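/- arXiv:1112.2161 — 4 statements merged into one kernel-verified Lean document; each statement's English description precedes it below -/
import Mathlib

section
/- Let p be a prime and let f : R → S be a flat ring homomorphism of F-finite Noetherian domains of characteristic p with regular fibers, i.e. for every prime ideal 𝔮 of S with 𝔭 = f^{-1}(𝔮), the localization of the fiber ring S ⊗_R κ(𝔭) at the prime corresponding to 𝔮 is a regular local ring (here κ(𝔭) denotes the residue field of R_𝔭). If R is strongly F-regular, then S is strongly F-regular. -/
/-- An `F`-finite Noetherian domain `R` of prime characteristic `p` is strongly
`F`-regular if for every nonzero `c ∈ R` there exist `e ≥ 1` and an `R`-linear map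
`φ : F^e_* R → R` (i.e. an additive map `φ : R → R` with `φ (r ^ p ^ e * x) = r * φ x`)
such that `φ c = 1`. -/
def IsStronglyFRegular (p : ℕ) (R : Type*) [CommRing R] : Prop :=
  ∀ c : R, c ≠ 0 → ∃ e : ℕ, 1 ≤ e ∧
    ∃ φ : R →+ R, (∀ r x : R, φ (r ^ p ^ e * x) = r * φ x) ∧ φ c = 1

/-- A ring `R` of prime characteristic `p` is `F`-finite if `F_* R`, i.e. `R` viewed as an
`R`-module via the Frobenius, is a finitely generated `R`-module. -/
def IsFFinite (p : ℕ) (R : Type*) [CommRing R] : Prop :=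
  ∃ s : Finset R, ∀ x : R, ∃ c : R → R, x = ∑ y ∈ s, c y ^ p * y

/-- A commutative ring is a regular local ring if it is Noetherian, local, and its
maximal ideal (equivalently, the Jacobson radical) is generated by `Krull dim` many
elements. -/
def IsRegularLocal (A : Type*) [CommRing A] : Prop :=
  IsNoetherianRing A ∧ IsLocalRing A ∧
    ∃ s : Finset A, Ideal.span (s : Set A) = (⊥ : Ideal A).jacobson ∧
      (s.card : WithBot (WithTop ℕ)) = ringKrullDim A

/-- The list `rs` is a (weakly) regular sequence modulo the ideal `I`. -/
def IsRegularModulo {T : Type*} [CommRing T] : Ideal T → List T → Prop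
  | _, [] => True
  | I, x :: rs => (∀ s, x * s ∈ I → s ∈ I) ∧ IsRegularModulo (I ⊔ Ideal.span {x}) rs

namespace IsRegularModulo

variable {T B : Type*} [CommRing T] [CommRing B]

theorem comap_sup_span {f : T →+* B} (hf : Function.Surjective f) (J : Ideal B) (x : T) :
    J.comap f ⊔ Ideal.span {x} = (J ⊔ Ideal.span {f x}).comap f := by
  ext t
  simp only [Ideal.mem_comap, Submodule.mem_sup, Ideal.mem_span_singleton']
  constructor
  · rintro ⟨a, ha, _, ⟨b, rfl⟩, rfl⟩
    exact ⟨f a, ha, _, ⟨f b, rfl⟩, by simp⟩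
  · rintro ⟨a, ha, _, ⟨b, rfl⟩, h⟩
    obtain ⟨b, rfl⟩ := hf b
    refine ⟨t - b * x, ?_, _, ⟨b, rfl⟩, by ring⟩
    rw [map_sub, map_mul, ← h]
    simpa using ha

theorem comap {f : T →+* B} (hf : Function.Surjective f) (rs : List T) (J : Ideal B)
    (h : IsRegularModulo J (rs.map f)) : IsRegularModulo (J.comap f) rs := by
  induction rs generalizing J with
  | nil => trivial
  | cons x rs ih =>
    refine ⟨fun s hs => h.1 (f s) (by simpa using hs), ?_⟩
    rw [comap_sup_span hf]
    exact ih _ h.2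

theorem mem_of_mul_mem_sup_pow {I : Ideal T} {x y : T} (hx : ∀ s, x * s ∈ I → s ∈ I)
    (hy : ∀ s, y * s ∈ I ⊔ Ideal.span {x} → s ∈ I ⊔ Ideal.span {x}) (j : ℕ) :
    ∀ s, y * s ∈ I ⊔ Ideal.span {x ^ j} → s ∈ I ⊔ Ideal.span {x ^ j} := by
  have key : ∀ {j : ℕ} {t : T}, t ∈ I ⊔ Ideal.span {x ^ j} ↔ ∃ b, t - b * x ^ j ∈ I := by
    intro j t
    simp only [Submodule.mem_sup, Ideal.mem_span_singleton']
    constructor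
    · rintro ⟨a, ha, _, ⟨b, rfl⟩, rfl⟩
      exact ⟨b, by simpa using ha⟩
    · rintro ⟨b, hb⟩
      exact ⟨_, hb, _, ⟨b, rfl⟩, by ring⟩
  have key1 : ∀ {t : T}, t ∈ I ⊔ Ideal.span {x} ↔ ∃ b, t - b * x ∈ I := by
    intro t; simpa using key (j := 1) (t := t)
  induction j with
  | zero => intro s _; simp
  | succ j ih =>
    intro s hs
    obtain ⟨b, hb⟩ := key.1 hs
    obtain ⟨c, hc⟩ := key1.1 (hy s (key1.2 ⟨b * x ^ j, by convert hb using 1; ring⟩))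
    have h1 : y * c - b * x ^ j ∈ I := by
      apply hx
      have := I.sub_mem hb (I.mul_mem_left y hc)
      convert this using 1; ring
    obtain ⟨d, hd⟩ := key.1 (ih c (key.2 ⟨b, h1⟩))
    refine key.2 ⟨d, ?_⟩
    have := I.add_mem hc (I.mul_mem_left x hd)
    convert this using 1; ring

theorem sup_pow {I : Ideal T} {x : T} {rs : List T} (j : ℕ) (hx : ∀ s, x * s ∈ I → s ∈ I)
    (h : IsRegularModulo (I ⊔ Ideal.span {x}) rs) :
    IsRegularModulo (I ⊔ Ideal.span {x ^ j}) rs := by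
  induction rs generalizing I with
  | nil => trivial
  | cons y rs ih =>
    refine ⟨mem_of_mul_mem_sup_pow hx h.1 j, ?_⟩
    have h2 := h.2
    rw [sup_right_comm] at h2 ⊢
    refine ih (fun s hs => ?_) h2
    simp only [Submodule.mem_sup, Ideal.mem_span_singleton'] at hs ⊢
    obtain ⟨a, ha, _, ⟨b, rfl⟩, hs⟩ := hs
    have hb : b ∈ I ⊔ Ideal.span {x} := by
      apply h.1
      simp only [Submodule.mem_sup, Ideal.mem_span_singleton']
      exact ⟨-a, I.neg_mem ha, _, ⟨s, rfl⟩, by linear_combination -hs⟩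
    simp only [Submodule.mem_sup, Ideal.mem_span_singleton'] at hb
    obtain ⟨a', ha', _, ⟨b', rfl⟩, rfl⟩ := hb
    refine ⟨s - b' * y, hx _ ?_, _, ⟨b', rfl⟩, by ring⟩
    have := I.add_mem ha (I.mul_mem_left y ha')
    convert this using 1
    linear_combination -hs

theorem map_pow {I : Ideal T} {rs : List T} (q : ℕ) (h : IsRegularModulo I rs) :
    IsRegularModulo I (rs.map (· ^ q)) := by
  induction rs generalizing I with
  | nil => trivial
  | cons x rs ih =>
    refine ⟨?_, ih (sup_pow q h.1 h.2)⟩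
    clear ih
    induction q with
    | zero => intro s hs; simpa using hs
    | succ q ihq => exact fun s hs => ihq _ (h.1 _ (by rwa [← mul_assoc, ← pow_succ']))

end IsRegularModulo

namespace IsLocalRing

theorem comap_maximalIdeal_of_surjective {A B : Type*} [CommRing A] [CommRing B] [IsLocalRing A]
    [IsLocalRing B] {f : A →+* B} (hf : Function.Surjective f) :
    (maximalIdeal B).comap f = maximalIdeal A :=
  have := IsLocalHom.of_surjective f hf
  maximalIdeal_comap f

variable {B : Type*} [CommRing B] [IsLocalRing B] [IsNoetherianRing B]

theorem exists_mem_maximalIdeal_notMem_sq (h : 0 < ringKrullDim B) :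
    ∃ x ∈ maximalIdeal B, x ∉ maximalIdeal B ^ 2 ∧ ∀ P ∈ minimalPrimes B, x ∉ P := by
  by_contra! H
  have hsub : (maximalIdeal B : Set B) ⊆
      ⋃ i ∈ insert (maximalIdeal B ^ 2) (minimalPrimes B), ((i : Ideal B) : Set B) := by
    intro x hx
    by_cases hx2 : x ∈ maximalIdeal B ^ 2
    · exact Set.mem_biUnion (Set.mem_insert _ _) hx2
    · obtain ⟨P, hP, hxP⟩ := H x hx hx2
      exact Set.mem_biUnion (Set.mem_insert_of_mem _ hP) hxP
  rw [Ideal.subset_union_prime_finite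
    ((minimalPrimes.finite_of_isNoetherianRing B).insert _) (f := fun i => i)
    (maximalIdeal B ^ 2) (maximalIdeal B ^ 2)] at hsub
  · obtain ⟨P, hP | hP, hle⟩ := hsub
    · subst hP
      have : maximalIdeal B = ⊥ :=
        Submodule.eq_bot_of_le_smul_of_le_jacobson_bot (maximalIdeal B) _
          (IsNoetherian.noetherian _) (by rwa [smul_eq_mul, ← sq])
          (maximalIdeal_le_jacobson _)
      rw [ringKrullDim_eq_zero_of_isField (isField_iff_maximalIdeal_eq.2 this)] at h
      exact lt_irrefl _ h
    · have hPp : P.IsPrime := hP.1.1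
      have heq : P = maximalIdeal B := le_antisymm (le_maximalIdeal hPp.ne_top) hle
      rw [← maximalIdeal_height_eq_ringKrullDim, ← heq, Ideal.height_eq_zero_iff.2 hP] at h
      simp at h
  · intro i hi hia _
    exact (hi.resolve_left hia).1.1

omit [IsNoetherianRing B] in
/-- Exchange of a generator of the maximal ideal. -/
theorem exists_erase_span_sup_eq [DecidableEq B] {s : Finset B}
    (hs : Ideal.span (s : Set B) = maximalIdeal B)
    {x : B} (hx : x ∈ maximalIdeal B) (hx2 : x ∉ maximalIdeal B ^ 2) :
    ∃ a ∈ s, Ideal.span {x} ⊔ Ideal.span (s.erase a : Set B) = maximalIdeal B := by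
  obtain ⟨f, -, rfl⟩ := Submodule.mem_span_finset.1 (hs ▸ hx)
  have hmem : ∀ a ∈ s, a ∈ maximalIdeal B := fun a ha => hs ▸ Ideal.subset_span ha
  obtain ⟨a, ha, hu⟩ : ∃ a ∈ s, IsUnit (f a) := by
    by_contra! H
    refine hx2 (Ideal.sum_mem _ fun a ha => ?_)
    rw [sq]
    exact Ideal.mul_mem_mul ((mem_maximalIdeal _).2 (H a ha)) (hmem a ha)
  refine ⟨a, ha, le_antisymm (sup_le ?_ ?_) ?_⟩
  · rwa [Ideal.span_singleton_le_iff_mem]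
  · exact Ideal.span_le.2 fun b hb => hmem b (Finset.mem_of_mem_erase hb)
  · rw [← hs, Ideal.span_le]
    intro b hb
    by_cases hba : b = a
    · subst hba
      have h1 : f b * b = (∑ a ∈ s, f a • a) - ∑ a ∈ s.erase b, f a • a := by
        rw [← Finset.add_sum_erase s _ ha]; simp
      refine (Ideal.unit_mul_mem_iff_mem _ hu).1 ?_
      rw [h1]
      exact Ideal.sub_mem _ (Ideal.mem_sup_left (Ideal.mem_span_singleton_self _))
        (Ideal.mem_sup_right (Ideal.sum_mem _ fun c hc =>
          Ideal.mul_mem_left _ _ (Ideal.subset_span hc)))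
    · exact Ideal.mem_sup_right (Ideal.subset_span (Finset.mem_erase.2 ⟨hba, hb⟩))

end IsLocalRing

open IsLocalRing in
/-- A regular local ring is a domain whose maximal ideal is generated by a regular sequence. -/
theorem isDomain_and_exists_isRegularModulo_of_card_le (n : ℕ) : ∀ (B : Type*) [CommRing B]
    [IsLocalRing B]
    [IsNoetherianRing B] (s : Finset B), Ideal.span (s : Set B) = maximalIdeal B →
    s.card ≤ n → n ≤ ringKrullDim B →
    IsDomain B ∧ ∃ rs : List B, IsRegularModulo ⊥ rs ∧ Ideal.ofList rs = maximalIdeal B := by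
  classical
  induction n with
  | zero =>
    intro B _ _ _ s hs hc _
    have hs0 : s = ∅ := by simpa using hc
    have : maximalIdeal B = ⊥ := by rw [← hs, hs0]; simp
    refine ⟨(isField_iff_maximalIdeal_eq.2 this).isDomain, [], trivial, ?_⟩
    rw [this, Ideal.ofList_nil]
  | succ n ih =>
    intro B _ _ _ s hs hc hd
    have hd0 : 0 < ringKrullDim B := lt_of_lt_of_le (by exact_mod_cast n.succ_pos) hd
    obtain ⟨x, hx, hx2, hxP⟩ := exists_mem_maximalIdeal_notMem_sq hd0
    obtain ⟨a, ha, hsup⟩ := exists_erase_span_sup_eq hs hx hx2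
    set I : Ideal B := Ideal.span {x} with hI
    have hIm : I ≤ maximalIdeal B := (Ideal.span_singleton_le_iff_mem _).2 hx
    have hItop : I ≠ ⊤ := fun h => (maximalIdeal.isMaximal B).ne_top (top_le_iff.1 (h ▸ hIm))
    have : Nontrivial (B ⧸ I) := Ideal.Quotient.nontrivial_iff.2 hItop
    have hsurj := Ideal.Quotient.mk_surjective (I := I)
    have : IsLocalRing (B ⧸ I) := IsLocalRing.of_surjective' _ hsurj
    have hcm := comap_maximalIdeal_of_surjective hsurj
    have hmax : (maximalIdeal B).map (Ideal.Quotient.mk I) = maximalIdeal (B ⧸ I) := by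
      rw [← hcm, Ideal.map_comap_of_surjective _ hsurj]
    obtain ⟨hdom, rs, hrs, hrs'⟩ := ih (B ⧸ I) ((s.erase a).image (Ideal.Quotient.mk I)) (by
        rw [← hmax, ← hsup, Ideal.map_sup, Ideal.map_span, Ideal.map_span, Finset.coe_image]
        have : (Ideal.Quotient.mk I) x = 0 :=
          Ideal.Quotient.eq_zero_iff_mem.2 (Ideal.mem_span_singleton_self x)
        simp [this]) (by
        refine Finset.card_image_le.trans ?_
        rw [Finset.card_erase_of_mem ha]; omega) (by
        have := ringKrullDim_le_ringKrullDim_quotient_add_card (R := B) {x} (by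
          simpa [IsLocalRing.ringJacobson_eq_maximalIdeal] using hx)
        rw [Finset.coe_singleton, Finset.card_singleton] at this
        have h2 := hd.trans this
        push_cast at h2
        exact ENat.WithBot.add_le_add_one_right_iff.1 (by simpa using h2))
    have hIp : I.IsPrime := (Ideal.Quotient.isDomain_iff_prime I).1 hdom
    obtain ⟨P, hP, hPI⟩ := Ideal.exists_minimalPrimes_le (bot_le : ⊥ ≤ I)
    have hPp : P.IsPrime := hP.1.1
    have hP0 : P = ⊥ := by
      refine Submodule.eq_bot_of_le_smul_of_le_jacobson_bot (maximalIdeal B) _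
          (IsNoetherian.noetherian _) (fun y hy => ?_) (maximalIdeal_le_jacobson _)
      obtain ⟨b, rfl⟩ := Ideal.mem_span_singleton'.1 (hPI hy)
      rw [mul_comm]
      exact Submodule.smul_mem_smul hx ((hPp.mem_or_mem hy).resolve_right (hxP P hP))
    have hB : IsDomain B := by
      subst hP0
      exact IsDomain.of_bot_isPrime B
    refine ⟨hB, ?_⟩
    obtain ⟨rs, rfl⟩ : ∃ ts : List B, ts.map (Ideal.Quotient.mk I) = rs :=
      ⟨rs.map (Function.surjInv hsurj), by simp⟩
    have hx0 : x ≠ 0 := fun h => hx2 (h ▸ Ideal.zero_mem _)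
    refine ⟨x :: rs, ⟨fun t ht => ?_, ?_⟩, ?_⟩
    · simpa [hx0] using ht
    · have := IsRegularModulo.comap hsurj _ _ hrs
      rw [← RingHom.ker, Ideal.mk_ker] at this
      simpa using this
    · rw [Ideal.ofList_cons, ← hcm, ← hrs', ← Ideal.map_ofList,
        Ideal.comap_map_of_surjective' _ hsurj, Ideal.mk_ker, sup_comm]

open IsLocalRing in
theorem IsRegularLocal.exists_isRegularModulo {T : Type*} [CommRing T] [IsLocalRing T] {I : Ideal T}
    (h : IsRegularLocal (T ⧸ I)) :
    ∃ rs : List T, IsRegularModulo I rs ∧ I ⊔ Ideal.ofList rs = maximalIdeal T := by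
  obtain ⟨h1, h2, s, hs, hc⟩ := h
  rw [jacobson_eq_maximalIdeal _ bot_ne_top] at hs
  obtain ⟨-, rs, hrs, hrs'⟩ := isDomain_and_exists_isRegularModulo_of_card_le s.card _ s hs le_rfl
    hc.le
  have hsurj := Ideal.Quotient.mk_surjective (I := I)
  obtain ⟨rs, rfl⟩ : ∃ ts : List T, ts.map (Ideal.Quotient.mk I) = rs :=
      ⟨rs.map (Function.surjInv hsurj), by simp⟩
  refine ⟨rs, ?_, ?_⟩
  · have := IsRegularModulo.comap hsurj _ _ hrs
    rwa [← RingHom.ker, Ideal.mk_ker] at this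
  · rw [← comap_maximalIdeal_of_surjective hsurj, ← hrs', ← Ideal.map_ofList,
        Ideal.comap_map_of_surjective' _ hsurj, Ideal.mk_ker, sup_comm]

section

open TensorProduct

theorem exists_smul_notMem_forall_smul_mem {R Q : Type*} [CommRing R] [AddCommGroup Q] [Module R Q]
    {m : Ideal R} {N : Submodule R Q} (k : ℕ) : ∀ (y : Q), y ∉ N → (∀ r ∈ m ^ k, r • y ∈ N) →
    ∃ r : R, r • y ∉ N ∧ ∀ a ∈ m, a • r • y ∈ N := by
  induction k with
  | zero => exact fun y hy h => absurd (by simpa using h 1 (by simp)) hy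
  | succ k ih =>
    intro y hy h
    by_cases H : ∀ a ∈ m, a • y ∈ N
    · exact ⟨1, by simpa using hy, by simpa using H⟩
    push Not at H
    obtain ⟨a, ha, hay⟩ := H
    obtain ⟨r, hr, hr'⟩ := ih (a • y) hay fun r hr => by
      rw [smul_smul]; exact h _ (by rw [pow_succ]; exact Ideal.mul_mem_mul hr ha)
    exact ⟨r * a, by rwa [mul_smul], fun b hb => by rw [mul_smul]; exact hr' b hb⟩

/-- The vanishing of `Tor₁(M, R / m)`, formulated as injectivity of `M ⊗ m → M`. -/
def IsFlatAt {R : Type*} [CommRing R] (m : Ideal R) (M : Type*) [AddCommGroup M] [Module R M] :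
    Prop :=
  Function.Injective ((Submodule.subtype m).lTensor M)

namespace IsFlatAt

variable {R : Type*} [CommRing R] {m : Ideal R} {M : Type*} [AddCommGroup M] [Module R M]

theorem of_flat [Module.Flat R M] : IsFlatAt m M :=
  Module.Flat.lTensor_preserves_injective_linearMap _ (Submodule.subtype_injective m)

/-- Enlarging a submodule by a copy of `R / m`. -/
theorem lTensor_injective_of_smul_mem (hM : IsFlatAt m M) [hm : m.IsMaximal] {N N' : Type*}
    [AddCommGroup N]
    [Module R N] [AddCommGroup N'] [Module R N'] (i : N →ₗ[R] N') (hi : Function.Injective i)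
    (x : N') (hx : x ∉ LinearMap.range i) (hmx : ∀ a ∈ m, a • x ∈ LinearMap.range i)
    (hsup : LinearMap.range i ⊔ Submodule.span R {x} = ⊤) :
    Function.Injective (i.lTensor M) := by
  have hmem : ∀ r : R, r • x ∈ LinearMap.range i → r ∈ m := by
    intro r hr
    by_contra hrm
    obtain ⟨b, c, hc, h⟩ := hm.exists_inv hrm
    apply hx
    rw [← one_smul R x, ← h, add_smul, mul_smul]
    exact add_mem (Submodule.smul_mem _ _ hr) (hmx c hc)
  choose g hg using fun a : m => hmx a a.2
  let α : m →ₗ[R] N × R :=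
    { toFun := fun a => (-g a, a)
      map_add' := fun a b => by
        ext
        · apply hi; simp [hg, add_smul, add_comm]
        · simp
      map_smul' := fun r a => by
        ext
        · apply hi; simp [hg, mul_smul]
        · simp }
  let β : N × R →ₗ[R] N' := i.coprod (LinearMap.toSpanSingleton R N' x)
  have hβ : Function.Surjective β := by
    rw [← LinearMap.range_eq_top, LinearMap.range_coprod, LinearMap.range_toSpanSingleton, hsup]
  have hex : Function.Exact α β := by
    rintro ⟨n, r⟩
    constructor
    · intro h
      have h : i n + r • x = 0 := h
      have hr : r ∈ m := hmem r ⟨-n, by rw [map_neg]; exact neg_eq_of_add_eq_zero_right h⟩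
      refine ⟨⟨r, hr⟩, ?_⟩
      ext
      · apply hi
        simp only [α, LinearMap.coe_mk, AddHom.coe_mk, map_neg, hg]
        exact neg_eq_of_add_eq_zero_left h
      · rfl
    · rintro ⟨a, ha⟩
      rw [← ha]
      simp [α, β, hg, LinearMap.coprod_apply]
  rw [injective_iff_map_eq_zero]
  intro w hw
  have h1 : β.lTensor M ((LinearMap.inl R N R).lTensor M w) = 0 := by
    rw [← LinearMap.comp_apply, ← LinearMap.lTensor_comp, LinearMap.coprod_inl, hw]
  obtain ⟨θ, hθ⟩ := (lTensor_exact M hex hβ _).1 h1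
  have h2 : (Submodule.subtype m).lTensor M θ = 0 := by
    have : Submodule.subtype m = LinearMap.snd R N R ∘ₗ α := rfl
    rw [this, LinearMap.lTensor_comp, LinearMap.comp_apply, hθ, ← LinearMap.comp_apply,
      ← LinearMap.lTensor_comp, LinearMap.snd_comp_inl]
    simp
  have h3 : θ = 0 := hM (by rw [h2, map_zero])
  rw [h3, map_zero] at hθ
  have := congrArg ((LinearMap.fst R N R).lTensor M) hθ
  rw [← LinearMap.comp_apply, ← LinearMap.lTensor_comp, LinearMap.fst_comp_inl] at this
  simpa using this.symm

theorem lTensor_subtype_injective (hM : IsFlatAt m M) [hm : m.IsMaximal] {D : Type*}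
    [AddCommGroup D]
    [Module R D] [IsNoetherian R D] (k : ℕ) (hk : ∀ r ∈ m ^ k, ∀ d : D, r • d = 0)
    (D₁ : Submodule R D) : Function.Injective (D₁.subtype.lTensor M) := by
  induction D₁ using WellFoundedGT.induction with
  | _ D₁ ih =>
  by_cases htop : D₁ = ⊤
  · subst htop
    exact (LinearEquiv.lTensor M Submodule.topEquiv).injective
  obtain ⟨y, hy⟩ : ∃ y, y ∉ D₁ := by
    by_contra! h; exact htop (Submodule.eq_top_iff'.2 h)
  obtain ⟨r, hr, hr'⟩ := exists_smul_notMem_forall_smul_mem (m := m) (N := D₁) k y hy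
    fun r hr => by simp [hk r hr]
  set x := r • y
  have hle : D₁ ≤ D₁ ⊔ Submodule.span R {x} := le_sup_left
  have hxm : x ∈ D₁ ⊔ Submodule.span R {x} :=
    Submodule.mem_sup_right (Submodule.mem_span_singleton_self x)
  have hlt : D₁ < D₁ ⊔ Submodule.span R {x} :=
    lt_of_le_of_ne hle fun h => hr (h ▸ hxm)
  rw [← Submodule.subtype_comp_inclusion _ _ hle, LinearMap.lTensor_comp]
  refine (ih _ hlt).comp (hM.lTensor_injective_of_smul_mem _ (Submodule.inclusion_injective hle)
    ⟨x, hxm⟩ ?_ ?_ ?_)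
  · rintro ⟨z, hz⟩
    exact hr (by rw [← show (z : D) = x from congrArg Subtype.val hz]; exact z.2)
  · exact fun a ha => ⟨⟨a • x, hr' a ha⟩, rfl⟩
  · rw [eq_top_iff]
    rintro ⟨z, hz⟩ -
    obtain ⟨a, ha, b, hb, rfl⟩ := Submodule.mem_sup.1 hz
    obtain ⟨c, rfl⟩ := Submodule.mem_span_singleton.1 hb
    refine Submodule.mem_sup.2 ⟨⟨a, hle ha⟩, ⟨⟨a, ha⟩, rfl⟩, ⟨c • x, Submodule.smul_mem _ _ hxm⟩,
      Submodule.mem_span_singleton.2 ⟨c, rfl⟩, rfl⟩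

theorem lTensor_injective (hM : IsFlatAt m M) [hm : m.IsMaximal] {C D : Type*} [AddCommGroup C]
    [Module R C] [AddCommGroup D] [Module R D] [IsNoetherian R D] (k : ℕ)
    (hk : ∀ r ∈ m ^ k, ∀ d : D, r • d = 0) (i : C →ₗ[R] D) (hi : Function.Injective i) :
    Function.Injective (i.lTensor M) := by
  have : i = (LinearMap.range i).subtype ∘ₗ (LinearEquiv.ofInjective i hi).toLinearMap := rfl
  rw [this, LinearMap.lTensor_comp]
  exact (hM.lTensor_subtype_injective k hk _).comp
    (LinearEquiv.lTensor M (LinearEquiv.ofInjective i hi)).injective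

theorem tmul_ne_zero (hM : IsFlatAt m M) [hm : m.IsMaximal] {Q : Type*} [AddCommGroup Q]
    [Module R Q] [IsNoetherian R Q] (k : ℕ) (hk : ∀ r ∈ m ^ k, ∀ d : Q, r • d = 0)
    {d : M} (hd : d ∉ m • (⊤ : Submodule R M)) {y : Q} (hy : y ≠ 0) :
    d ⊗ₜ[R] y ≠ 0 := by
  intro h0
  obtain ⟨r, hr, hr'⟩ := exists_smul_notMem_forall_smul_mem (m := m) (N := ⊥) k y
    (by simpa using hy)
    fun r hr => by simp [hk r hr]
  have h1 : d ⊗ₜ[R] (r • y) = 0 := by rw [TensorProduct.tmul_smul, h0, smul_zero]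
  let i : (R ⧸ m) →ₗ[R] Q := Submodule.liftQ m (LinearMap.toSpanSingleton R Q (r • y))
    fun a ha => by simpa using hr' a ha
  have hi : Function.Injective i := by
    rw [injective_iff_map_eq_zero]
    intro b hb
    obtain ⟨b, rfl⟩ := Ideal.Quotient.mk_surjective b
    rw [Ideal.Quotient.eq_zero_iff_mem]
    have hb : b • r • y = 0 := hb
    by_contra hbm
    obtain ⟨e, c, hc, h⟩ := hm.exists_inv hbm
    apply hr
    rw [Submodule.mem_bot, ← one_smul R (r • y), ← h, add_smul, mul_smul, hb, smul_zero, zero_add]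
    simpa using hr' c hc
  have h2 : d ⊗ₜ[R] (1 : R ⧸ m) = 0 := hM.lTensor_injective k hk i hi (by
    rw [map_zero, LinearMap.lTensor_tmul, ← h1]
    congr 1
    exact one_smul R _)
  have h3 := congrArg (TensorProduct.tensorQuotEquivQuotSMul M m) h2
  apply hd
  rw [map_zero, ← map_one (Ideal.Quotient.mk m), tensorQuotEquivQuotSMul_tmul_mk, one_smul] at h3
  simpa using h3


open Polynomial in
/-- Adjoining a variable that acts through an element which is regular modulo `m`. -/
theorem polynomial {T : Type*} [CommRing T] [Algebra R T] [Algebra R[X] T] [IsScalarTower R R[X] T]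
    (hT : IsFlatAt m T)
    (hx : ∀ s, algebraMap R[X] T X * s ∈ m.map (algebraMap R T) → s ∈ m.map (algebraMap R T)) :
    IsFlatAt (m.comap constantCoeff) T := by
  set m₁ : Ideal R[X] := m.comap constantCoeff with hm₁
  have hC : ∀ a ∈ m, C a ∈ m₁ := fun a ha => by simpa [hm₁] using ha
  have hX : (X : R[X]) ∈ m₁ := by simp [hm₁]
  let ι : T ⊗[R] m →ₗ[R] T ⊗[R[X]] m₁ := TensorProduct.lift <|
    LinearMap.mk₂ R (fun t a => t ⊗ₜ ⟨C a.1, hC a.1 a.2⟩)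
      (fun _ _ _ => TensorProduct.add_tmul _ _ _)
      (fun r t a => (TensorProduct.smul_tmul' r t _).symm)
      (fun t a b => by
        rw [← TensorProduct.tmul_add]; congr 1; ext1; simp)
      (fun r t a => by
        rw [TensorProduct.smul_tmul', ← algebraMap_smul R[X] r t, TensorProduct.smul_tmul]
        congr 1; ext1; simp)
  have hι : ∀ t (a : m), ι (t ⊗ₜ a) = t ⊗ₜ ⟨C a.1, hC a.1 a.2⟩ := fun _ _ => rfl
  have hdec : ∀ θ : T ⊗[R[X]] m₁, ∃ θ₀ s, θ = ι θ₀ + s ⊗ₜ ⟨X, hX⟩ := by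
    intro θ
    induction θ with
    | zero => exact ⟨0, 0, by simp⟩
    | add a b ha hb =>
      obtain ⟨a₀, s, rfl⟩ := ha
      obtain ⟨b₀, t, rfl⟩ := hb
      exact ⟨a₀ + b₀, s + t, by rw [map_add, TensorProduct.add_tmul]; abel⟩
    | tmul t f =>
      obtain ⟨f, hf⟩ := f
      have hf0 : f.coeff 0 ∈ m := hf
      refine ⟨t ⊗ₜ ⟨f.coeff 0, hf0⟩, f.divX • t, ?_⟩
      rw [hι, TensorProduct.smul_tmul, ← TensorProduct.tmul_add]
      congr 1; ext1
      simpa [add_comm] using (divX_mul_X_add f).symm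
  let μ : T ⊗[R[X]] m₁ →ₗ[R[X]] T :=
    (TensorProduct.rid R[X] T).toLinearMap ∘ₗ (Submodule.subtype m₁).lTensor T
  let μ₀ : T ⊗[R] m →ₗ[R] T :=
    (TensorProduct.rid R T).toLinearMap ∘ₗ (Submodule.subtype m).lTensor T
  have hμ₀ : Function.Injective μ₀ := (TensorProduct.rid R T).injective.comp hT
  suffices hμ : Function.Injective μ from Function.Injective.of_comp hμ
  have hμι : ∀ θ, μ (ι θ) = μ₀ θ := by
    intro θ
    induction θ with
    | zero => simp
    | add a b ha hb => rw [map_add, map_add, map_add, ha, hb]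
    | tmul t a =>
      rw [hι]
      change C a.1 • t = a.1 • t
      rw [← algebraMap_smul R[X] a.1 t]; rfl
  have hμ₀mem : ∀ θ, μ₀ θ ∈ m.map (algebraMap R T) := by
    intro θ
    induction θ with
    | zero => simp
    | add a b ha hb => rw [map_add]; exact add_mem ha hb
    | tmul t a =>
      change a.1 • t ∈ _
      rw [Algebra.smul_def]
      exact Ideal.mul_mem_right _ _ (Ideal.mem_map_of_mem _ a.2)
  have hXmem : ∀ s ∈ m.map (algebraMap R T), ∀ t : T,
      ∃ θ₀, ι θ₀ = (t * s) ⊗ₜ ⟨X, hX⟩ := by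
    intro s hs
    induction hs using Submodule.span_induction with
    | mem s hs =>
      intro t
      obtain ⟨a, ha, rfl⟩ := hs
      refine ⟨((X : R[X]) • t) ⊗ₜ ⟨a, ha⟩, ?_⟩
      have : t * algebraMap R T a = (C a : R[X]) • t := by
        rw [Algebra.smul_def, mul_comm, IsScalarTower.algebraMap_apply R R[X] T]; rfl
      rw [this, hι, TensorProduct.smul_tmul, TensorProduct.smul_tmul]
      congr 1; ext1
      exact mul_comm X (C a)
    | zero => exact fun t => ⟨0, by simp⟩
    | add a b _ _ ha hb =>
      intro t
      obtain ⟨a₀, ha⟩ := ha t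
      obtain ⟨b₀, hb⟩ := hb t
      exact ⟨a₀ + b₀, by rw [map_add, ha, hb, mul_add, TensorProduct.add_tmul]⟩
    | smul b s _ ih =>
      intro t
      obtain ⟨θ₀, h⟩ := ih (t * b)
      exact ⟨θ₀, by rw [h, smul_eq_mul, mul_assoc]⟩
  rw [injective_iff_map_eq_zero]
  intro θ hθ
  obtain ⟨θ₀, s, rfl⟩ := hdec θ
  have hs : algebraMap R[X] T X * s ∈ m.map (algebraMap R T) := by
    rw [map_add, hμι] at hθ
    have h1 : μ (s ⊗ₜ ⟨X, hX⟩) = algebraMap R[X] T X * s := by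
      rw [← Algebra.smul_def]; rfl
    rw [h1] at hθ
    rw [← neg_eq_of_add_eq_zero_right hθ]
    exact neg_mem (hμ₀mem _)
  obtain ⟨θ₁, hθ₁⟩ := hXmem s (hx s hs) 1
  rw [one_mul] at hθ₁
  rw [← hθ₁, ← map_add] at hθ ⊢
  rw [hμι] at hθ
  rw [hμ₀ (hθ.trans (map_zero _).symm), map_zero]

open Polynomial in
theorem map_comap_constantCoeff {T : Type*} [CommRing T] [Algebra R T] [Algebra R[X] T]
    [IsScalarTower R R[X] T] (m : Ideal R) :
    (m.comap constantCoeff).map (algebraMap R[X] T) =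
      m.map (algebraMap R T) ⊔ Ideal.span {algebraMap R[X] T X} := by
  apply le_antisymm
  · rw [Ideal.map_le_iff_le_comap]
    intro f hf
    have hf0 : f.coeff 0 ∈ m := hf
    rw [Ideal.mem_comap, ← divX_mul_X_add f, map_add, map_mul]
    refine add_mem (Ideal.mem_sup_right (Ideal.mul_mem_left _ _ (Ideal.mem_span_singleton_self _)))
      (Ideal.mem_sup_left ?_)
    have : algebraMap R[X] T (C (f.coeff 0)) = algebraMap R T (f.coeff 0) :=
      (IsScalarTower.algebraMap_apply R R[X] T _).symm
    rw [this]
    exact Ideal.mem_map_of_mem _ hf0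
  · refine sup_le ?_ ?_
    · rw [Ideal.map_le_iff_le_comap]
      intro a ha
      rw [Ideal.mem_comap, IsScalarTower.algebraMap_apply R R[X] T]
      exact Ideal.mem_map_of_mem _ (by simpa using ha)
    · rw [Ideal.span_singleton_le_iff_mem]
      exact Ideal.mem_map_of_mem _ (by simp)

end IsFlatAt

end

theorem RingHom.finite_of_forall_eq_sum {R S : Type*} [CommRing R] [CommRing S] (f : R →+* S)
    (s : Finset S) (hs : ∀ x, ∃ c : S → R, x = ∑ y ∈ s, f (c y) * y) : f.Finite := by
  let := f.toAlgebra
  refine ⟨⟨s, Submodule.eq_top_iff'.2 fun x => ?_⟩⟩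
  obtain ⟨c, hc⟩ := hs x
  rw [hc]
  exact Submodule.sum_mem _ fun y hy => Submodule.smul_mem _ (c y) (Submodule.subset_span hy)

theorem IsFFinite.finite_iterateFrobenius {p : ℕ} {R : Type*} [CommRing R] [ExpChar R p]
    (h : IsFFinite p R) (e : ℕ) : (iterateFrobenius R p e).Finite := by
  have h1 : (frobenius R p).Finite := by
    obtain ⟨s, hs⟩ := h
    exact RingHom.finite_of_forall_eq_sum _ s hs
  induction e with
  | zero => rw [iterateFrobenius_zero]; exact RingHom.Finite.id R
  | succ e ih =>
    have : iterateFrobenius R p (e + 1) = (frobenius R p).comp (iterateFrobenius R p e) := by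
      ext x; simp [iterateFrobenius_def, frobenius_def, pow_succ, pow_mul]
    rw [this]
    exact h1.comp ih

/-- For `F`-finite rings the quotients by powers of an ideal are finite over the quotient by
the ideal itself, via a power of the Frobenius. -/
theorem IsFFinite.exists_finite_quotient_pow {p : ℕ} [hp : Fact p.Prime] {R : Type*} [CommRing R]
    [CharP R p] (h : IsFFinite p R) (m : Ideal R) (l : ℕ) :
    ∃ ρ : R ⧸ m →+* R ⧸ m ^ l, ρ.Finite := by
  obtain ⟨e, he⟩ : ∃ e, l ≤ p ^ e := ⟨l, (Nat.lt_pow_self hp.out.one_lt).le⟩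
  let ρ : R ⧸ m →+* R ⧸ m ^ l :=
    Ideal.Quotient.lift m ((Ideal.Quotient.mk (m ^ l)).comp (iterateFrobenius R p e)) fun a ha => by
      rw [RingHom.comp_apply, Ideal.Quotient.eq_zero_iff_mem, iterateFrobenius_def]
      exact Ideal.pow_le_pow_right he (Ideal.pow_mem_pow ha _)
  refine ⟨ρ, RingHom.Finite.of_comp_finite (f := Ideal.Quotient.mk m) ?_⟩
  rw [Ideal.Quotient.lift_comp_mk]
  exact (RingHom.Finite.of_surjective _ Ideal.Quotient.mk_surjective).comp
    (h.finite_iterateFrobenius e)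

theorem exists_forall_apply_mul_eq {K L : Type*} [Field K] [Field L] [Algebra K L]
    [Module.Finite K L]
    {δ : L →ₗ[K] K} (hδ : δ ≠ 0) (τ : L →ₗ[K] K) : ∃ b, ∀ x, δ (b * x) = τ x := by
  let Φ : L →ₗ[K] Module.Dual K L := (LinearMap.llcomp K L L K δ) ∘ₗ LinearMap.mul K L
  have hΦ : Function.Injective Φ := by
    rw [injective_iff_map_eq_zero]
    intro b hb
    by_contra hb0
    apply hδ
    ext x
    have := LinearMap.congr_fun hb (b⁻¹ * x)
    simpa [Φ, hb0] using this
  obtain ⟨b, hb⟩ := (LinearMap.injective_iff_surjective_of_finrank_eq_finrank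
    (Subspace.dual_finrank_eq).symm).1 hΦ τ
  exact ⟨b, fun x => LinearMap.congr_fun hb x⟩

/-- The dual of an Artinian local algebra over a field. -/
theorem exists_dualizing_module.{u} (K A : Type u) [Field K] [CommRing A] [Algebra K A]
    [Module.Finite K A]
    (I : Ideal A) [hI : I.IsMaximal] (l : ℕ) (hl : I ^ l = ⊥) :
    ∃ (D : Type u) (_ : AddCommGroup D) (_ : Module A D), Module.Finite A D ∧ ∃ u : D, u ≠ 0 ∧
      (∀ a ∈ I, a • u = 0) ∧ (∀ δ : D, δ ≠ 0 → ∃ a : A, a • δ = u) ∧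
      ∀ a : A, (∀ δ : D, a • δ = 0) → a = 0 := by
  let : Module A (A →ₗ[K] K) :=
    { smul := fun a δ => δ ∘ₗ LinearMap.mulLeft K a
      one_smul := fun δ => by ext x; exact congrArg δ (one_mul x)
      mul_smul := fun a b δ => by
        ext x; exact congrArg δ (show (a * b) * x = b * (a * x) by ring)
      smul_zero := fun a => rfl
      smul_add := fun a δ δ' => rfl
      add_smul := fun a b δ => by
        ext x; exact (congrArg δ (add_mul a b x)).trans (map_add δ _ _)
      zero_smul := fun δ => by
        ext x; exact (congrArg δ (zero_mul x)).trans (map_zero δ) }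
  have hsmul : ∀ (a : A) (δ : A →ₗ[K] K) (x : A), (a • δ) x = δ (a * x) := fun _ _ _ => rfl
  have htower : IsScalarTower K A (A →ₗ[K] K) := ⟨fun k a δ => by
    ext x; rw [hsmul, LinearMap.smul_apply, hsmul, ← map_smul, smul_mul_assoc]⟩
  let : Field (A ⧸ I) := Ideal.Quotient.field I
  obtain ⟨τ, hτ⟩ : ∃ τ : A ⧸ I →ₗ[K] K, τ 1 ≠ 0 := by
    by_contra! H
    exact one_ne_zero ((Module.forall_dual_apply_eq_zero_iff K (1 : A ⧸ I)).1 H)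
  let π : A →ₗ[K] A ⧸ I := (Ideal.Quotient.mkₐ K I).toLinearMap
  have hπ : ∀ a, π a = Ideal.Quotient.mk I a := fun _ => rfl
  refine ⟨A →ₗ[K] K, inferInstance, inferInstance,
    Module.Finite.of_restrictScalars_finite K A _, τ ∘ₗ π, fun h => hτ ?_, fun a ha => ?_,
    fun δ hδ => ?_, fun a ha => ?_⟩
  · simpa [hπ] using LinearMap.congr_fun h 1
  · ext x
    rw [hsmul, LinearMap.comp_apply, hπ, Ideal.Quotient.eq_zero_iff_mem.2 (I.mul_mem_right x ha)]
    simp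
  · obtain ⟨a, ha, ha'⟩ := exists_smul_notMem_forall_smul_mem (m := I) (N := (⊥ : Submodule A _))
      l δ (by simpa using hδ) (by simp [hl])
    let δ' : A ⧸ I →ₗ[K] K := Submodule.liftQ (I.restrictScalars K) (a • δ) fun x hx => by
      have := LinearMap.congr_fun ((Submodule.mem_bot A).1 (ha' x hx)) 1
      rwa [hsmul, mul_one] at this
    have hδ' : ∀ x, δ' (π x) = (a • δ) x := fun _ => rfl
    have hδ0 : δ' ≠ 0 := fun h => ha (by
      rw [Submodule.mem_bot]; ext x; rw [← hδ', h]; rfl)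
    obtain ⟨b, hb⟩ := exists_forall_apply_mul_eq hδ0 τ
    obtain ⟨b, rfl⟩ := Ideal.Quotient.mk_surjective b
    refine ⟨b * a, ?_⟩
    ext x
    rw [mul_smul, hsmul, ← hδ', LinearMap.comp_apply, ← hb]
    rfl
  · by_contra h
    apply h
    rw [← Module.forall_dual_apply_eq_zero_iff K]
    intro δ
    simpa [hsmul] using LinearMap.congr_fun (ha δ) 1

/-- Let `W` be a faithful module over a finite algebra over a field, all of whose nonzero
submodules contain `ε ≠ 0`. Then every nonzero element of any module survives in `W`. -/
theorem exists_linearMap_apply_ne_zero {K A W N : Type*} [Field K] [CommRing A] [Algebra K A]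
    [Module.Finite K A]
    [AddCommGroup W] [Module A W] [Module K W] [IsScalarTower K A W] [Module.Finite K W]
    [AddCommGroup N] [Module A N] [Module K N] [IsScalarTower K A N]
    {ε : W} (hε : ε ≠ 0) (hW : ∀ w : W, w ≠ 0 → ∃ s : A, s • w = ε)
    (hA : ∀ a : A, (∀ w : W, a • w = 0) → a = 0) {z : N} (hz : z ≠ 0) :
    ∃ h : N →ₗ[A] W, h z ≠ 0 := by
  obtain ⟨lam, hlam⟩ : ∃ lam : W →ₗ[K] K, lam ε ≠ 0 := by
    by_contra! H; exact hε ((Module.forall_dual_apply_eq_zero_iff K _).1 H)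
  obtain ⟨μ, hμ⟩ : ∃ μ : N →ₗ[K] K, μ z ≠ 0 := by
    by_contra! H; exact hz ((Module.forall_dual_apply_eq_zero_iff K _).1 H)
  let B : A →ₗ[K] W →ₗ[K] K := LinearMap.llcomp K W W K lam ∘ₗ (Algebra.lsmul K K W).toLinearMap
  have hB : ∀ a w, B a w = lam (a • w) := fun _ _ => rfl
  have hBi : Function.Injective B := by
    rw [injective_iff_map_eq_zero]
    intro a ha
    refine hA a fun w => ?_
    by_contra hw
    obtain ⟨s, hs⟩ := hW _ hw
    apply hlam
    rw [← hs, smul_comm, ← hB, ha]; rfl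
  have hBf : Function.Injective B.flip := by
    rw [injective_iff_map_eq_zero]
    intro w hw
    by_contra hw0
    obtain ⟨s, hs⟩ := hW _ hw0
    apply hlam
    rw [← hs, ← hB, ← LinearMap.flip_apply, hw]; rfl
  have hfin : Module.finrank K W = Module.finrank K (Module.Dual K A) := by
    refine le_antisymm (LinearMap.finrank_le_finrank_of_injective hBf) ?_
    rw [Subspace.dual_finrank_eq, ← Subspace.dual_finrank_eq (K := K) (V := W)]
    exact LinearMap.finrank_le_finrank_of_injective hBi
  have hBs : Function.Surjective B.flip :=
    (LinearMap.injective_iff_surjective_of_finrank_eq_finrank hfin).1 hBf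
  choose h hh using fun n : N => hBs (μ ∘ₗ (Algebra.lsmul K K N).toLinearMap.flip n)
  have hh' : ∀ n a, lam (a • h n) = μ (a • n) := fun n a => LinearMap.congr_fun (hh n) a
  refine ⟨{ toFun := h, map_add' := fun x y => hBf ?_, map_smul' := fun b x => hBf ?_ }, fun h0 =>
    ?_⟩
  · ext a
    simp only [LinearMap.flip_apply, LinearMap.add_apply, hB, smul_add, map_add, hh']
  · ext a
    simp only [LinearMap.flip_apply, hB, RingHom.id_apply, smul_smul, hh']
  · apply hμ
    rw [← one_smul A z, ← hh', show h z = 0 from h0, smul_zero, map_zero]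

theorem IsFFinite.exists_dualizing_module.{u} {p : ℕ} [hp : Fact p.Prime] {R : Type u} [CommRing R]
    [CharP R p] (h : IsFFinite p R) (m : Ideal R) [hm : m.IsMaximal] {l : ℕ} (hl : l ≠ 0) :
    ∃ (D : Type u) (_ : AddCommGroup D) (_ : Module R D), Module.Finite R D ∧
      (∀ r ∈ m ^ l, ∀ d : D, r • d = 0) ∧ ∃ u : D, u ≠ 0 ∧
      (∀ a ∈ m, a • u = 0) ∧ (∀ δ : D, δ ≠ 0 → ∃ a : R, a • δ = u) ∧
      ∀ a : R, (∀ δ : D, a • δ = 0) → a ∈ m ^ l := by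
  obtain ⟨ρ, hρ⟩ := h.exists_finite_quotient_pow m l
  let : Field (R ⧸ m) := Ideal.Quotient.field m
  let := ρ.toAlgebra
  have : Module.Finite (R ⧸ m) (R ⧸ m ^ l) := hρ
  have hsurj := Ideal.Quotient.mk_surjective (I := m ^ l)
  have hI : (m.map (Ideal.Quotient.mk (m ^ l))).IsMaximal :=
    Ideal.IsMaximal.map_of_surjective_of_ker_le hsurj (by
      rw [Ideal.mk_ker]; exact Ideal.pow_le_self hl)
  obtain ⟨D, _, _, hfin, u, hu, h1, h2, h3⟩ := _root_.exists_dualizing_module (R ⧸ m)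
    (R ⧸ m ^ l) (m.map (Ideal.Quotient.mk (m ^ l))) l (by
      rw [← Ideal.map_pow, Ideal.map_quotient_self])
  let : Module R D := Module.compHom D (Ideal.Quotient.mk (m ^ l))
  have hsmul : ∀ (r : R) (d : D), r • d = Ideal.Quotient.mk (m ^ l) r • d := fun _ _ => rfl
  have : IsScalarTower R (R ⧸ m ^ l) D := ⟨fun r a d => by
    rw [hsmul, Algebra.smul_def, mul_smul]; rfl⟩
  refine ⟨D, inferInstance, inferInstance, Module.Finite.trans (R ⧸ m ^ l) D, fun r hr d => ?_, u,
    hu, fun a ha => ?_, fun δ hδ => ?_, fun a ha => ?_⟩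
  · rw [hsmul, Ideal.Quotient.eq_zero_iff_mem.2 hr, zero_smul]
  · exact h1 _ (Ideal.mem_map_of_mem _ ha)
  · obtain ⟨a, ha⟩ := h2 δ hδ
    obtain ⟨a, rfl⟩ := hsurj a
    exact ⟨a, ha⟩
  · exact Ideal.Quotient.eq_zero_iff_mem.1 (h3 _ ha)

theorem IsFFinite.exists_linearMap_apply_ne_zero {p : ℕ} [hp : Fact p.Prime] {T : Type*}
    [CommRing T]
    [CharP T p] (h : IsFFinite p T) (n : Ideal T) [hn : n.IsMaximal] (l : ℕ)
    {W N : Type*} [AddCommGroup W] [Module T W] [Module.Finite T W] [AddCommGroup N] [Module T N]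
    (hW0 : ∀ r ∈ n ^ l, ∀ w : W, r • w = 0) (hN0 : ∀ r ∈ n ^ l, ∀ w : N, r • w = 0)
    {ε : W} (hε : ε ≠ 0) (hW : ∀ w : W, w ≠ 0 → ∃ s : T, s • w = ε)
    (hA : ∀ a : T, (∀ w : W, a • w = 0) → a ∈ n ^ l) {z : N} (hz : z ≠ 0) :
    ∃ h : N →ₗ[T] W, h z ≠ 0 := by
  obtain ⟨ρ, hρ⟩ := h.exists_finite_quotient_pow n l
  let : Field (T ⧸ n) := Ideal.Quotient.field n
  let := ρ.toAlgebra
  have : Module.Finite (T ⧸ n) (T ⧸ n ^ l) := hρ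
  let : Module (T ⧸ n ^ l) W :=
    Module.IsTorsionBySet.module (R := T) (I := n ^ l) fun w r => hW0 r r.2 w
  let : Module (T ⧸ n ^ l) N :=
    Module.IsTorsionBySet.module (R := T) (I := n ^ l) fun w r => hN0 r r.2 w
  have hWs : ∀ (r : T) (w : W), Ideal.Quotient.mk (n ^ l) r • w = r • w := fun _ _ => rfl
  have hNs : ∀ (r : T) (w : N), Ideal.Quotient.mk (n ^ l) r • w = r • w := fun _ _ => rfl
  have : IsScalarTower T (T ⧸ n ^ l) W := ⟨fun r a d => by
    rw [← hWs, Algebra.smul_def, mul_smul]; rfl⟩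
  let : Module (T ⧸ n) W := Module.compHom W ρ
  let : Module (T ⧸ n) N := Module.compHom N ρ
  have : IsScalarTower (T ⧸ n) (T ⧸ n ^ l) W := ⟨fun r a d => by
    rw [Algebra.smul_def, mul_smul]; rfl⟩
  have : IsScalarTower (T ⧸ n) (T ⧸ n ^ l) N := ⟨fun r a d => by
    rw [Algebra.smul_def, mul_smul]; rfl⟩
  have : Module.Finite (T ⧸ n ^ l) W := Module.Finite.of_restrictScalars_finite T _ W
  have : Module.Finite (T ⧸ n) W := Module.Finite.trans (T ⧸ n ^ l) W
  obtain ⟨g, hg⟩ := _root_.exists_linearMap_apply_ne_zero (K := T ⧸ n) (A := T ⧸ n ^ l) (W := W) hε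
    (fun w hw => by
      obtain ⟨s, hs⟩ := hW w hw
      exact ⟨Ideal.Quotient.mk _ s, hs⟩)
    (fun a ha => by
      obtain ⟨a, rfl⟩ := Ideal.Quotient.mk_surjective a
      exact Ideal.Quotient.eq_zero_iff_mem.2 (hA a ha)) hz
  exact ⟨{ toFun := g, map_add' := map_add g,
           map_smul' := fun r x => by rw [← hNs, map_smul]; rfl }, hg⟩

section

open TensorProduct

theorem IsFlatAt.eq_zero_of_forall_lTensor_eq_zero {R : Type*} [CommRing R] {m : Ideal R}
    [hm : m.IsMaximal] {M : Type*} [AddCommGroup M] [Module R M] (hM : IsFlatAt m M)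
    {C D : Type*} [AddCommGroup C] [Module R C] [AddCommGroup D] [Module R D] [IsNoetherian R D]
    (k : ℕ) (hk : ∀ r ∈ m ^ k, ∀ d : D, r • d = 0) {ι : Type*} [Finite ι] (f : ι → C →ₗ[R] D)
    (hf : ∀ c, (∀ i, f i c = 0) → c = 0) {θ : M ⊗[R] C} (hθ : ∀ i, (f i).lTensor M θ = 0) :
    θ = 0 := by
  classical
  have := Fintype.ofFinite ι
  refine hM.lTensor_injective k (D := ι → D) (fun r hr d => funext fun i => hk r hr _)
    (LinearMap.pi f) ?_ ?_
  · rw [injective_iff_map_eq_zero]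
    exact fun c hc => hf c fun i => congrFun hc i
  · apply (TensorProduct.piRight R R M (fun _ : ι => D)).injective
    rw [map_zero, map_zero]
    funext i
    have hproj : ∀ x, TensorProduct.piRight R R M (fun _ : ι => D) x i =
        (LinearMap.proj i : (ι → D) →ₗ[R] D).lTensor M x := by
      intro x
      induction x with
      | zero => simp
      | add a b ha hb => rw [map_add, map_add, Pi.add_apply, ha, hb]
      | tmul a b => simp
    rw [hproj, ← LinearMap.comp_apply, ← LinearMap.lTensor_comp, LinearMap.proj_pi, hθ]
    rfl

section

variable {R T : Type*} [CommRing R] [CommRing T] [Algebra R T]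

theorem Ideal.smul_tensorProduct_eq_zero {I : Ideal R} {D : Type*} [AddCommGroup D] [Module R D]
    {d : D}
    (h : ∀ r ∈ I, r • d = 0) {t : T} (ht : t ∈ I.map (algebraMap R T)) (s : T) :
    t • s ⊗ₜ[R] d = 0 := by
  induction ht using Submodule.span_induction with
  | mem t ht =>
    obtain ⟨r, hr, rfl⟩ := ht
    rw [algebraMap_smul, TensorProduct.smul_tmul', TensorProduct.smul_tmul, h r hr,
      TensorProduct.tmul_zero]
  | zero => rw [zero_smul]
  | add a b _ _ ha hb => rw [add_smul, ha, hb, add_zero]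
  | smul a b _ hb => rw [smul_assoc, hb, smul_zero]

theorem Ideal.smul_tensorProduct_eq_zero' {I : Ideal R} {D : Type*} [AddCommGroup D] [Module R D]
    (h : ∀ r ∈ I, ∀ d : D, r • d = 0) {t : T} (ht : t ∈ I.map (algebraMap R T)) (w : T ⊗[R] D) :
    t • w = 0 := by
  induction w with
  | zero => rw [smul_zero]
  | add a b ha hb => rw [smul_add, ha, hb, add_zero]
  | tmul s d => exact Ideal.smul_tensorProduct_eq_zero (fun r hr => h r hr d) ht s

variable {m : Ideal R} [hm : m.IsMaximal] [IsNoetherianRing R]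
  {D : Type*} [AddCommGroup D] [Module R D] [Module.Finite R D] {l : ℕ}

open IsLocalRing in
theorem IsFlatAt.exists_smul_eq_one_tmul [IsLocalRing T] (hT : IsFlatAt m T)
    (hmT : m.map (algebraMap R T) = maximalIdeal T)
    (hl : ∀ r ∈ m ^ l, ∀ d : D, r • d = 0) {u : D} (hu : u ≠ 0) (hmu : ∀ a ∈ m, a • u = 0)
    (hD : ∀ δ : D, δ ≠ 0 → ∃ a : R, a • δ = u) (w : T ⊗[R] D) (hw : w ≠ 0) :
    ∃ s : T, s • w = 1 ⊗ₜ u := by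
  obtain ⟨s, hs, hs'⟩ := exists_smul_notMem_forall_smul_mem (m := maximalIdeal T)
    (N := (⊥ : Submodule T (T ⊗[R] D))) l w (by simpa using hw) (by
      intro r hr
      rw [← hmT, ← Ideal.map_pow] at hr
      rw [Submodule.mem_bot]
      exact Ideal.smul_tensorProduct_eq_zero' hl hr w)
  simp only [Submodule.mem_bot] at hs hs'
  obtain ⟨G, hG⟩ := (IsNoetherian.noetherian m)
  have hGm : ∀ g : G, (g : R) ∈ m := fun g => hG ▸ Ideal.subset_span g.2
  let U : Submodule R D := Submodule.span R {u}
  let f : G → (D ⧸ U) →ₗ[R] D := fun g => U.liftQ (LinearMap.lsmul R D g) (by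
    rw [Submodule.span_singleton_le_iff_mem]; exact hmu _ (hGm g))
  have hker : ∀ d : D, (∀ a ∈ m, a • d = 0) → d ∈ U := by
    intro d hd
    by_cases hd0 : d = 0
    · rw [hd0]; exact zero_mem _
    obtain ⟨a, ha⟩ := hD d hd0
    have ham : a ∉ m := fun h => hu (by rw [← ha, hd a h])
    obtain ⟨b, c, hc, h⟩ := hm.exists_inv ham
    rw [Submodule.mem_span_singleton]
    exact ⟨b, by rw [← ha, smul_smul, ← add_zero ((b * a) • d), ← hd c hc, ← add_smul, h, one_smul]⟩
  have h0 : U.mkQ.lTensor T (s • w) = 0 := by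
    refine hT.eq_zero_of_forall_lTensor_eq_zero l hl f (fun c hc => ?_) fun g => ?_
    · obtain ⟨d, rfl⟩ := U.mkQ_surjective c
      rw [Submodule.mkQ_apply, Submodule.Quotient.mk_eq_zero]
      refine hker d fun a ha => ?_
      rw [← hG] at ha
      induction ha using Submodule.span_induction with
      | mem a ha => exact hc ⟨a, ha⟩
      | zero => rw [zero_smul]
      | add a b _ _ ha hb => rw [add_smul, ha, hb, add_zero]
      | smul a b _ hb => rw [smul_assoc, hb, smul_zero]
    · rw [← LinearMap.comp_apply, ← LinearMap.lTensor_comp, Submodule.liftQ_mkQ]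
      have : ∀ x : T ⊗[R] D, (LinearMap.lsmul R D (g : R)).lTensor T x = algebraMap R T g • x := by
        intro x
        induction x with
        | zero => simp
        | add a b ha hb => rw [map_add, smul_add, ha, hb]
        | tmul a b =>
          rw [algebraMap_smul, LinearMap.lTensor_tmul, LinearMap.lsmul_apply,
            TensorProduct.tmul_smul]
      rw [this, hs' _ (hmT ▸ Ideal.mem_map_of_mem _ (hGm g))]
  have hex : Function.Exact (LinearMap.toSpanSingleton R D u) U.mkQ := by
    rw [LinearMap.exact_iff, Submodule.ker_mkQ, LinearMap.range_toSpanSingleton]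
  obtain ⟨θ, hθ⟩ := (lTensor_exact T hex U.mkQ_surjective _).1 h0
  obtain ⟨t, rfl⟩ := (TensorProduct.rid R T).symm.surjective θ
  rw [TensorProduct.rid_symm_apply, LinearMap.lTensor_tmul, LinearMap.toSpanSingleton_apply_one]
    at hθ
  have htu : IsUnit t := by
    by_contra h
    apply hs
    have := Ideal.smul_tensorProduct_eq_zero (T := T) hmu (hmT ▸ (mem_maximalIdeal t).2 h) 1
    rwa [TensorProduct.smul_tmul', smul_eq_mul, mul_one, hθ] at this
  obtain ⟨t', ht'⟩ := htu.exists_left_inv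
  exact ⟨t' * s, by rw [mul_smul, ← hθ, TensorProduct.smul_tmul', smul_eq_mul, ht']⟩

theorem IsFlatAt.mem_map_of_forall_smul_eq_zero (hT : IsFlatAt m T)
    (hl : ∀ r ∈ m ^ l, ∀ d : D, r • d = 0)
    (hD : ∀ a : R, (∀ δ : D, a • δ = 0) → a ∈ m ^ l) {a : T}
    (ha : ∀ w : T ⊗[R] D, a • w = 0) : a ∈ (m ^ l).map (algebraMap R T) := by
  obtain ⟨G, hG⟩ := Module.Finite.fg_top (R := R) (M := D)
  let f : G → (R ⧸ m ^ l) →ₗ[R] D := fun g => Submodule.liftQ _ (LinearMap.toSpanSingleton R D g)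
    fun r hr => hl r hr _
  have h0 : a ⊗ₜ[R] (1 : R ⧸ m ^ l) = 0 := by
    refine hT.eq_zero_of_forall_lTensor_eq_zero l hl f (fun c hc => ?_) fun g => ?_
    · obtain ⟨r, rfl⟩ := Ideal.Quotient.mk_surjective c
      rw [Ideal.Quotient.eq_zero_iff_mem]
      refine hD r fun δ => ?_
      have : δ ∈ Submodule.span R (G : Set D) := hG ▸ Submodule.mem_top
      induction this using Submodule.span_induction with
      | mem d hd => exact hc ⟨d, hd⟩
      | zero => rw [smul_zero]
      | add a b _ _ ha hb => rw [smul_add, ha, hb, add_zero]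
      | smul a b _ hb => rw [smul_comm, hb, smul_zero]
    · rw [LinearMap.lTensor_tmul, ← ha (1 ⊗ₜ (g : D)), TensorProduct.smul_tmul', smul_eq_mul,
        mul_one]
      congr 1
      exact one_smul R _
  have h3 := congrArg (TensorProduct.tensorQuotEquivQuotSMul T (m ^ l)) h0
  rw [map_zero, ← map_one (Ideal.Quotient.mk (m ^ l)), tensorQuotEquivQuotSMul_tmul_mk, one_smul,
    Submodule.Quotient.mk_eq_zero, Ideal.smul_top_eq_map] at h3
  exact h3

end

end

section

open TensorProduct

/-- The map `N → M ⊗ N`, `z ↦ d ⊗ z`, is injective for all finitely generated modules `N`. -/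
def IsPureElement.{v, w} (T : Type v) {M : Type w} [CommRing T] [AddCommGroup M] [Module T M]
    (d : M) : Prop :=
  ∀ (N : Type v) [AddCommGroup N] [Module T N] [Module.Finite T N] (z : N), z ≠ 0 →
    d ⊗ₜ[T] z ≠ 0

open IsLocalRing in
/-- Purity can be tested on socle elements of finite length modules defined over the base. -/
theorem isPureElement_of_forall_tmul_ne_zero.{u, v, w} {p : ℕ} [hp : Fact p.Prime] {R : Type u}
    {T : Type v} {T' : Type w} [CommRing R] [CommRing T] [CommRing T'] [Algebra R T] [Algebra T T']
    [Algebra R T'] [IsScalarTower R T T'] [CharP R p] [CharP T p] [IsNoetherianRing R]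
    [IsNoetherianRing T] [IsLocalRing T] (hR : IsFFinite p R) (hFT : IsFFinite p T)
    {m : Ideal R} [hm : m.IsMaximal] (hT : IsFlatAt m T)
    (hmT : m.map (algebraMap R T) = maximalIdeal T) {d : T'}
    (H : ∀ (D : Type u) [AddCommGroup D] [Module R D] [Module.Finite R D] (l : ℕ),
      (∀ r ∈ m ^ l, ∀ x : D, r • x = 0) → ∀ y : D, y ≠ 0 → (∀ a ∈ m, a • y = 0) →
      d ⊗ₜ[R] y ≠ 0) :
    IsPureElement T d := by
  intro N _ _ _ z hz hdz
  have hkrull := Ideal.iInf_pow_smul_eq_bot_of_isLocalRing (M := N) (maximalIdeal T)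
    (maximalIdeal.isMaximal T).ne_top
  obtain ⟨l, hl⟩ : ∃ l : ℕ, z ∉ maximalIdeal T ^ l • (⊤ : Submodule T N) := by
    by_contra! h
    exact hz ((Submodule.mem_bot T).1 (hkrull ▸ (Submodule.mem_iInf _).2 h))
  have hl0 : l ≠ 0 := by rintro rfl; simp at hl
  obtain ⟨D, _, _, _, hlD, y, hy, h1, h2, h3⟩ := hR.exists_dualizing_module m hl0
  have hdy := H D l hlD y hy h1
  let e := AlgebraTensorModule.cancelBaseChange R T T T' D
  have he : e (d ⊗ₜ (1 ⊗ₜ y)) = d ⊗ₜ y := by simp [e]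
  have hε : (1 : T) ⊗ₜ[R] y ≠ 0 := by
    intro h
    rw [h, TensorProduct.tmul_zero, map_zero] at he
    exact hdy he.symm
  have hW := hT.exists_smul_eq_one_tmul hmT hlD hy h1 h2
  obtain ⟨h, hh⟩ := hFT.exists_linearMap_apply_ne_zero (maximalIdeal T) l
    (W := T ⊗[R] D) (N := N ⧸ maximalIdeal T ^ l • (⊤ : Submodule T N))
    (fun r hr w => Ideal.smul_tensorProduct_eq_zero' hlD (by rwa [Ideal.map_pow, hmT]) w)
    (fun r hr w => by
      obtain ⟨w, rfl⟩ := Submodule.Quotient.mk_surjective _ w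
      rw [← Submodule.Quotient.mk_smul, Submodule.Quotient.mk_eq_zero]
      exact Submodule.smul_mem_smul hr Submodule.mem_top)
    hε hW
    (fun a ha => by
      rw [← hmT, ← Ideal.map_pow]
      exact hT.mem_map_of_forall_smul_eq_zero hlD h3 ha)
    (z := Submodule.Quotient.mk z) (by rwa [Ne, Submodule.Quotient.mk_eq_zero])
  obtain ⟨s, hs⟩ := hW _ hh
  have h4 := congrArg (LinearMap.lTensor T' (h ∘ₗ Submodule.mkQ _)) hdz
  rw [LinearMap.lTensor_tmul, map_zero] at h4
  have h5 := congrArg (s • ·) h4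
  simp only [smul_zero, ← TensorProduct.tmul_smul] at h5
  rw [show s • (h ∘ₗ Submodule.mkQ _) z = 1 ⊗ₜ y from hs] at h5
  rw [h5, map_zero] at he
  exact hdy he.symm

end

section

open TensorProduct Polynomial

theorem IsFFinite.polynomial {p : ℕ} [hp : Fact p.Prime] {R : Type*} [CommRing R] [CharP R p]
    (h : IsFFinite p R) : IsFFinite p R[X] := by
  classical
  obtain ⟨s, hs⟩ := h
  let t : Finset R[X] := (s ×ˢ Finset.range p).image fun y => C y.1 * X ^ y.2
  have hmem : ∀ y ∈ s, ∀ j < p, C y * X ^ j ∈ t := fun y hy j hj =>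
    Finset.mem_image.2 ⟨(y, j), Finset.mem_product.2 ⟨hy, Finset.mem_range.2 hj⟩, rfl⟩
  have hadd : ∀ f g : R[X], (∃ c : R[X] → R[X], f = ∑ y ∈ t, c y ^ p * y) →
      (∃ c : R[X] → R[X], g = ∑ y ∈ t, c y ^ p * y) →
      ∃ c : R[X] → R[X], f + g = ∑ y ∈ t, c y ^ p * y := by
    rintro _ _ ⟨c, rfl⟩ ⟨c', rfl⟩
    refine ⟨fun y => c y + c' y, ?_⟩
    rw [← Finset.sum_add_distrib]
    exact Finset.sum_congr rfl fun y _ => by rw [add_pow_char, add_mul]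
  have hzero : ∃ c : R[X] → R[X], (0 : R[X]) = ∑ y ∈ t, c y ^ p * y :=
    ⟨fun _ => 0, by simp [hp.out.ne_zero]⟩
  have hone : ∀ y ∈ t, ∀ r : R[X], ∃ c : R[X] → R[X], r ^ p * y = ∑ y ∈ t, c y ^ p * y := by
    intro y hy r
    refine ⟨Pi.single y r, ?_⟩
    rw [Finset.sum_eq_single_of_mem y hy]
    · rw [Pi.single_eq_same]
    · intro b _ hb
      rw [Pi.single_eq_of_ne hb, zero_pow hp.out.ne_zero, zero_mul]
  refine ⟨t, fun f => ?_⟩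
  induction f using Polynomial.induction_on' with
  | add f g hf hg => exact hadd f g hf hg
  | monomial n a =>
    obtain ⟨c, hc⟩ := hs a
    have : monomial n a = ∑ y ∈ s, (C (c y) * X ^ (n / p)) ^ p * (C y * X ^ (n % p)) := by
      conv_lhs => rw [← C_mul_X_pow_eq_monomial, hc, ← Nat.div_add_mod n p]
      rw [map_sum, Finset.sum_mul]
      refine Finset.sum_congr rfl fun y _ => ?_
      rw [map_mul, map_pow, pow_add, pow_mul']
      ring
    rw [this]
    exact Finset.sum_induction _
      (fun f : R[X] => ∃ c : R[X] → R[X], f = ∑ y ∈ t, c y ^ p * y) hadd hzero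
      fun y hy => hone _ (hmem y hy _ (Nat.mod_lt _ hp.out.pos)) _

/-- Extension of a `p⁻ᵉ`-linear map to polynomials. -/
theorem exists_polynomial_addMonoidHom {p : ℕ} [hp : Fact p.Prime] {R : Type*} [CommRing R]
    [CharP R p] (e : ℕ) (φ : R →+ R) (hφ : ∀ r x : R, φ (r ^ p ^ e * x) = r * φ x) :
    ∃ ψ : R[X] →+ R[X], (∀ r x : R[X], ψ (r ^ p ^ e * x) = r * ψ x) ∧
      ∀ c, ψ (C c) = C (φ c) := by
  set q := p ^ e with hq
  have hq0 : 0 < q := pow_pos hp.out.pos e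
  let ψ : R[X] → R[X] := fun f => ∑ n ∈ Finset.range (f.natDegree + 1),
    monomial n (φ (f.coeff (n * q)))
  have hψ : ∀ f n, (ψ f).coeff n = φ (f.coeff (n * q)) := by
    intro f n
    simp only [ψ, finsetSum_coeff, coeff_monomial, Finset.sum_ite_eq', Finset.mem_range]
    split_ifs with h
    · rfl
    · rw [coeff_eq_zero_of_natDegree_lt, map_zero]
      have := Nat.le_mul_of_pos_right n hq0
      omega
  refine ⟨AddMonoidHom.mk' ψ fun f g => ?_, fun r f => ?_, fun c => ?_⟩
  · ext n
    rw [coeff_add, hψ, hψ, hψ, coeff_add, map_add]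
  · change ψ _ = r * ψ f
    ext n
    rw [hψ]
    induction r using Polynomial.induction_on' with
    | add r s hr hs =>
      rw [hq, add_pow_char_pow, ← hq, add_mul, coeff_add, map_add, hr, hs, add_mul, coeff_add]
    | monomial k b =>
      rw [monomial_pow, ← C_mul_X_pow_eq_monomial, ← C_mul_X_pow_eq_monomial, mul_assoc, mul_assoc,
        coeff_C_mul, coeff_C_mul, hφ, coeff_X_pow_mul', coeff_X_pow_mul', hψ]
      by_cases hkn : k ≤ n
      · rw [if_pos hkn, if_pos (Nat.mul_le_mul_right q hkn), Nat.sub_mul]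
      · rw [if_neg hkn, if_neg (fun h => hkn (Nat.le_of_mul_le_mul_right h hq0)), map_zero]
  · ext n
    change (ψ _).coeff n = _
    rw [hψ, coeff_C, coeff_C]
    by_cases hn : n = 0
    · simp [hn]
    · rw [if_neg hn, if_neg (by simp [hn, hq0.ne']), map_zero]

/-- The ring `T`, to be regarded as an algebra via the `e`-th iterate of the Frobenius. -/
def Frob (_p _e : ℕ) (T : Type*) : Type _ := T

namespace Frob

variable {p e : ℕ} {R T : Type*} [CommRing R] [CommRing T]

instance : CommRing (Frob p e T) := inferInstanceAs (CommRing T)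

/-- The identity map. -/
def equiv (p e : ℕ) (T : Type*) [CommRing T] : T ≃+* Frob p e T := RingEquiv.refl T

variable [ExpChar T p] [Algebra R T]

instance : Algebra R (Frob p e T) :=
  ((equiv p e T).toRingHom.comp ((iterateFrobenius T p e).comp (algebraMap R T))).toAlgebra

theorem algebraMap_apply (r : R) :
    algebraMap R (Frob p e T) r = equiv p e T (algebraMap R T r ^ p ^ e) := rfl

theorem smul_equiv (r : R) (t : T) :
    r • equiv p e T t = equiv p e T (algebraMap R T r ^ p ^ e * t) := rfl

instance (A : Type*) [CommRing A] [Algebra R A] [Algebra A T] [IsScalarTower R A T] :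
    IsScalarTower R A (Frob p e T) :=
  IsScalarTower.of_algebraMap_eq fun r => by
    rw [algebraMap_apply, algebraMap_apply, IsScalarTower.algebraMap_apply R A T]

end Frob

end

section

open TensorProduct Polynomial IsLocalRing

theorem tmul_ne_zero_of_splitting {R R' T' : Type*} [CommRing R] [CommRing R'] [CommRing T']
    [Algebra R R'] [Algebra R' T'] [Algebra R T'] [IsScalarTower R R' T'] [IsNoetherianRing R']
    {m : Ideal R} {m' : Ideal R'} [m'.IsMaximal] (hm' : m' ≤ (m.map (algebraMap R R')).radical)
    (hT : IsFlatAt m' T') (h1 : (1 : T') ∉ m' • (⊤ : Submodule R' T'))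
    {c : R'} {φ : R' →ₗ[R] R} (hφ : φ c = 1)
    {D : Type*} [AddCommGroup D] [Module R D] [Module.Finite R D] {l : ℕ}
    (hl : ∀ r ∈ m ^ l, ∀ x : D, r • x = 0) {y : D} (hy : y ≠ 0) :
    algebraMap R' T' c ⊗ₜ[R] y ≠ 0 := by
  have hQ : c ⊗ₜ[R] y ≠ 0 := by
    intro h
    have h2 := congrArg ((TensorProduct.lid R D).toLinearMap ∘ₗ φ.rTensor D) h
    rw [map_zero] at h2
    apply hy
    simpa [hφ] using h2
  obtain ⟨k, hk⟩ := Ideal.exists_pow_le_of_le_radical_of_fg hm' (IsNoetherian.noetherian m')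
  have h0 := hT.tmul_ne_zero (Q := R' ⊗[R] D) (k * l) (fun r hr d =>
    Ideal.smul_tensorProduct_eq_zero' hl (by
      rw [Ideal.map_pow]
      exact Ideal.pow_right_mono hk l (by rwa [← pow_mul])) d) h1 hQ
  intro h
  apply h0
  apply (AlgebraTensorModule.cancelBaseChange R R' T' T' D).injective
  rw [map_zero, AlgebraTensorModule.cancelBaseChange_tmul, ← h, Algebra.smul_def, mul_one]

section

variable {p : ℕ} [hp : Fact p.Prime]

/-- A splitting of `c` on the base `R` makes `c` pure on a flat local extension with regular fiber.
-/
theorem isPureElement_frob_of_splitting.{u, v} (e : ℕ) {T : Type v} [CommRing T] [CharP T p]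
    [IsNoetherianRing T]
    [IsLocalRing T] (hFT : IsFFinite p T) (xs : List T) :
    ∀ (R : Type u) [CommRing R] [CharP R p] [IsNoetherianRing R] [Algebra R T] (_ : IsFFinite p R)
      (m : Ideal R) [m.IsMaximal] (_ : IsFlatAt m T)
      (_ : IsRegularModulo (m.map (algebraMap R T)) xs)
      (_ : m.map (algebraMap R T) ⊔ Ideal.ofList xs = maximalIdeal T) (c : R)
      (φ : R →+ R) (_ : ∀ r x : R, φ (r ^ p ^ e * x) = r * φ x) (_ : φ c = 1),
      IsPureElement T (Frob.equiv p e T (algebraMap R T c)) := by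
  induction xs with
  | nil =>
    intro R _ _ _ _ hFR m _ hT _ hmax c φ hφ hc
    rw [Ideal.ofList_nil, sup_bot_eq] at hmax
    refine isPureElement_of_forall_tmul_ne_zero (R := R) (T' := Frob p e T) hFR hFT hT hmax ?_
    intro D _ _ _ l hl y hy _
    let : Algebra (Frob p e R) (Frob p e T) := inferInstanceAs (Algebra R T)
    have : IsScalarTower R (Frob p e R) (Frob p e T) := IsScalarTower.of_algebraMap_eq fun r =>
      (map_pow (algebraMap R T) r (p ^ e)).symm
    have : IsNoetherianRing (Frob p e R) := inferInstanceAs (IsNoetherianRing R)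
    let m' : Ideal (Frob p e R) := m
    have : m'.IsMaximal := inferInstanceAs m.IsMaximal
    have hT' : IsFlatAt m' (Frob p e T) := hT
    let φ' : Frob p e R →ₗ[R] R :=
      { toFun := φ, map_add' := map_add φ, map_smul' := hφ }
    refine tmul_ne_zero_of_splitting (R' := Frob p e R) (T' := Frob p e T) (m := m) (m' := m') ?_
      hT' ?_ (φ := φ') (c := c) hc hl hy
    · exact fun a ha => ⟨p ^ e, Ideal.mem_map_of_mem (algebraMap R (Frob p e R))
        (show (a : R) ∈ m from ha)⟩
    · have : (1 : T) ∉ m • (⊤ : Submodule R T) := by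
        rw [Ideal.smul_top_eq_map, hmax]
        exact fun h => (Ideal.ne_top_iff_one _).1 (maximalIdeal.isMaximal T).ne_top h
      exact this
  | cons x xs ih =>
    intro R _ _ _ _ hFR m _ hT hreg hmax c φ hφ hc
    let : Algebra R[X] T := (aeval x).toAlgebra
    have hX : algebraMap R[X] T X = x := aeval_X x
    have : IsScalarTower R R[X] T := IsScalarTower.of_algebraMap_eq fun r => (aeval_C x r).symm
    have hmap := IsFlatAt.map_comap_constantCoeff (T := T) m
    rw [hX] at hmap
    have hmm : (m.comap constantCoeff).IsMaximal :=
      Ideal.comap_isMaximal_of_surjective _ fun r => ⟨C r, by simp⟩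
    obtain ⟨ψ, hψ, hψC⟩ := exists_polynomial_addMonoidHom e φ hφ
    have := ih R[X] hFR.polynomial (m.comap constantCoeff)
      (hT.polynomial (by rw [hX]; exact hreg.1)) (by rw [hmap]; exact hreg.2)
      (by rw [hmap, sup_assoc, ← hmax, Ideal.ofList_cons]) (C c) ψ hψ (by rw [hψC, hc, C_1])
    rwa [show algebraMap R[X] T (C c) = algebraMap R T c from aeval_C x c] at this

theorem isPureElement_of_isRegularModulo.{u, v, w} {T : Type v} {T' : Type w} [CommRing T]
    [CommRing T'] [CharP T p]
    [IsNoetherianRing T] [IsLocalRing T] [Algebra T T'] (hFT : IsFFinite p T) {d : T'}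
    (hd : d ∉ (maximalIdeal T).map (algebraMap T T')) (xs : List T) :
    ∀ (R : Type u) [CommRing R] [CharP R p] [IsNoetherianRing R] [Algebra R T] [Algebra R T']
      [IsScalarTower R T T'] (_ : IsFFinite p R)
      (m : Ideal R) [m.IsMaximal] (_ : IsFlatAt m T) (_ : IsFlatAt m T')
      (_ : IsRegularModulo (m.map (algebraMap R T)) xs)
      (_ : IsRegularModulo (m.map (algebraMap R T')) (xs.map (algebraMap T T')))
      (_ : m.map (algebraMap R T) ⊔ Ideal.ofList xs = maximalIdeal T), IsPureElement T d := by
  induction xs with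
  | nil =>
    intro R _ _ _ _ _ _ hFR m _ hT hT' _ _ hmax
    rw [Ideal.ofList_nil, sup_bot_eq] at hmax
    refine isPureElement_of_forall_tmul_ne_zero (R := R) hFR hFT hT hmax ?_
    intro D _ _ _ l hl y hy _
    refine hT'.tmul_ne_zero l hl ?_ hy
    rw [Ideal.smul_top_eq_map]
    rwa [← hmax, Ideal.map_map, ← IsScalarTower.algebraMap_eq] at hd
  | cons x xs ih =>
    intro R _ _ _ _ _ _ hFR m _ hT hT' hreg hreg' hmax
    let : Algebra R[X] T := (aeval x).toAlgebra
    let : Algebra R[X] T' := ((algebraMap T T').comp (algebraMap R[X] T)).toAlgebra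
    have hX : algebraMap R[X] T X = x := aeval_X x
    have hX' : algebraMap R[X] T' X = algebraMap T T' x := congrArg _ hX
    have hC : ∀ r, algebraMap R[X] T (C r) = algebraMap R T r := aeval_C x
    have : IsScalarTower R[X] T T' := IsScalarTower.of_algebraMap_eq fun r => rfl
    have : IsScalarTower R R[X] T := IsScalarTower.of_algebraMap_eq fun r => (hC r).symm
    have : IsScalarTower R R[X] T' := IsScalarTower.of_algebraMap_eq fun r =>
      (IsScalarTower.algebraMap_apply R T T' r).trans (congrArg _ (hC r).symm)
    have hmap := IsFlatAt.map_comap_constantCoeff (T := T) m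
    have hmap' := IsFlatAt.map_comap_constantCoeff (T := T') m
    rw [hX] at hmap
    rw [hX'] at hmap'
    have hmm : (m.comap constantCoeff).IsMaximal :=
      Ideal.comap_isMaximal_of_surjective _ fun r => ⟨C r, by simp⟩
    exact ih R[X] hFR.polynomial (m.comap constantCoeff)
      (hT.polynomial (by rw [hX]; exact hreg.1)) (hT'.polynomial (by rw [hX']; exact hreg'.1))
      (by rw [hmap]; exact hreg.2) (by rw [hmap']; exact hreg'.2)
      (by rw [hmap, sup_assoc, ← hmax, Ideal.ofList_cons])

end

end

section

open TensorProduct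

/-- A universal test module for the ideal of values at `m` of the functionals on `M`. -/
theorem exists_tmul_eq_zero_and_forall_smul_eq_zero.{v, w} {S : Type v} {M : Type w} [CommRing S]
    [IsNoetherianRing S] [AddCommGroup M] [Module S M] [Module.Finite S M] (m : M) :
    ∃ (N : Type v) (_ : AddCommGroup N) (_ : Module S N) (_ : Module.Finite S N) (z : N),
      m ⊗ₜ[S] z = 0 ∧ ∀ s : S, s • z = 0 → ∃ φ : M →ₗ[S] S, φ m = s := by
  classical
  obtain ⟨n, π, hπ⟩ := Module.Finite.exists_fin' S M
  obtain ⟨v, rfl⟩ := hπ m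
  obtain ⟨k, G, hG⟩ := Module.Finite.exists_fin' S (LinearMap.ker π)
  let g : Fin k → Fin n → S := fun j => (G (Pi.single j 1)).1
  have hg : ∀ j, π (g j) = 0 := fun j => (G (Pi.single j 1)).2
  have hker : ∀ (w : (Fin n → S) →ₗ[S] S), (∀ j, w (g j) = 0) → ∀ x, π x = 0 → w x = 0 := by
    intro w hw x hx
    obtain ⟨y, hy⟩ := hG ⟨x, hx⟩
    have : w ∘ₗ (LinearMap.ker π).subtype ∘ₗ G = 0 := by
      ext j
      simpa using hw j
    have := LinearMap.congr_fun this y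
    simpa [hy] using this
  let L : ((Fin n → S) →ₗ[S] S) →ₗ[S] (Fin k → S) × S :=
    LinearMap.prod (LinearMap.pi fun j => LinearMap.applyₗ (g j)) (LinearMap.applyₗ v)
  refine ⟨((Fin k → S) × S) ⧸ LinearMap.range L, inferInstance, inferInstance, inferInstance,
    Submodule.Quotient.mk (0, 1), ?_, fun s hs => ?_⟩
  · let Q := (LinearMap.range L).mkQ
    have hQ : ∀ i, v i • Q (0, 1) = -∑ j, g j i • Q (Pi.single j 1, 0) := by
      intro i
      have h : Q (L (LinearMap.proj i)) = 0 := by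
        rw [Submodule.mkQ_apply, Submodule.Quotient.mk_eq_zero]
        exact ⟨_, rfl⟩
      have h2 : L (LinearMap.proj i) =
          ∑ j, g j i • ((Pi.single j 1 : Fin k → S), (0 : S)) + v i • (0, 1) := by
        refine Prod.ext ?_ ?_
        · ext j
          simp [L, Prod.fst_sum, Finset.sum_apply, Pi.single_apply]
        · simp [L, Prod.snd_sum]
      rw [h2, map_add, map_sum] at h
      simp only [map_smul] at h
      exact eq_neg_of_add_eq_zero_right h
    change π v ⊗ₜ[S] Q (0, 1) = 0
    have hv : ∀ x : Fin n → S, π x = ∑ i, x i • π (Pi.single i 1) := by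
      intro x
      conv_lhs => rw [pi_eq_sum_univ' x]
      simp
    rw [hv, TensorProduct.sum_tmul]
    simp_rw [TensorProduct.smul_tmul, hQ, TensorProduct.tmul_neg, TensorProduct.tmul_sum,
      ← TensorProduct.smul_tmul]
    rw [Finset.sum_neg_distrib, Finset.sum_comm]
    simp_rw [← TensorProduct.sum_tmul, ← hv, hg, TensorProduct.zero_tmul]
    simp
  · rw [← Submodule.Quotient.mk_smul, Submodule.Quotient.mk_eq_zero] at hs
    obtain ⟨w, hw⟩ := hs
    have h1 : ∀ j, w (g j) = 0 := fun j => by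
      simpa [L] using congrFun (congrArg Prod.fst hw) j
    have h2 : w v = s := by simpa [L] using congrArg Prod.snd hw
    obtain ⟨φ, hφ⟩ : ∃ φ : M →ₗ[S] S, φ ∘ₗ π = w := by
      refine ⟨(LinearMap.ker π).liftQ w (hker w h1) ∘ₗ
        (π.quotKerEquivOfSurjective hπ).symm.toLinearMap, ?_⟩
      refine LinearMap.ext fun x => ?_
      simp only [LinearMap.comp_apply, LinearEquiv.coe_coe,
        LinearMap.quotKerEquivOfSurjective_symm_apply]
      exact Submodule.liftQ_apply _ _ _
    exact ⟨φ, by rw [← h2, ← hφ]; rfl⟩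

/-- If the image of `d` in a module over the localization at `q` is pure, some functional
takes a value outside `q` at `d`. -/
theorem IsPureElement.exists_apply_notMem.{v, w, x} {S T : Type v} [CommRing S] [CommRing T]
    [IsNoetherianRing S] [Algebra S T] (q : Ideal S) [q.IsPrime] [IsLocalization.AtPrime T q]
    {M : Type w} [AddCommGroup M] [Module S M] [Module.Finite S M]
    {M' : Type x} [AddCommGroup M'] [Module S M'] [Module T M'] [IsScalarTower S T M']
    (g : M →ₗ[S] M') {d : M} (hd : IsPureElement T (g d)) : ∃ φ : M →ₗ[S] S, φ d ∉ q := by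
  obtain ⟨N, _, _, _, z, hz, hN⟩ := exists_tmul_eq_zero_and_forall_smul_eq_zero (S := S) d
  by_contra! H
  have : IsLocalizedModule q.primeCompl (TensorProduct.mk S T N 1) :=
    (isLocalizedModule_iff_isBaseChange q.primeCompl T _).2 (TensorProduct.isBaseChange S N T)
  have h1 : (1 : T) ⊗ₜ[S] z ≠ 0 := by
    intro h
    obtain ⟨c, hc⟩ := (IsLocalizedModule.eq_zero_iff q.primeCompl (TensorProduct.mk S T N 1)).1 h
    obtain ⟨φ, hφ⟩ := hN c hc
    exact c.2 (hφ ▸ H φ)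
  apply hd _ _ h1
  apply (AlgebraTensorModule.cancelBaseChange S T T M' N).injective
  rw [map_zero, AlgebraTensorModule.cancelBaseChange_tmul, one_smul,
    ← LinearMap.rTensor_tmul, hz, map_zero]

end

section

variable {p : ℕ}

namespace Frob

variable {e : ℕ}

theorem finite {R : Type*} [CommRing R] [ExpChar R p] (h : IsFFinite p R) :
    Module.Finite R (Frob p e R) :=
  h.finite_iterateFrobenius e

theorem isFFinite {R : Type*} [CommRing R] [ExpChar R p] (h : Module.Finite R (Frob p 1 R)) :
    IsFFinite p R := by
  obtain ⟨⟨s, hs⟩⟩ := h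
  refine ⟨s.map (equiv p 1 R).symm.toEquiv.toEmbedding, fun x => ?_⟩
  obtain ⟨c, -, hc⟩ := Submodule.mem_span_finset.1 (hs ▸ Submodule.mem_top : equiv p 1 R x ∈ _)
  refine ⟨c ∘ equiv p 1 R, ?_⟩
  rw [Finset.sum_map]
  apply (equiv p 1 R).injective
  rw [map_sum, ← hc]
  refine Finset.sum_congr rfl fun y _ => (smul_equiv (c y) ((equiv p 1 R).symm y)).trans ?_
  rw [pow_one]
  rfl

variable {R T : Type*} [CommRing R] [CommRing T] [Algebra R T] [ExpChar R p] [ExpChar T p]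

/-- The Frobenius pushforward of the structure map of an algebra. -/
def map (p e : ℕ) (R T : Type*) [CommRing R] [CommRing T] [Algebra R T] [ExpChar R p]
    [ExpChar T p] : Frob p e R →ₗ[R] Frob p e T where
  toFun x := equiv p e T (algebraMap R T ((equiv p e R).symm x))
  map_add' x y := by simp
  map_smul' r x := by
    obtain ⟨x, rfl⟩ := (equiv p e R).surjective x
    simp [smul_equiv]

theorem map_equiv (x : R) : map p e R T (equiv p e R x) = equiv p e T (algebraMap R T x) := rfl

theorem isLocalizedModule_map (M : Submonoid R) [IsLocalization M T] (hp : p ≠ 0) :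
    IsLocalizedModule M (map p e R T) where
  map_units s := by
    obtain ⟨u, hu⟩ := (IsLocalization.map_units T s).pow (p ^ e)
    rw [Module.End.isUnit_iff]
    refine ⟨fun x y h => ?_, fun y => ?_⟩
    · obtain ⟨x, rfl⟩ := (equiv p e T).surjective x
      obtain ⟨y, rfl⟩ := (equiv p e T).surjective y
      simp only [Module.algebraMap_end_apply, smul_equiv, ← hu] at h
      exact congrArg _ ((Units.mul_right_inj u).1 ((equiv p e T).injective h))
    · obtain ⟨y, rfl⟩ := (equiv p e T).surjective y
      exact ⟨equiv p e T (↑u⁻¹ * y), by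
        rw [Module.algebraMap_end_apply, smul_equiv, ← hu, Units.mul_inv_cancel_left]⟩
  surj y := by
    obtain ⟨y, rfl⟩ := (equiv p e T).surjective y
    obtain ⟨⟨a, s⟩, h⟩ := IsLocalization.surj M y
    refine ⟨⟨equiv p e R (a * s ^ (p ^ e - 1)), s⟩, ?_⟩
    change (s : R) • equiv p e T y = _
    dsimp only at h
    rw [map_equiv, smul_equiv, map_mul (algebraMap R T), ← h, map_pow, mul_assoc, ← pow_succ',
      Nat.sub_add_cancel (Nat.one_le_iff_ne_zero.2 (pow_ne_zero e hp)), mul_comm]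
  exists_of_eq {x y} h := by
    obtain ⟨x, rfl⟩ := (equiv p e R).surjective x
    obtain ⟨y, rfl⟩ := (equiv p e R).surjective y
    obtain ⟨c, hc⟩ := IsLocalization.exists_of_eq (M := M) ((equiv p e T).injective h)
    refine ⟨c, ?_⟩
    simp only [RingEquiv.symm_apply_apply] at hc
    rw [Submonoid.smul_def, Submonoid.smul_def, smul_equiv, smul_equiv,
      Algebra.algebraMap_self_apply,
      ← Nat.sub_add_cancel (Nat.one_le_iff_ne_zero.2 (pow_ne_zero e hp)), pow_succ, mul_assoc, hc,
      mul_assoc]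

end Frob

theorem IsFFinite.of_isLocalization {R T : Type*} [CommRing R] [CommRing T] [Algebra R T]
    [ExpChar R p] [ExpChar T p] (M : Submonoid R) [IsLocalization M T] (hp : p ≠ 0)
    (h : IsFFinite p R) : IsFFinite p T := by
  have := Frob.finite (e := 1) h
  have := Frob.isLocalizedModule_map (T := T) (e := 1) M hp
  have : Module.Finite T (Frob p 1 T) :=
    Module.Finite.of_isLocalizedModule M (Rₚ := T) (Frob.map p 1 R T)
  exact Frob.isFFinite this

/-- A `p⁻ᵉ`-linear map extends to localizations. -/
theorem exists_addMonoidHom_of_isLocalization {R T : Type*} [CommRing R] [CommRing T] [Algebra R T]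
    [ExpChar R p] [ExpChar T p] (M : Submonoid R) [IsLocalization M T] (hp : p ≠ 0) {e : ℕ}
    (φ : R →+ R) (hφ : ∀ r x : R, φ (r ^ p ^ e * x) = r * φ x) :
    ∃ ψ : T →+ T, (∀ r x : T, ψ (r ^ p ^ e * x) = r * ψ x) ∧
      ∀ c, ψ (algebraMap R T c) = algebraMap R T (φ c) := by
  have := Frob.isLocalizedModule_map (T := T) (e := e) M hp
  let φ' : Frob p e R →ₗ[R] R :=
    { toFun := φ, map_add' := map_add φ, map_smul' := hφ }
  let ψ := IsLocalizedModule.mapExtendScalars M (Frob.map p e R T) (Algebra.linearMap R T) T φ'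
  refine ⟨ψ.toAddMonoidHom, ψ.map_smul, fun c => ?_⟩
  exact IsLocalizedModule.map_apply M (Frob.map p e R T) (Algebra.linearMap R T) φ' c

end

open IsLocalRing in
theorem exists_frob_apply_algebraMap_notMem.{u, v} {p : ℕ} [hp : Fact p.Prime] {R : Type u}
    {S : Type v} [CommRing R] [CommRing S] [IsDomain R] [IsDomain S] [IsNoetherianRing R]
    [IsNoetherianRing S] [CharP R p] [CharP S p] (hR : IsFFinite p R) (hS : IsFFinite p S)
    [Algebra R S] [Module.Flat R S] (q : Ideal S) [q.IsPrime]
    (hreg : IsRegularLocal (Localization.AtPrime q ⧸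
      ((q.comap (algebraMap R S)).map (algebraMap R S)).map
        (algebraMap S (Localization.AtPrime q))))
    {e : ℕ} {c : R} (φ : R →+ R) (hφ : ∀ r x : R, φ (r ^ p ^ e * x) = r * φ x) (hc : φ c = 1) :
    ∃ ψ : Frob p e S →ₗ[S] S, ψ (Frob.equiv p e S (algebraMap R S c)) ∉ q := by
  let P := q.comap (algebraMap R S)
  let R' := Localization.AtPrime P
  let T := Localization.AtPrime q
  have := charP_of_injective_algebraMap (IsLocalization.injective R'
    P.primeCompl_le_nonZeroDivisors) p
  have := charP_of_injective_algebraMap (IsLocalization.injective T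
    q.primeCompl_le_nonZeroDivisors) p
  let : Algebra R' T := (Localization.localRingHom P q (algebraMap R S) rfl).toAlgebra
  have : IsScalarTower R R' T := IsScalarTower.of_algebraMap_eq fun r =>
    (IsScalarTower.algebraMap_apply R S T r).trans
      (Localization.localRingHom_to_map P q (algebraMap R S) rfl r).symm
  have : IsNoetherianRing R' := IsLocalization.isNoetherianRing P.primeCompl _ inferInstance
  have : IsNoetherianRing T := IsLocalization.isNoetherianRing q.primeCompl _ inferInstance
  have : Module.Flat S T := IsLocalization.flat T q.primeCompl
  have : Module.Flat R T := Module.Flat.trans R S T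
  have : Module.Flat R' T := (Module.flat_iff_of_isLocalization R' P.primeCompl T).2 this
  have hmap : (maximalIdeal R').map (algebraMap R' T) =
      (P.map (algebraMap R S)).map (algebraMap S T) := by
    rw [← Localization.AtPrime.map_eq_maximalIdeal, Ideal.map_map, Ideal.map_map,
      ← IsScalarTower.algebraMap_eq, ← IsScalarTower.algebraMap_eq]
  obtain ⟨xs, hxs, hmax⟩ := hreg.exists_isRegularModulo
  obtain ⟨φ', hφ', hφ'c⟩ := exists_addMonoidHom_of_isLocalization (T := R') P.primeCompl
    hp.out.ne_zero φ hφ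
  have h := isPureElement_frob_of_splitting e (hS.of_isLocalization (T := T) q.primeCompl
    hp.out.ne_zero)
    xs R' (hR.of_isLocalization P.primeCompl hp.out.ne_zero) (maximalIdeal R') IsFlatAt.of_flat
    (by rw [hmap]; exact hxs) (by rw [hmap]; exact hmax) (algebraMap R R' c) φ' hφ'
    (by rw [hφ'c, hc, map_one])
  rw [← IsScalarTower.algebraMap_apply, IsScalarTower.algebraMap_apply R S T, ← Frob.map_equiv] at h
  have := Frob.finite (e := e) hS
  exact h.exists_apply_notMem q _

open IsLocalRing in
theorem exists_frob_apply_notMem {p : ℕ} [hp : Fact p.Prime] {S : Type*} [CommRing S] [IsDomain S]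
    [IsNoetherianRing S] [CharP S p] (hS : IsFFinite p S) (q : Ideal S) [q.IsPrime]
    (hreg : IsRegularLocal (Localization.AtPrime q ⧸ (⊥ : Ideal (Localization.AtPrime q))))
    {d : S} (hd : d ≠ 0) :
    ∃ e : ℕ, 1 ≤ e ∧ ∃ ψ : Frob p e S →ₗ[S] S, ψ (Frob.equiv p e S d) ∉ q := by
  let T := Localization.AtPrime q
  have hinj := IsLocalization.injective T q.primeCompl_le_nonZeroDivisors
  have := charP_of_injective_algebraMap hinj p
  have : IsNoetherianRing T := IsLocalization.isNoetherianRing q.primeCompl _ inferInstance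
  let : Algebra (ZMod p) T := ZMod.algebra T p
  obtain ⟨k, hk⟩ : ∃ k : ℕ, algebraMap S T d ∉ maximalIdeal T ^ k := by
    by_contra! h
    have := Ideal.iInf_pow_eq_bot_of_isLocalRing (maximalIdeal T) (maximalIdeal.isMaximal T).ne_top
    exact hd (hinj (((Submodule.mem_bot T).1 (this ▸ (Submodule.mem_iInf _).2 h)).trans
      (map_zero _).symm))
  obtain ⟨xs, hxs, hmax⟩ := hreg.exists_isRegularModulo
  let e := k + 1
  have hke : k ≤ p ^ e := (Nat.le_succ k).trans (Nat.lt_pow_self hp.out.one_lt).le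
  refine ⟨e, Nat.le_add_left 1 k, ?_⟩
  have hmem : Frob.equiv p e T (algebraMap S T d) ∉
      (maximalIdeal T).map (algebraMap T (Frob p e T)) := by
    intro h
    have hle : (maximalIdeal T).map (algebraMap T (Frob p e T)) ≤
        (maximalIdeal T ^ k).comap (Frob.equiv p e T).symm.toRingHom := by
      rw [Ideal.map_le_iff_le_comap]
      exact fun x hx => Ideal.pow_le_pow_right hke (Ideal.pow_mem_pow hx _)
    exact hk (hle h)
  have hZ : IsFFinite p (ZMod p) := ⟨{1}, fun x => ⟨fun _ => x, by simp⟩⟩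
  have h := isPureElement_of_isRegularModulo (hS.of_isLocalization (T := T) q.primeCompl
    hp.out.ne_zero)
    hmem xs (ZMod p) hZ ⊥ IsFlatAt.of_flat IsFlatAt.of_flat
    (by rw [Ideal.map_bot]; exact hxs) (by rw [Ideal.map_bot]; exact hxs.map_pow (p ^ e))
    (by rw [Ideal.map_bot]; exact hmax)
  rw [← Frob.map_equiv] at h
  have := Frob.finite (e := e) hS
  exact h.exists_apply_notMem q _

namespace Frob

variable {p : ℕ} {S : Type*} [CommRing S] [ExpChar S p]

theorem exists_linearMap_comp {e e' : ℕ} (φ : Frob p e S →ₗ[S] S) (ψ : Frob p e' S →ₗ[S] S) :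
    ∃ χ : Frob p (e + e') S →ₗ[S] S,
      ∀ x, χ (equiv p _ S x) = ψ (equiv p e' S (φ (equiv p e S x))) :=
  ⟨{  toFun x := ψ (equiv p e' S (φ (equiv p e S ((equiv p _ S).symm x))))
      map_add' x y := by simp
      map_smul' r x := by
        obtain ⟨x, rfl⟩ := (equiv p _ S).surjective x
        rw [smul_equiv, RingEquiv.symm_apply_apply, RingEquiv.symm_apply_apply,
          Algebra.algebraMap_self_apply, RingHom.id_apply, ← map_smul, smul_equiv, add_comm e,
          pow_add, pow_mul, Algebra.algebraMap_self_apply, ← smul_eq_mul (r ^ p ^ e'), ← map_smul,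
          smul_equiv, Algebra.algebraMap_self_apply] }, fun x => by simp⟩

/-- The ideal of all values at `d` of the `p⁻ᵉ`-linear maps. -/
def valueIdeal (p e : ℕ) {S : Type*} [CommRing S] [ExpChar S p] (d : S) : Ideal S :=
  LinearMap.range (LinearMap.applyₗ (equiv p e S d) : (Frob p e S →ₗ[S] S) →ₗ[S] S)

theorem one_mem_valueIdeal {e : ℕ} {d : S}
    (h : ∀ (q : Ideal S) [q.IsPrime], ∃ ψ : Frob p e S →ₗ[S] S, ψ (equiv p e S d) ∉ q) :
    1 ∈ valueIdeal p e d := by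
  rw [← Ideal.eq_top_iff_one]
  by_contra hne
  obtain ⟨q, hq, hle⟩ := Ideal.exists_le_maximal _ hne
  obtain ⟨ψ, hψ⟩ := h q
  exact hψ (hle ⟨ψ, rfl⟩)

theorem one_mem_valueIdeal_one {e : ℕ} (h : 1 ∈ valueIdeal p (e + 1) (1 : S)) :
    1 ∈ valueIdeal p 1 (1 : S) := by
  obtain ⟨σ, hσ⟩ := h
  let σ' : Frob p 1 S →ₗ[S] S :=
    { toFun x := σ (equiv p (e + 1) S ((equiv p 1 S).symm x ^ p ^ e))
      map_add' x y := by rw [map_add, add_pow_expChar_pow, map_add, map_add]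
      map_smul' r x := by
        obtain ⟨x, rfl⟩ := (equiv p _ S).surjective x
        rw [smul_equiv, RingEquiv.symm_apply_apply, RingEquiv.symm_apply_apply, mul_pow, ← pow_mul,
          ← pow_add, RingHom.id_apply, ← map_smul, smul_equiv, add_comm 1] }
  refine ⟨σ', ?_⟩
  change σ (equiv p (e + 1) S (1 ^ p ^ e)) = 1
  rwa [one_pow]

theorem valueIdeal_le_add_one (hp : p ≠ 0) (h : 1 ∈ valueIdeal p 1 (1 : S)) (e : ℕ) (d : S) :
    valueIdeal p e d ≤ valueIdeal p (e + 1) d := by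
  rintro _ ⟨φ, rfl⟩
  obtain ⟨σ, hσ⟩ := h
  let σ' : Frob p 1 S →ₗ[S] S :=
    σ ∘ₗ LinearMap.mulLeft S (equiv p 1 S (d ^ (p - 1)))
  obtain ⟨χ, hχ⟩ := exists_linearMap_comp σ' φ
  rw [add_comm]
  refine ⟨χ, ?_⟩
  have : σ' (equiv p 1 S d) = d := by
    have : equiv p 1 S (d ^ (p - 1)) * equiv p 1 S d = d • equiv p 1 S 1 := by
      rw [← map_mul, ← pow_succ, Nat.sub_add_cancel (Nat.one_le_iff_ne_zero.2 hp), smul_equiv,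
        pow_one, mul_one, Algebra.algebraMap_self_apply]
    change σ (equiv p 1 S (d ^ (p - 1)) * equiv p 1 S d) = d
    rw [this, map_smul]
    exact (congrArg (d * ·) hσ).trans (mul_one d)
  exact (hχ d).trans (by rw [this]; rfl)

end Frob

/-- If `R → S` is a flat homomorphism of `F`-finite Noetherian domains of prime
characteristic `p` with regular fibers (for every prime `𝔮` of `S` lying over `𝔭` of `R`,
the localization of the fiber ring at `𝔮`, i.e. `S_𝔮 / 𝔭 S_𝔮`, is a regular local ring),
and `R` is strongly `F`-regular, then `S` is strongly `F`-regular. -/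
theorem stronglyFRegular_of_flat_regular_fibers (R S : Type*) [CommRing R] [CommRing S]
    [IsDomain R] [IsDomain S] [IsNoetherianRing R] [IsNoetherianRing S]
    (p : ℕ) (hp : p.Prime) [CharP R p] [CharP S p]
    (hFFR : IsFFinite p R) (hFFS : IsFFinite p S)
    [Algebra R S] [Module.Flat R S]
    (hreg : ∀ (𝔮 : Ideal S) [𝔮.IsPrime],
      IsRegularLocal (Localization.AtPrime 𝔮 ⧸
        Ideal.map (algebraMap S (Localization.AtPrime 𝔮))
          (Ideal.map (algebraMap R S) (𝔮.comap (algebraMap R S)))))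
    (hFR : IsStronglyFRegular p R) :
    IsStronglyFRegular p S := by
  intro d hd
  have : Fact p.Prime := ⟨hp⟩
  have hα : ∀ c : R, c ≠ 0 → ∃ e, 1 ≤ e ∧ 1 ∈ Frob.valueIdeal p e (algebraMap R S c) := by
    intro c hc
    obtain ⟨e, he, φ, hφ, hφc⟩ := hFR c hc
    exact ⟨e, he, Frob.one_mem_valueIdeal fun q _ =>
      exists_frob_apply_algebraMap_notMem hFFR hFFS q (hreg q) φ hφ hφc⟩
  have hone : 1 ∈ Frob.valueIdeal p 1 (1 : S) := by
    obtain ⟨e, he, h⟩ := hα 1 one_ne_zero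
    obtain ⟨e, rfl⟩ := Nat.exists_eq_add_of_le' he
    rw [map_one] at h
    exact Frob.one_mem_valueIdeal_one h
  have hmono : Monotone fun e => Frob.valueIdeal p (e + 1) d := monotone_nat_of_le_succ fun e =>
    Frob.valueIdeal_le_add_one hp.ne_zero hone (e + 1) d
  obtain ⟨c, hc, e, φ, hφ⟩ : ∃ c : R, c ≠ 0 ∧ ∃ e, algebraMap R S c ∈ Frob.valueIdeal p
    (e + 1) d := by
    by_contra! H
    obtain ⟨q, hq, hle, hdisj⟩ := Ideal.exists_le_prime_disjoint
      (⨆ e, Frob.valueIdeal p (e + 1) d) ((nonZeroDivisors R).map (algebraMap R S)) (by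
        rw [Set.disjoint_right]
        rintro _ ⟨c, hc, rfl⟩ hmem
        obtain ⟨e, he⟩ := (Submodule.mem_iSup_of_directed _ hmono.directed_le).1 hmem
        exact H c (nonZeroDivisors.ne_zero hc) e he)
    have hbot : q.comap (algebraMap R S) = ⊥ := by
      rw [eq_bot_iff]
      intro c hc
      by_contra hc0
      exact Set.disjoint_right.1 hdisj ⟨c, mem_nonZeroDivisors_of_ne_zero hc0, rfl⟩ hc
    have hq' := hreg q
    rw [hbot, Ideal.map_bot, Ideal.map_bot] at hq'
    obtain ⟨e, he, ψ, hψ⟩ := exists_frob_apply_notMem hFFS q hq' hd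
    obtain ⟨e, rfl⟩ := Nat.exists_eq_add_of_le' he
    exact hψ (hle (Submodule.mem_iSup_of_mem e ⟨ψ, rfl⟩))
  obtain ⟨e', -, ψ, hψ⟩ := hα c hc
  obtain ⟨χ, hχ⟩ := Frob.exists_linearMap_comp φ ψ
  refine ⟨e + 1 + e', by omega, χ.toAddMonoidHom, χ.map_smul, (hχ d).trans ?_⟩
  rw [show φ (Frob.equiv p (e + 1) S d) = algebraMap R S c from hφ]
  exact hψ
end

section
/- Let k be a field, let B be a domain that is a finitely generated k-algebra, let R be a finitely generated B-algebra, let N be a finitely generated R-module, and set M = Hom_R(N, R). Then there exists a nonzero element u ∈ B such that for every prime ideal 𝔭 of B with u ∉ 𝔭, the natural base-change map M ⊗_B κ(𝔭) → Hom_{R ⊗_B κ(𝔭)}(N ⊗_B κ(𝔭), R ⊗_B κ(𝔭)) is an isomorphism of (R ⊗_B κ(𝔭))-modules, where κ(𝔭) denotes the residue field Frac(B/𝔭). -/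
open TensorProduct

/-- The localization of the `B`-module `M` away from `u` is flat over `B`. -/
def Module.FlatAway {B : Type*} [CommRing B] (u : B) (M : Type*) [AddCommGroup M] [Module B M] :
    Prop :=
  Module.Flat B (LocalizedModule.Away u M)

universe v

namespace Module.FlatAway

section Basic

variable {B : Type*} [CommRing B] {u : B} {M M' M'' : Type*}
  [AddCommGroup M] [Module B M] [AddCommGroup M'] [Module B M'] [AddCommGroup M''] [Module B M'']

theorem iff_forall_ideal : FlatAway u M ↔ ∀ (I : Ideal B) (x : M ⊗[B] I),
    I.subtype.lTensor M x = 0 → ∃ n : ℕ, u ^ n • x = 0 := by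
  let S := Submonoid.powers u
  let g := LocalizedModule.mkLinearMap S M
  have key (I : Ideal B) : I.subtype.lTensor (LocalizedModule S M) =
      IsLocalizedModule.map S (AlgebraTensorModule.rTensor B I g)
        (AlgebraTensorModule.rTensor B B g) (AlgebraTensorModule.lTensor B M I.subtype) :=
    (IsLocalizedModule.map_lTensor (S := S) (f := I.subtype) (g := g)).symm
  rw [FlatAway, Module.Flat.iff_lTensor_injective']
  refine forall_congr' fun I ↦ ?_
  rw [key, injective_iff_map_eq_zero]
  constructor
  · intro h x hx
    have := h (AlgebraTensorModule.rTensor B I g x) (by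
      rw [IsLocalizedModule.map_apply]
      exact (congrArg _ hx).trans (map_zero _))
    obtain ⟨⟨_, n, rfl⟩, hn⟩ := (IsLocalizedModule.eq_zero_iff S _).mp this
    exact ⟨n, hn⟩
  · intro h y hy
    obtain ⟨⟨x, s⟩, rfl⟩ :=
      IsLocalizedModule.mk'_surjective S (AlgebraTensorModule.rTensor B I g) y
    simp only [Function.uncurry_apply_pair, IsLocalizedModule.map_mk',
      IsLocalizedModule.mk'_eq_zero'] at hy ⊢
    obtain ⟨c, hc⟩ := hy
    obtain ⟨n, hn⟩ := h (c • x) (by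
      rw [← hc]
      exact LinearMap.map_smul_of_tower (I.subtype.lTensor M) c x)
    exact ⟨⟨u ^ n, n, rfl⟩ * c, by rw [mul_smul]; exact hn⟩

theorem of_dvd {v : B} (h : FlatAway u M) (huv : u ∣ v) : FlatAway v M := by
  rw [iff_forall_ideal] at h ⊢
  intro I x hx
  obtain ⟨n, hn⟩ := h I x hx
  obtain ⟨c, rfl⟩ := huv
  exact ⟨n, by rw [mul_pow, mul_comm, mul_smul, hn, smul_zero]⟩

theorem of_exact (h' : FlatAway u M') (h'' : FlatAway u M'') (f : M' →ₗ[B] M) (g : M →ₗ[B] M'')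
    (hf : Function.Injective f) (hg : Function.Surjective g) (hfg : Function.Exact f g) :
    FlatAway u M := by
  rw [iff_forall_ideal] at h' h'' ⊢
  intro I x hx
  obtain ⟨n, hn⟩ := h'' I (g.rTensor I x) (by
    rw [← LinearMap.comp_apply, LinearMap.lTensor_comp_rTensor, ← LinearMap.rTensor_comp_lTensor,
      LinearMap.comp_apply, hx, map_zero])
  rw [← map_smul] at hn
  obtain ⟨y, hy⟩ := (rTensor_exact I hfg hg _).mp hn
  obtain ⟨m, hm⟩ := h' I y (by
    apply Module.Flat.rTensor_preserves_injective_linearMap (M := B) f hf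
    rw [← LinearMap.comp_apply, LinearMap.rTensor_comp_lTensor, ← LinearMap.lTensor_comp_rTensor,
      LinearMap.comp_apply, hy, map_smul, hx, smul_zero, map_zero])
  exact ⟨m + n, by rw [pow_add, mul_smul, ← hy, ← map_smul, hm, map_zero]⟩

theorem of_linearEquiv (h : FlatAway u M) (e : M ≃ₗ[B] M') : FlatAway u M' := by
  rw [iff_forall_ideal] at h ⊢
  intro I x hx
  obtain ⟨n, hn⟩ := h I (e.symm.toLinearMap.rTensor I x) (by
    rw [← LinearMap.comp_apply, LinearMap.lTensor_comp_rTensor, ← LinearMap.rTensor_comp_lTensor,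
      LinearMap.comp_apply, hx, map_zero])
  refine ⟨n, (e.symm.rTensor I).injective ?_⟩
  rw [map_zero, map_smul]
  exact hn

theorem of_iSup_eq_top (F : ℕ →o Submodule B M) (hF : ⨆ n, F n = ⊤)
    (h : ∀ n, FlatAway u (F n)) : FlatAway u M := by
  simp only [iff_forall_ideal] at h ⊢
  intro I x hx
  obtain ⟨n, y, rfl⟩ : ∃ n y, (F n).subtype.rTensor I y = x := by
    clear hx
    induction x with
    | zero => exact ⟨0, 0, map_zero _⟩
    | tmul m i =>
      have hm : m ∈ ⨆ n, F n := hF ▸ Submodule.mem_top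
      obtain ⟨n, hn⟩ := (Submodule.mem_iSup_of_chain F m).mp hm
      exact ⟨n, ⟨m, hn⟩ ⊗ₜ i, rfl⟩
    | add x y hx hy =>
      obtain ⟨n, x, rfl⟩ := hx
      obtain ⟨m, y, rfl⟩ := hy
      refine ⟨max n m, (Submodule.inclusion (F.monotone (le_max_left n m))).rTensor I x +
        (Submodule.inclusion (F.monotone (le_max_right n m))).rTensor I y, ?_⟩
      rw [map_add, ← LinearMap.rTensor_comp_apply, ← LinearMap.rTensor_comp_apply,
        Submodule.subtype_comp_inclusion, Submodule.subtype_comp_inclusion]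
  obtain ⟨k, hk⟩ := h n I y (by
    apply Module.Flat.rTensor_preserves_injective_linearMap (M := B) (F n).subtype
      (F n).injective_subtype
    rw [← LinearMap.comp_apply, LinearMap.rTensor_comp_lTensor, ← LinearMap.lTensor_comp_rTensor,
      LinearMap.comp_apply, hx, map_zero])
  exact ⟨k, by rw [← map_smul, hk, map_zero]⟩

/-- If `u` acts invertibly on `Q`, then tensoring with `Q` preserves injections whose cokernel
is flat away from `u`. -/
theorem rTensor_injective (h : FlatAway u M'') (f : M' →ₗ[B] M) (g : M →ₗ[B] M'')
    (hf : Function.Injective f) (hg : Function.Surjective g) (hfg : Function.Exact f g)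
    (Q : Type*) [AddCommGroup Q] [Module B Q] (hu : IsUnit (algebraMap B (Module.End B Q) u)) :
    Function.Injective (f.rTensor Q) := by
  let S := Submonoid.powers u
  let ι := LocalizedModule.mkLinearMap S M'
  let ι' := LocalizedModule.mkLinearMap S M
  let ι'' := LocalizedModule.mkLinearMap S M''
  have : Module.Flat B (LocalizedModule S M'') := h
  have inj := LinearMap.lTensor_injective_of_exact_of_flat
    (IsLocalizedModule.map S ι' ι'' g) (IsLocalizedModule.map_surjective S ι' ι'' g hg)
    (IsLocalizedModule.map S ι ι' f) (IsLocalizedModule.map_injective S ι ι' f hf)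
    (IsLocalizedModule.map_exact S ι ι' ι'' f g hfg) Q
  rw [LinearMap.lTensor_inj_iff_rTensor_inj] at inj
  rw [injective_iff_map_eq_zero]
  intro x hx
  have hx' : AlgebraTensorModule.rTensor B Q ι x = 0 := by
    apply inj
    change ((IsLocalizedModule.map S ι ι' f).rTensor Q) (ι.rTensor Q x) = _
    rw [map_zero, ← LinearMap.rTensor_comp_apply, IsLocalizedModule.map_comp,
      LinearMap.rTensor_comp_apply, hx, map_zero]
  obtain ⟨⟨_, n, rfl⟩, hn⟩ := (IsLocalizedModule.eq_zero_iff S _).mp hx'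
  obtain ⟨v, hv⟩ := hu.exists_left_inv
  have huv : (v ^ n).lTensor M' (u ^ n • x) = x := by
    have hc : Commute v (algebraMap B (Module.End B Q) u) := (Algebra.commutes u v).symm
    have : (v ^ n) ∘ₗ (algebraMap B (Module.End B Q) (u ^ n)) = LinearMap.id := by
      change v ^ n * _ = 1
      rw [map_pow, ← hc.mul_pow, hv, one_pow]
    have h2 : u ^ n • x = (algebraMap B (Module.End B Q) (u ^ n)).lTensor M' x := by
      rw [Module.algebraMap_end_eq_smul_id, LinearMap.lTensor_smul]
      simp
    rw [h2, ← LinearMap.lTensor_comp_apply, this, LinearMap.lTensor_id, LinearMap.id_apply]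
  have hn' : u ^ n • x = 0 := hn
  rw [← huv, hn', map_zero]

theorem exists_of_finite [IsDomain B] [IsNoetherianRing B] [Module.Finite B M] :
    ∃ u : B, u ≠ 0 ∧ FlatAway u M := by
  have : Module.FinitePresentation B M := Module.finitePresentation_of_finite B M
  obtain ⟨r, hr, hfree, -⟩ := Module.FinitePresentation.exists_free_localizedModule_powers
    (nonZeroDivisors B) (LocalizedModule.mkLinearMap (nonZeroDivisors B) M) (FractionRing B)
  refine ⟨r, nonZeroDivisors.ne_zero hr, ?_⟩
  have : Module.Flat B (Localization (.powers r)) := IsLocalization.flat _ (.powers r)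
  exact Module.Flat.trans B (Localization (.powers r)) (LocalizedModule.Away r M)

end Basic

section Tower

variable {B A : Type*} [CommRing B] [CommRing A] [Algebra B A] {u : B} {M D : Type*}
  [AddCommGroup M] [Module A M] [Module B M] [IsScalarTower B A M]
  [AddCommGroup D] [Module A D] [Module B D] [IsScalarTower B A D]

theorem sup_range {N : Submodule A M} {φ : D →ₗ[A] M} (hN : FlatAway u N)
    (hD : FlatAway u (D ⧸ N.comap φ)) : FlatAway u ↥(N ⊔ LinearMap.range φ) := by
  let g := N.mkQ ∘ₗ (N ⊔ LinearMap.range φ).subtype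
  have hker : LinearMap.ker (N.mkQ ∘ₗ φ) = N.comap φ := by
    rw [LinearMap.ker_comp, Submodule.ker_mkQ]
  have hrange : LinearMap.range (N.mkQ ∘ₗ φ) = LinearMap.range g := by
    rw [LinearMap.range_comp, LinearMap.range_comp, Submodule.range_subtype, Submodule.map_sup,
      Submodule.mkQ_map_self, bot_sup_eq]
  have hg : FlatAway u (LinearMap.range g) := hD.of_linearEquiv
    ((Submodule.quotEquivOfEq _ _ hker.symm ≪≫ₗ (N.mkQ ∘ₗ φ).quotKerEquivRange ≪≫ₗ
      LinearEquiv.ofEq _ _ hrange).restrictScalars B)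
  have hle : N ≤ N ⊔ LinearMap.range φ := le_sup_left
  refine hN.of_exact hg ((Submodule.inclusion hle).restrictScalars B)
    (g.rangeRestrict.restrictScalars B) (Submodule.inclusion_injective hle)
    g.surjective_rangeRestrict fun y ↦ ?_
  have : (g.rangeRestrict y = 0) ↔ (y : M) ∈ N := by
    rw [← Submodule.Quotient.mk_eq_zero N, Subtype.ext_iff]
    rfl
  refine this.trans ⟨fun hy ↦ ⟨⟨y, hy⟩, rfl⟩, ?_⟩
  rintro ⟨z, rfl⟩
  exact z.2

/-- A module generated over `A` by the iterates under `x` of a finite submodule is generically flat,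
provided that finite `A`-modules are. -/
theorem exists_of_iSup_map_pow [IsDomain B] [IsNoetherianRing A]
    (hA : ∀ (Q : Type v) [AddCommGroup Q] [Module A Q] [Module B Q] [IsScalarTower B A Q]
      [Module.Finite A Q], ∃ u : B, u ≠ 0 ∧ FlatAway u Q)
    {M : Type v} [AddCommGroup M] [Module A M] [Module B M] [IsScalarTower B A M]
    (x : Module.End A M) (M₀ : Submodule A M) [Module.Finite A M₀]
    (h : ⨆ n, M₀.map (x ^ n) = ⊤) : ∃ u : B, u ≠ 0 ∧ FlatAway u M := by
  let F : ℕ →o Submodule A M := partialSups fun n ↦ M₀.map (x ^ n)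
  have hF (n : ℕ) : F (n + 1) = F n ⊔ M₀.map (x ^ (n + 1)) := partialSups_add_one _ _
  have hF0 : F 0 = M₀ := by
    simp only [F, partialSups_zero, pow_zero]
    exact Submodule.map_id M₀
  have hxF (n : ℕ) : (F n).map x ≤ F (n + 1) := by
    have hmap (n : ℕ) : (M₀.map (x ^ n)).map x = M₀.map (x ^ (n + 1)) := by
      rw [← Submodule.map_comp, pow_succ']
      rfl
    induction n with
    | zero =>
      rw [hF, hF0, ← hmap, pow_zero]
      exact le_trans (Submodule.map_mono (Submodule.map_id M₀).ge) le_sup_right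
    | succ n ih =>
      rw [hF n, Submodule.map_sup, hmap, hF (n + 1)]
      exact sup_le_sup_right ih _
  let φ (n : ℕ) : M₀ →ₗ[A] M := (x ^ (n + 1)) ∘ₗ M₀.subtype
  have hφ (n : ℕ) : LinearMap.range (φ n) = M₀.map (x ^ (n + 1)) := by
    rw [LinearMap.range_comp, Submodule.range_subtype]
  let K : ℕ →o Submodule A M₀ := ⟨fun n ↦ (F n).comap (φ n), monotone_nat_of_le_succ fun n m hm ↦ by
    refine hxF n ⟨_, hm, ?_⟩
    simp only [φ, LinearMap.comp_apply]
    rw [pow_succ' x (n + 1)]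
    rfl⟩
  obtain ⟨N, hN⟩ := monotone_stabilizes_iff_noetherian.mpr
    (inferInstance : IsNoetherian A M₀) K
  choose u hu0 hu using fun n ↦ hA (M₀ ⧸ K n)
  obtain ⟨v, hv0, hv⟩ := hA M₀
  let w := v * ∏ i ∈ Finset.range (N + 1), u i
  have hwK (n : ℕ) : FlatAway w (M₀ ⧸ K n) := by
    have hle (n : ℕ) (hn : n ≤ N) : FlatAway w (M₀ ⧸ K n) :=
      (hu n).of_dvd ((Finset.dvd_prod_of_mem u (Finset.mem_range_succ_iff.mpr hn)).mul_left v)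
    rcases le_total n N with hn | hn
    · exact hle n hn
    · rw [← hN n hn]
      exact hle N le_rfl
  have hwF (n : ℕ) : FlatAway w (F n) := by
    induction n with
    | zero =>
      rw [hF0]
      exact hv.of_dvd (dvd_mul_right _ _)
    | succ n ih =>
      rw [hF, ← hφ]
      exact ih.sup_range (hwK n)
  refine ⟨w, mul_ne_zero hv0 (Finset.prod_ne_zero_iff.mpr fun i _ ↦ hu0 i), ?_⟩
  refine of_iSup_eq_top ⟨fun n ↦ (F n).restrictScalars B, F.monotone⟩ ?_ hwF
  rw [eq_top_iff]
  intro m _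
  have hm : m ∈ ⨆ n, F n := by
    rw [show ⨆ n, F n = ⊤ from (iSup_partialSups_eq _).trans h]
    trivial
  obtain ⟨n, hn⟩ := (Submodule.mem_iSup_of_chain F m).mp hm
  exact Submodule.mem_iSup_of_mem n hn

end Tower

/-- Every finite `A`-module in the universe `v` becomes flat over `B` after inverting a
nonzero element of `B`. -/
def ForFiniteModules (B A : Type*) [CommRing B] [CommRing A] [Algebra B A] : Prop :=
  ∀ (M : Type v) [AddCommGroup M] [Module A M] [Module B M] [IsScalarTower B A M]
    [Module.Finite A M], ∃ u : B, u ≠ 0 ∧ FlatAway u M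

namespace ForFiniteModules

variable {B A A' : Type*} [CommRing B] [CommRing A] [Algebra B A] [CommRing A'] [Algebra B A']

theorem of_surjective (h : ForFiniteModules.{v} B A) (f : A →ₐ[B] A')
    (hf : Function.Surjective f) : ForFiniteModules.{v} B A' := by
  intro M _ _ _ _ _
  algebraize [f.toRingHom]
  let : Module A M := Module.compHom M f.toRingHom
  have : IsScalarTower A A' M := .of_algebraMap_smul fun _ _ ↦ rfl
  have : IsScalarTower B A M := .of_algebraMap_smul fun b m ↦ by
    rw [← algebraMap_smul A' (algebraMap B A b) m, ← algebraMap_smul A' b m]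
    exact congrArg (· • m) (f.commutes b)
  have : Module.Finite A A' := .of_surjective (Algebra.linearMap A A') hf
  have : Module.Finite A M := .trans A' M
  exact h M

open Polynomial in
theorem polynomial [IsDomain B] [IsNoetherianRing A] (h : ForFiniteModules.{v} B A) :
    ForFiniteModules.{v} B A[X] := by
  intro M _ _ _ _ _
  let : Module A M := Module.compHom M (C : A →+* A[X])
  have : IsScalarTower A A[X] M := .of_algebraMap_smul fun _ _ ↦ rfl
  have : IsScalarTower B A M := .of_algebraMap_smul fun b m ↦ by
    rw [← algebraMap_smul A[X] (algebraMap B A b) m, ← algebraMap_smul A[X] b m]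
    rfl
  obtain ⟨T, hT⟩ := (inferInstance : Module.Finite A[X] M).fg_top
  have : Module.Finite A (Submodule.span A (T : Set M)) := Module.Finite.span_finset A T
  refine exists_of_iSup_map_pow h (Algebra.lsmul A A M (X : A[X])) (Submodule.span A T) ?_
  rw [eq_top_iff]
  rintro m -
  have hm : m ∈ Submodule.span A[X] (T : Set M) := hT ▸ Submodule.mem_top
  induction hm using Submodule.span_induction with
  | mem t ht =>
    exact Submodule.mem_iSup_of_mem 0 ⟨t, Submodule.subset_span ht, by simp⟩
  | zero => exact zero_mem _
  | add _ _ _ _ h₁ h₂ => exact add_mem h₁ h₂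
  | smul p m _ hm =>
    have hX (m) (hm : m ∈ ⨆ n, (Submodule.span A (T : Set M)).map
        ((Algebra.lsmul A A M (X : A[X])) ^ n)) :
        (X : A[X]) • m ∈ ⨆ n, (Submodule.span A (T : Set M)).map
          ((Algebra.lsmul A A M (X : A[X])) ^ n) := by
      induction hm using Submodule.iSup_induction' with
      | mem n m hm =>
        obtain ⟨t, ht, rfl⟩ := hm
        refine Submodule.mem_iSup_of_mem (n + 1) ⟨t, ht, ?_⟩
        rw [pow_succ']
        rfl
      | zero => rw [smul_zero]; exact zero_mem _
      | add _ _ _ _ h₁ h₂ => rw [smul_add]; exact add_mem h₁ h₂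
    induction p using Polynomial.induction_on' with
    | add p q hp hq => rw [add_smul]; exact add_mem hp hq
    | monomial n a =>
      rw [← C_mul_X_pow_eq_monomial, mul_smul]
      refine Submodule.smul_mem _ a ?_
      induction n with
      | zero => rwa [pow_zero, one_smul]
      | succ n ih => rw [pow_succ', mul_smul]; exact hX _ ih

theorem of_finite [IsDomain B] [IsNoetherianRing B] [Module.Finite B A] :
    ForFiniteModules.{v} B A := by
  intro M _ _ _ _ _
  have : Module.Finite B M := .trans A M
  exact exists_of_finite

theorem mvPolynomial [IsDomain B] [IsNoetherianRing B] (n : ℕ) :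
    ForFiniteModules.{v} B (MvPolynomial (Fin n) B) := by
  induction n with
  | zero =>
    have : Module.Finite B (MvPolynomial (Fin 0) B) :=
      .equiv (MvPolynomial.isEmptyAlgEquiv B (Fin 0)).symm.toLinearEquiv
    exact of_finite
  | succ n ih =>
    exact ih.polynomial.of_surjective
      ((MvPolynomial.finSuccEquiv B n).symm : _ →ₐ[B] MvPolynomial (Fin (n + 1)) B)
      (MvPolynomial.finSuccEquiv B n).symm.surjective

/-- Generic flatness for finite modules over algebras of finite type. -/
theorem of_finiteType [IsDomain B] [IsNoetherianRing B] [Algebra.FiniteType B A] :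
    ForFiniteModules.{v} B A := by
  obtain ⟨n, f, hf⟩ := Algebra.FiniteType.iff_quotient_mvPolynomial''.mp
    (inferInstance : Algebra.FiniteType B A)
  exact (mvPolynomial n).of_surjective f hf

end ForFiniteModules

end Module.FlatAway

section LeftExact

variable {R : Type*} [CommRing R] {M₁ M₂ M₃ N₁ N₂ N₃ : Type*}
  [AddCommGroup M₁] [AddCommGroup M₂] [AddCommGroup M₃]
  [AddCommGroup N₁] [AddCommGroup N₂] [AddCommGroup N₃] [Module R M₁] [Module R M₂] [Module R M₃]
  [Module R N₁] [Module R N₂] [Module R N₃]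

theorem Function.Exact.rangeRestrict {f : M₁ →ₗ[R] M₂} {g : M₂ →ₗ[R] M₃}
    (h : Function.Exact f g) : Function.Exact f g.rangeRestrict := fun x ↦ by
  rw [← h x, Subtype.ext_iff]
  rfl

theorem Function.Exact.lTensor_of_injective {f : M₁ →ₗ[R] M₂} {g : M₂ →ₗ[R] M₃}
    (h : Function.Exact f g) (S : Type*) [AddCommGroup S] [Module R S]
    (hg : Function.Injective ((LinearMap.range g).subtype.lTensor S)) :
    Function.Exact (f.lTensor S) (g.lTensor S) := by
  have := hg.comp_exact_iff_exact.mpr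
    (lTensor_exact S h.rangeRestrict g.surjective_rangeRestrict)
  rwa [← LinearMap.lTensor_comp, LinearMap.rangeRestrict, LinearMap.subtype_comp_codRestrict] at this

/-- A variant of `IsBaseChange.of_left_exact` without flatness of `S`. -/
theorem IsBaseChange.of_left_exact_of_injective (S : Type*) [CommRing S] [Algebra R S]
    [Module S N₁] [Module S N₂] [Module S N₃]
    [IsScalarTower R S N₁] [IsScalarTower R S N₂] [IsScalarTower R S N₃]
    (h₁ : M₁ →ₗ[R] N₁) (h₂ : M₂ →ₗ[R] N₂) (h₃ : M₃ →ₗ[R] N₃)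
    {f : M₁ →ₗ[R] M₂} {g : M₂ →ₗ[R] M₃} {f' : N₁ →ₗ[S] N₂} {g' : N₂ →ₗ[S] N₃}
    (comm₁ : h₂ ∘ₗ f = f'.restrictScalars R ∘ₗ h₁) (comm₂ : h₃ ∘ₗ g = g'.restrictScalars R ∘ₗ h₂)
    (isb₂ : IsBaseChange S h₂) (isb₃ : IsBaseChange S h₃)
    (exact₁ : Function.Exact (f.lTensor S) (g.lTensor S))
    (inj₁ : Function.Injective (f.lTensor S))
    (exact₂ : Function.Exact f' g') (inj₂ : Function.Injective f') : IsBaseChange S h₁ := by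
  simp only [IsBaseChange, IsTensorProduct] at isb₂ isb₃ ⊢
  refine LinearMap.bijective_of_bijective_of_injective_of_left_exact
    ((f.baseChange S).restrictScalars R) ((g.baseChange S).restrictScalars R)
    (f'.restrictScalars R) (g'.restrictScalars R) _ _ _ ?_ ?_ exact₁ exact₂ isb₂ isb₃.1 inj₁ inj₂
  · ext s m
    simpa using congrArg (s • ·) (LinearMap.congr_fun comm₁ m).symm
  · ext s m
    simpa using congrArg (s • ·) (LinearMap.congr_fun comm₂ m).symm

end LeftExact

section DualBaseChange

variable {R : Type*} [CommRing R] (S : Type*) [CommRing S] [Algebra R S]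
  {N P Q : Type*} [AddCommGroup N] [Module R N] [AddCommGroup P] [Module R P]
  [AddCommGroup Q] [Module R Q]

variable (R N) in
/-- The natural map `Hom_R(N, R) → Hom_S(S ⊗[R] N, S)`. -/
noncomputable def Module.Dual.toBaseChange :
    (N →ₗ[R] R) →ₗ[R] (S ⊗[R] N →ₗ[S] S) :=
  (TensorProduct.isBaseChange R N S).linearMapLeftRightHom (Algebra.linearMap R S)

@[simp]
theorem Module.Dual.toBaseChange_tmul (l : N →ₗ[R] R) (s : S) (n : N) :
    toBaseChange R S N l (s ⊗ₜ n) = s * algebraMap R S (l n) := by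
  have h : toBaseChange R S N l (1 ⊗ₜ n) = algebraMap R S (l n) :=
    IsBaseChange.linearMapLeftRightHom_comp_apply _ _ l n
  rw [← mul_one s, ← smul_eq_mul, ← TensorProduct.smul_tmul', map_smul, h, smul_eq_mul,
    smul_eq_mul, mul_one]

theorem Module.Dual.toBaseChange_comp_lcomp (p : P →ₗ[R] N) :
    toBaseChange R S P ∘ₗ p.lcomp R R =
      ((p.baseChange S).lcomp S S).restrictScalars R ∘ₗ toBaseChange R S N := by
  ext l s
  simp

/-- If `Q → P → N → 0` is a presentation by finite free modules, then the formation of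
`Hom_R(N, R)` commutes with base change to `S` as soon as the inclusions of `Hom_R(N, R)` in
`Hom_R(P, R)` and of the image of `Hom_R(P, R)` in `Hom_R(Q, R)` stay injective over `S`. -/
theorem Module.Dual.isBaseChange_toBaseChange [Module.Free R P] [Module.Finite R P]
    [Module.Free R Q] [Module.Finite R Q] (p : P →ₗ[R] N) (q : Q →ₗ[R] P)
    (hp : Function.Surjective p) (hqp : Function.Exact q p)
    (h₁ : Function.Injective ((p.lcomp R R).lTensor S))
    (h₂ : Function.Injective ((LinearMap.range (q.lcomp R R)).subtype.lTensor S)) :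
    IsBaseChange S (toBaseChange R S N) := by
  have hdual : Function.Exact (p.lcomp R R) (q.lcomp R R) :=
    LinearMap.exact_lcomp_of_exact_of_surjective R hqp hp
  refine IsBaseChange.of_left_exact_of_injective S _ _ _
    (toBaseChange_comp_lcomp S p) (toBaseChange_comp_lcomp S q)
    ((TensorProduct.isBaseChange R P S).linearMapLeftRight (IsBaseChange.linearMap R S))
    ((TensorProduct.isBaseChange R Q S).linearMapLeftRight (IsBaseChange.linearMap R S))
    (hdual.lTensor_of_injective S h₂) h₁
    (LinearMap.exact_lcomp_of_exact_of_surjective S (lTensor_exact S hqp hp)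
      (LinearMap.lTensor_surjective S hp))
    (LinearMap.lcomp_injective_of_surjective _ (LinearMap.lTensor_surjective S hp))

end DualBaseChange

theorem LinearMap.lTensor_tensorProduct_injective {B R : Type*} [CommRing B] [CommRing R]
    [Algebra B R] {K F : Type*} [AddCommGroup K] [Module R K] [Module B K] [IsScalarTower B R K]
    [AddCommGroup F] [Module R F] [Module B F] [IsScalarTower B R F] (f : K →ₗ[R] F)
    (κ : Type*) [AddCommGroup κ] [Module B κ]
    (h : Function.Injective ((f.restrictScalars B).rTensor κ)) :
    Function.Injective (f.lTensor (R ⊗[B] κ)) := by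
  rw [LinearMap.lTensor_inj_iff_rTensor_inj]
  let eK := AlgebraTensorModule.cancelBaseChange B R R K κ
  let eF := AlgebraTensorModule.cancelBaseChange B R R F κ
  have hcomm : eF.toLinearMap ∘ₗ f.rTensor (R ⊗[B] κ) =
      AlgebraTensorModule.rTensor B κ f ∘ₗ eK.toLinearMap := by
    ext
    simp [eK, eF]
  have hcomp : Function.Injective (AlgebraTensorModule.rTensor B κ f ∘ eK) :=
    Function.Injective.comp h eK.injective
  refine Function.Injective.of_comp (f := eF) ?_
  convert! hcomp using 1
  exact congrArg DFunLike.coe hcomm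

theorem Module.FlatAway.lTensor_tensorProduct_injective {B R : Type*} [CommRing B] [CommRing R]
    [Algebra B R] {u : B} {M M' M'' : Type*} [AddCommGroup M] [Module R M] [Module B M]
    [IsScalarTower B R M] [AddCommGroup M'] [Module R M'] [Module B M'] [IsScalarTower B R M']
    [AddCommGroup M''] [Module R M''] [Module B M''] [IsScalarTower B R M'']
    (h : FlatAway u M'') (f : M' →ₗ[R] M) (g : M →ₗ[R] M'')
    (hf : Function.Injective f) (hg : Function.Surjective g) (hfg : Function.Exact f g)
    (κ : Type*) [AddCommGroup κ] [Module B κ] (hu : IsUnit (algebraMap B (Module.End B κ) u)) :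
    Function.Injective (f.lTensor (R ⊗[B] κ)) :=
  LinearMap.lTensor_tensorProduct_injective f κ <|
    h.rTensor_injective (f.restrictScalars B) (g.restrictScalars B) hf hg hfg κ hu

/-- Generic base change for duals: if `B` is a domain of finite type over a field `k`,
`R` a finitely generated `B`-algebra, `N` a finitely generated `R`-module and
`M = Hom_R(N, R)`, then there is a nonzero `u ∈ B` such that for every prime `𝔭` of `B`
avoiding `u`, with residue field `κ = κ(𝔭) = Frac(B/𝔭)`, the natural base-change map
`M ⊗_B κ(𝔭) → Hom_{R ⊗_B κ(𝔭)}(N ⊗_B κ(𝔭), R ⊗_B κ(𝔭))` is an isomorphism of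
`(R ⊗_B κ(𝔭))`-modules; we express both sides via base change along `R → R ⊗[B] κ`,
so the conclusion asserts the existence of a `(R ⊗[B] κ)`-linear equivalence agreeing
with the natural map `(x ⊗ λ) ↦ (y ⊗ n ↦ x · y · λ(n))` on simple tensors. -/
theorem generic_baseChange_of_dual_isomorphism (k B R N : Type*) [Field k]
    [CommRing B] [IsDomain B] [Algebra k B] [Algebra.FiniteType k B]
    [CommRing R] [Algebra B R] [Algebra.FiniteType B R]
    [AddCommGroup N] [Module R N] [Module.Finite R N] :
    ∃ u : B, u ≠ 0 ∧ ∀ (𝔭 : Ideal B) [𝔭.IsPrime], u ∉ 𝔭 →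
      ∀ (κ : Type*) [Field κ] [Algebra (B ⧸ 𝔭) κ] [IsFractionRing (B ⧸ 𝔭) κ]
        [Algebra B κ] [IsScalarTower B (B ⧸ 𝔭) κ],
        ∃ Φ : ((R ⊗[B] κ) ⊗[R] (N →ₗ[R] R)) ≃ₗ[R ⊗[B] κ]
            (((R ⊗[B] κ) ⊗[R] N) →ₗ[R ⊗[B] κ] (R ⊗[B] κ)),
          ∀ (x : R ⊗[B] κ) (l : N →ₗ[R] R) (y : R ⊗[B] κ) (n : N),
            Φ (x ⊗ₜ l) (y ⊗ₜ n) = x * y * algebraMap R (R ⊗[B] κ) (l n) := by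
  have : IsNoetherianRing B := Algebra.FiniteType.isNoetherianRing k B
  have : IsNoetherianRing R := Algebra.FiniteType.isNoetherianRing B R
  have := Module.finitePresentation_of_finite R N
  obtain ⟨n, m, p, q, hp, hqp⟩ := Module.FinitePresentation.exists_fin' R N
  let d := q.lcomp R R
  have hdual : Function.Exact (p.lcomp R R) d :=
    LinearMap.exact_lcomp_of_exact_of_surjective R hqp hp
  obtain ⟨u, hu0, hu⟩ := Module.FlatAway.ForFiniteModules.of_finiteType (B := B) (A := R)
    (LinearMap.range d)
  obtain ⟨v, hv0, hv⟩ := Module.FlatAway.ForFiniteModules.of_finiteType (B := B) (A := R)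
    (((Fin m → R) →ₗ[R] R) ⧸ LinearMap.range d)
  refine ⟨u * v, mul_ne_zero hu0 hv0, fun 𝔭 _ huv κ _ _ _ _ _ ↦ ?_⟩
  have hunit : IsUnit (algebraMap B (Module.End B κ) (u * v)) := by
    have : algebraMap B κ (u * v) ≠ 0 := by
      rw [IsScalarTower.algebraMap_apply B (B ⧸ 𝔭) κ, Ne,
        FaithfulSMul.algebraMap_eq_zero_iff]
      exact fun h ↦ huv (Ideal.Quotient.eq_zero_iff_mem.mp h)
    rw [← (Algebra.lmul B κ).commutes]
    exact this.isUnit.map _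
  have h₁ : Function.Injective ((p.lcomp R R).lTensor (R ⊗[B] κ)) :=
    (hu.of_dvd (dvd_mul_right u v)).lTensor_tensorProduct_injective _ d.rangeRestrict
      (LinearMap.lcomp_injective_of_surjective p hp) d.surjective_rangeRestrict
      hdual.rangeRestrict κ hunit
  have h₂ : Function.Injective ((LinearMap.range d).subtype.lTensor (R ⊗[B] κ)) :=
    (hv.of_dvd (dvd_mul_left v u)).lTensor_tensorProduct_injective _ (LinearMap.range d).mkQ
      (LinearMap.range d).injective_subtype (LinearMap.range d).mkQ_surjective
      (LinearMap.exact_subtype_mkQ _) κ hunit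
  have hbc := Module.Dual.isBaseChange_toBaseChange (R ⊗[B] κ) p q hp hqp h₁ h₂
  refine ⟨hbc.equiv, fun x l y n ↦ ?_⟩
  rw [IsBaseChange.equiv_tmul, LinearMap.smul_apply, Module.Dual.toBaseChange_tmul, smul_eq_mul,
    mul_assoc]
end

section
/- Let p be a prime, let R be an F-finite Noetherian domain of characteristic p that is F-pure, and let S be the integral closure of R in its fraction field Frac(R) (a finitely generated R-module since R is F-finite). Then R satisfies (WN1); in particular, for every height-one prime ideal 𝔮 of S, setting 𝔭 = 𝔮 ∩ R, one has 𝔭·S_𝔮 = 𝔮·S_𝔮, and the residue field extension κ(𝔭) → κ(𝔮) is a separable field extension, so that the normalization R → S is unramified in codimension one. -/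
/-- A ring `R` of prime characteristic `p` is `F`-pure (Frobenius split) if there is an
`R`-linear map `F_* R → R` sending `1` to `1`, i.e. an additive map `φ : R → R` with
`φ (r ^ p * x) = r * φ x` and `φ 1 = 1`. -/
def IsFPure (p : ℕ) (R : Type*) [CommRing R] : Prop :=
  ∃ φ : R →+ R, (∀ r x : R, φ (r ^ p * x) = r * φ x) ∧ φ 1 = 1

theorem exists_frobeniusInverseLinear_extension {A K : Type*} [CommRing A] [IsDomain A] [Field K]
    [Algebra A K] [IsFractionRing A K] {p : ℕ} (hp : 0 < p) (φ : A →+ A)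
    (hφ : ∀ r x : A, φ (r ^ p * x) = r * φ x) :
    ∃ ψ : K →+ K, (∀ z w : K, ψ (z ^ p * w) = z * ψ w) ∧
      ∀ a : A, ψ (algebraMap A K a) = algebraMap A K (φ a) := by
  have hinj := IsFractionRing.injective A K
  have hne : ∀ {b : A}, b ≠ 0 → algebraMap A K b ≠ 0 := fun hb h =>
    hb (hinj (by rw [h, map_zero]))
  have frac : ∀ z : K, ∃ a b : A, b ≠ 0 ∧ z * algebraMap A K b ^ p = algebraMap A K a := by
    intro z
    obtain ⟨a, b, hb, rfl⟩ := IsFractionRing.div_surjective (A := A) z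
    have hb0 : b ≠ 0 := nonZeroDivisors.ne_zero hb
    refine ⟨a * b ^ (p - 1), b, hb0, ?_⟩
    obtain ⟨q, rfl⟩ := Nat.exists_eq_succ_of_ne_zero hp.ne'
    have := hne hb0
    simp only [Nat.succ_eq_add_one, Nat.add_sub_cancel, map_mul, map_pow]
    field_simp
    ring
  have key : ∀ z : K, ∃ w : K, ∀ a b : A, b ≠ 0 →
      z * algebraMap A K b ^ p = algebraMap A K a → w * algebraMap A K b = algebraMap A K (φ a) := by
    intro z
    obtain ⟨a₀, b₀, hb₀, h₀⟩ := frac z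
    refine ⟨algebraMap A K (φ a₀) / algebraMap A K b₀, fun a b hb h => ?_⟩
    have e : b ^ p * a₀ = b₀ ^ p * a := hinj (by
      simp only [map_mul, map_pow, ← h₀, ← h]; ring)
    have e' : b * φ a₀ = b₀ * φ a := by rw [← hφ, ← hφ, e]
    have := hne hb₀
    have e'' := congrArg (algebraMap A K) e'
    simp only [map_mul] at e''
    field_simp
    linear_combination e''
  choose ψ hψ using key
  have hadd : ∀ z w, ψ (z + w) = ψ z + ψ w := by
    intro z w
    obtain ⟨a, b, hb, h⟩ := frac z
    obtain ⟨a', b', hb', h'⟩ := frac w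
    have hbb := mul_ne_zero hb hb'
    have h1 := hψ z (b' ^ p * a) (b * b') hbb (by simp only [map_mul, map_pow, ← h]; ring)
    have h2 := hψ w (b ^ p * a') (b * b') hbb (by simp only [map_mul, map_pow, ← h']; ring)
    have h3 := hψ (z + w) (b' ^ p * a + b ^ p * a') (b * b') hbb
      (by simp only [map_add, map_mul, map_pow, ← h, ← h']; ring)
    apply mul_right_cancel₀ (hne hbb)
    rw [h3, add_mul, h1, h2, map_add, map_add]
  refine ⟨AddMonoidHom.mk' ψ hadd, fun z w => ?_, fun a => ?_⟩
  · obtain ⟨a, b, hb, h⟩ := frac w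
    obtain ⟨c, e, he, rfl⟩ := IsFractionRing.div_surjective (A := A) z
    have he0 : e ≠ 0 := nonZeroDivisors.ne_zero he
    have h1 := hψ w a b hb h
    have := hne he0
    have h2 := hψ ((algebraMap A K c / algebraMap A K e) ^ p * w) (c ^ p * a) (e * b)
      (mul_ne_zero he0 hb) (by simp only [map_mul, map_pow, ← h, div_pow, mul_pow]; field_simp)
    rw [hφ, map_mul, map_mul, ← h1] at h2
    apply mul_right_cancel₀ (hne (mul_ne_zero he0 hb))
    simp only [AddMonoidHom.mk'_apply, map_mul]
    rw [h2]
    field_simp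
  · simpa using hψ (algebraMap A K a) a 1 one_ne_zero (by simp)

theorem exists_pIndependent_finset {R : Type*} [CommRing R] [IsDomain R] {p : ℕ}
    (hp : p.Prime) [CharP R p] (s : Finset R)
    (hs : ∀ x : R, ∃ c : R → R, x = ∑ y ∈ s, c y ^ p * y) :
    ∃ (t : Finset R) (b : R), b ≠ 0 ∧
      (∀ c : R → R, ∑ y ∈ t, c y ^ p * y = 0 → ∀ y ∈ t, c y = 0) ∧
      ∀ x : R, ∃ c : R → R, b ^ p * x = ∑ y ∈ t, c y ^ p * y := by
  classical
  have := Fact.mk hp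
  let P : Finset R → Prop := fun t => ∀ c : R → R, ∑ y ∈ t, c y ^ p * y = 0 → ∀ y ∈ t, c y = 0
  obtain ⟨t, ht, hmax⟩ := (s.powerset.filter P).exists_maximal ⟨∅, by simp [P]⟩
  rw [Finset.mem_filter, Finset.mem_powerset] at ht
  have hz : ∀ z : R, ∃ b : R, z ∈ s → b ≠ 0 ∧ ∃ c : R → R, b ^ p * z = ∑ y ∈ t, c y ^ p * y := by
    intro z
    by_cases hzs : z ∈ s
    swap
    · exact ⟨1, fun h => absurd h hzs⟩
    by_cases hzt : z ∈ t
    · refine ⟨1, fun _ => ⟨one_ne_zero, fun y => if y = z then 1 else 0, ?_⟩⟩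
      rw [Finset.sum_eq_single z]
      · simp
      · intro y _ hy
        simp [hy, hp.ne_zero]
      · exact fun h => absurd hzt h
    · have hnot : ¬ P (insert z t) := fun h => hzt (hmax (by
        change _ ∈ s.powerset.filter P
        rw [Finset.mem_filter, Finset.mem_powerset]
        exact ⟨Finset.insert_subset hzs ht.1, h⟩) (Finset.subset_insert z t)
        (Finset.mem_insert_self z t))
      simp only [P] at hnot
      push Not at hnot
      obtain ⟨c, hc, y, hy, hcy⟩ := hnot
      rw [Finset.sum_insert hzt] at hc
      refine ⟨c z, fun _ => ⟨fun h0 => ?_, fun y => - c y, ?_⟩⟩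
      · rw [h0, zero_pow hp.ne_zero, zero_mul, zero_add] at hc
        rcases Finset.mem_insert.1 hy with rfl | hy
        · exact hcy h0
        · exact hcy (ht.2 c hc y hy)
      · have hneg : ∀ a : R, (-a) ^ p = - a ^ p := fun a => map_neg (frobenius R p) a
        simp only [hneg, neg_mul, Finset.sum_neg_distrib]
        exact eq_neg_of_add_eq_zero_left hc
  choose b hb using hz
  refine ⟨t, ∏ z ∈ s, b z, Finset.prod_ne_zero_iff.2 fun z hz => (hb z hz).1, ht.2, fun x => ?_⟩
  have hz' : ∀ z, ∃ c : R → R, z ∈ s → b z ^ p * z = ∑ y ∈ t, c y ^ p * y := by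
    intro z
    by_cases hzs : z ∈ s
    · obtain ⟨c, hc⟩ := (hb z hzs).2
      exact ⟨c, fun _ => hc⟩
    · exact ⟨0, fun h => absurd h hzs⟩
  choose c hc using hz'
  obtain ⟨d, hd⟩ := hs x
  refine ⟨fun y => ∑ z ∈ s, d z * (∏ w ∈ s.erase z, b w) * c z y, ?_⟩
  simp only [sum_pow_char, Finset.sum_mul]
  rw [Finset.sum_comm]
  conv_lhs => rw [hd, Finset.mul_sum]
  refine Finset.sum_congr rfl fun z hz => ?_
  rw [← Finset.mul_prod_erase s b hz]
  calc _ = (d z * (∏ w ∈ s.erase z, b w)) ^ p * (b z ^ p * z) := by ring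
    _ = _ := by
      rw [hc z hz, Finset.mul_sum]
      exact Finset.sum_congr rfl fun y _ => by ring

theorem isSeparable_of_frobeniusInverseLinear {E L : Type*} [Field E] [Field L] [Algebra E L]
    [Algebra.IsAlgebraic E L] {p : ℕ} (hp : p.Prime) [CharP E p] (φ : L →+ L)
    (hφ : ∀ z w : L, φ (z ^ p * w) = z * φ w) (h1 : φ 1 = 1)
    (hE : ∀ e : E, ∃ e' : E, φ (algebraMap E L e) = algebraMap E L e') :
    Algebra.IsSeparable E L := by
  have := Fact.mk hp
  have : ExpChar E p := ExpChar.prime hp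
  have hM : ∀ m ∈ separableClosure E L, φ m ∈ separableClosure E L := by
    intro m hm
    have hsep : IsSeparable E m := mem_separableClosure_iff.1 hm
    have hadj : m ∈ IntermediateField.adjoin E {m ^ p} := by
      rw [← IntermediateField.adjoin_simple_eq_adjoin_pow_expChar_of_isSeparable E L hsep p]
      exact IntermediateField.mem_adjoin_simple_self E m
    rw [← IntermediateField.mem_toSubalgebra,
      IntermediateField.adjoin_simple_toSubalgebra_of_isAlgebraic
        (Algebra.IsAlgebraic.isAlgebraic _), Algebra.adjoin_singleton_eq_range_aeval] at hadj
    obtain ⟨f, hf⟩ := hadj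
    have hf' : m = ∑ i ∈ Finset.range (f.natDegree + 1), (m ^ i) ^ p * algebraMap E L (f.coeff i) := by
      conv_lhs => rw [← hf]
      change Polynomial.aeval (m ^ p) f = _
      rw [Polynomial.aeval_eq_sum_range]
      exact Finset.sum_congr rfl fun i _ => by rw [Algebra.smul_def]; ring
    rw [hf', map_sum]
    refine sum_mem fun i _ => ?_
    obtain ⟨e', he'⟩ := hE (f.coeff i)
    rw [hφ, he']
    exact mul_mem (pow_mem hm i) ((separableClosure E L).algebraMap_mem e')
  rw [← separableClosure.eq_top_iff, eq_top_iff]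
  intro x _
  obtain ⟨n, y, hy⟩ := (isPurelyInseparable_iff_pow_mem (separableClosure E L) p).1
    (inferInstance : IsPurelyInseparable (separableClosure E L) L) x
  have hroot : ∀ n : ℕ, x ^ p ^ n ∈ separableClosure E L → x ∈ separableClosure E L := by
    intro n
    induction n with
    | zero => simp
    | succ n ih =>
      intro h
      have h2 := hM _ h
      rw [pow_succ, pow_mul, ← mul_one ((x ^ p ^ n) ^ p), hφ, h1, mul_one] at h2
      exact ih h2
  exact hroot n (hy ▸ y.2)

theorem pow_mem_of_forall_root {K : Type*} [Field K] {p : ℕ} {T : Subring K}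
    (hT : ∀ z : K, z ^ p ∈ T → z ∈ T) (e : ℕ) {z : K} (hz : z ^ p ^ e ∈ T) : z ∈ T := by
  induction e with
  | zero => simpa using hz
  | succ e ih => exact ih (hT _ (by rwa [← pow_mul, ← pow_succ]))

theorem exists_pow_mem_of_pIndependent {R : Type*} [CommRing R] [IsDomain R] [IsNoetherianRing R]
    {I : ℕ → Ideal R} {p : ℕ} (hp : p.Prime) {b d : R} (hd : d ≠ 0) (hdI : ∀ e, d ∈ I e)
    (hI : ∀ e, ∀ r ∈ I (e + 1), ∃ (t : Finset R) (c : R → R),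
      b ^ p * r = ∑ y ∈ t, c y ^ p * y ∧ ∀ y ∈ t, c y ∈ I e) :
    ∃ n, b ^ n ∈ I 0 := by
  have hpow : ∀ e, ∃ n, ∀ r ∈ I e, b ^ n * r ∈ I 0 ^ p ^ e := by
    intro e
    induction e with
    | zero => exact ⟨0, by simp⟩
    | succ e ih =>
      obtain ⟨n, hn⟩ := ih
      refine ⟨p * n + p, fun r hr => ?_⟩
      obtain ⟨t, c, hc, hcI⟩ := hI e r hr
      have : b ^ (p * n + p) * r = ∑ y ∈ t, (b ^ n * c y) ^ p * y := by
        rw [pow_add, mul_assoc, hc, Finset.mul_sum]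
        exact Finset.sum_congr rfl fun y _ => by ring
      rw [this, pow_succ, pow_mul]
      exact sum_mem fun y hy => Ideal.mul_mem_right _ _ (Ideal.pow_mem_pow (hn _ (hcI y hy)) p)
  by_contra hcon
  have hrad : b ∉ (I 0).radical := hcon
  rw [Ideal.radical_eq_sInf, Submodule.mem_sInf] at hrad
  push Not at hrad
  obtain ⟨(P : Ideal R), ⟨hIP, hP⟩, hbP⟩ := hrad
  have hmem : ∀ n, algebraMap R (Localization.AtPrime P) d ∈
      IsLocalRing.maximalIdeal (Localization.AtPrime P) ^ n := by
    intro n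
    obtain ⟨m, hm⟩ := hpow n
    have h1 : b ^ m * d ∈ P ^ n :=
      Ideal.pow_le_pow_right (Nat.lt_pow_self hp.one_lt).le (Ideal.pow_right_mono hIP _ (hm d (hdI n)))
    have h2 := Ideal.mem_map_of_mem (algebraMap R (Localization.AtPrime P)) h1
    rw [Ideal.map_pow, Localization.AtPrime.map_eq_maximalIdeal, map_mul, map_pow] at h2
    refine (Ideal.unit_mul_mem_iff_mem _ (IsUnit.pow m ?_)).1 h2
    exact IsLocalization.map_units (Localization.AtPrime P) (⟨b, hbP⟩ : P.primeCompl)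
  have h0 : algebraMap R (Localization.AtPrime P) d = 0 := by
    have : IsNoetherianRing (Localization.AtPrime P) :=
      IsLocalization.isNoetherianRing P.primeCompl _ inferInstance
    rw [← Ideal.mem_bot, ← Ideal.iInf_pow_eq_bot_of_isLocalRing
      (IsLocalRing.maximalIdeal (Localization.AtPrime P)) (Ideal.IsPrime.ne_top inferInstance)]
    exact Ideal.mem_iInf.2 hmem
  exact hd (IsLocalization.injective (Localization.AtPrime P)
    P.primeCompl_le_nonZeroDivisors (by rw [h0, map_zero]))

theorem exists_ne_zero_forall_isIntegral_mul_mem_range {R K : Type*} [CommRing R] [IsDomain R]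
    [IsNoetherianRing R] [Field K] [Algebra R K] [IsFractionRing R K] {p : ℕ} (hp : p.Prime)
    [CharP R p] (s : Finset R) (hs : ∀ x : R, ∃ c : R → R, x = ∑ y ∈ s, c y ^ p * y)
    (hK : ∀ z : K, z ^ p ∈ (algebraMap R K).range → z ∈ (algebraMap R K).range) :
    ∃ b : R, b ≠ 0 ∧ ∀ x : K, IsIntegral R x → algebraMap R K b * x ∈ (algebraMap R K).range := by
  have := Fact.mk hp
  have hinj := IsFractionRing.injective R K
  obtain ⟨t, b, hb, hind, hspan⟩ := exists_pIndependent_finset hp s hs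
  refine ⟨b, hb, fun x hx => ?_⟩
  let I : ℕ → Ideal R := fun e =>
    { carrier := {r | ∀ n : ℕ, algebraMap R K r * x ^ (n * p ^ e) ∈ (algebraMap R K).range}
      add_mem' := fun h h' n => by rw [map_add, add_mul]; exact add_mem (h n) (h' n)
      zero_mem' := fun n => by rw [map_zero, zero_mul]; exact zero_mem _
      smul_mem' := fun c r h n => by
        rw [smul_eq_mul, map_mul, mul_assoc]; exact mul_mem ⟨c, rfl⟩ (h n) }
  obtain ⟨d, hd, hdx⟩ := hx.isAlmostIntegral
  obtain ⟨a, v, hv, hav⟩ := IsFractionRing.div_surjective R x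
  have hv0 : algebraMap R K v ≠ 0 := fun h =>
    nonZeroDivisors.ne_zero hv (hinj (by rw [h, map_zero]))
  have hI : ∀ e, ∀ r ∈ I (e + 1), ∃ (t : Finset R) (c : R → R),
      b ^ p * r = ∑ y ∈ t, c y ^ p * y ∧ ∀ y ∈ t, c y ∈ I e := by
    intro e r hr
    obtain ⟨c, hc⟩ := hspan r
    refine ⟨t, c, hc, fun y hy n => ?_⟩
    obtain ⟨r', hr'⟩ := hr n
    obtain ⟨c', hc'⟩ := hspan r'
    set N := n * p ^ e with hN
    have e1 : v ^ (N * p) * r' = a ^ (N * p) * r := by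
      apply hinj
      rw [map_mul, map_mul, hr', show n * p ^ (e + 1) = N * p by rw [hN]; ring, ← hav, div_pow,
        map_pow, map_pow]
      field_simp
    have e2 : ∑ y ∈ t, (v ^ N * c' y - a ^ N * c y) ^ p * y = 0 := by
      have h1 : ∑ y ∈ t, (v ^ N * c' y) ^ p * y = v ^ (N * p) * (b ^ p * r') := by
        rw [hc', Finset.mul_sum]
        exact Finset.sum_congr rfl fun y _ => by ring
      have h2 : ∑ y ∈ t, (a ^ N * c y) ^ p * y = a ^ (N * p) * (b ^ p * r) := by
        rw [hc, Finset.mul_sum]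
        exact Finset.sum_congr rfl fun y _ => by ring
      simp only [sub_pow_char, sub_mul, Finset.sum_sub_distrib]
      rw [h1, h2]
      linear_combination b ^ p * e1
    have e3 := congrArg (algebraMap R K) (sub_eq_zero.1 (hind _ e2 y hy))
    refine ⟨c' y, ?_⟩
    rw [← hav, div_pow]
    simp only [map_mul, map_pow] at e3
    field_simp
    linear_combination e3
  obtain ⟨n, hn⟩ := exists_pow_mem_of_pIndependent (I := I) hp (nonZeroDivisors.ne_zero hd)
    (fun e m => by rw [← Algebra.smul_def]; exact hdx _) hI
  refine pow_mem_of_forall_root hK n ?_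
  have h := hn (p ^ n)
  rw [pow_zero, mul_one] at h
  rw [mul_pow, ← map_pow, ← Nat.sub_add_cancel (Nat.lt_pow_self hp.one_lt (n := n)).le, pow_add,
    map_mul, mul_assoc, Nat.sub_add_cancel (Nat.lt_pow_self hp.one_lt (n := n)).le]
  exact mul_mem ⟨_, rfl⟩ h

theorem exists_conductor {R K : Type*} [CommRing R] [IsDomain R] [IsNoetherianRing R] [Field K]
    [Algebra R K] [IsFractionRing R K] {p : ℕ} (hp : p.Prime) (ψ : K →+ K)
    (hψ : ∀ z w : K, ψ (z ^ p * w) = z * ψ w)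
    (hR : ∀ z ∈ (algebraMap R K).range, ψ z ∈ (algebraMap R K).range)
    (hK : ∀ z : K, z ^ p ∈ (algebraMap R K).range → z ∈ (algebraMap R K).range)
    {b : R} (hb : b ≠ 0)
    (hbK : ∀ x : K, IsIntegral R x → algebraMap R K b * x ∈ (algebraMap R K).range) :
    ∃ (φ : integralClosure R K →+ integralClosure R K) (I : Ideal (integralClosure R K)),
      (∀ s, (φ s : K) = ψ s) ∧ I ≠ ⊥ ∧
      (∀ c ∈ I, ∃ r : R, algebraMap R (integralClosure R K) r = c) ∧
      (∀ (c : integralClosure R K) (n : ℕ), c ^ n ∈ I → c ∈ I) ∧ (∀ c ∈ I, φ c ∈ I) := by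
  have hinj := IsFractionRing.injective R K
  let C : Submodule R K :=
    { carrier := {c | ∀ x : K, IsIntegral R x → c * x ∈ (algebraMap R K).range}
      add_mem' := fun h h' x hx => by rw [add_mul]; exact add_mem (h x hx) (h' x hx)
      zero_mem' := fun x _ => by rw [zero_mul]; exact zero_mem _
      smul_mem' := fun r c h x hx => by
        rw [Algebra.smul_def, mul_assoc]; exact mul_mem ⟨r, rfl⟩ (h x hx) }
  have hCR : ∀ c ∈ C, c ∈ (algebraMap R K).range := fun c hc => by
    simpa using hc 1 isIntegral_one
  have hCmul : ∀ c ∈ C, ∀ x, IsIntegral R x → c * x ∈ C := fun c hc x hx y hy => by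
    rw [mul_assoc]; exact hc _ (hx.mul hy)
  have hbC : algebraMap R K b ∈ C := hbK
  have hC0 : C ≠ ⊥ := fun h => hb (hinj (by
    rw [h, Submodule.mem_bot] at hbC
    rw [hbC, map_zero]))
  have hCfg : C.FG := by
    have hle : C ≤ LinearMap.range (Algebra.linearMap R K) := fun c hc => hCR c hc
    rw [← Submodule.map_comap_eq_of_le hle]
    exact (IsNoetherian.noetherian _).map _
  have hψC : ∀ c ∈ C, ψ c ∈ C := fun c hc x hx => by
    rw [mul_comm, ← hψ, mul_comm]
    exact hR _ (hc _ (hx.pow p))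
  have hψint : ∀ x, IsIntegral R x → IsIntegral R (ψ x) := fun x hx =>
    isIntegral_of_smul_mem_submodule C hC0 hCfg _ fun c hc => by
      rw [smul_eq_mul, mul_comm, ← hψ]
      refine hψC _ (hCmul _ ?_ _ hx)
      obtain ⟨q, hq⟩ := Nat.exists_eq_succ_of_ne_zero hp.ne_zero
      rw [hq, pow_succ']
      obtain ⟨r, hr⟩ := hCR c hc
      exact hCmul c hc _ ((hr ▸ isIntegral_algebraMap).pow q)
  have hCroot : ∀ x, IsIntegral R x → ∀ n : ℕ, x ^ n ∈ C → x ∈ C := by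
    intro x hx n hn y hy
    refine pow_mem_of_forall_root hK n ?_
    have hle : n ≤ p ^ n := (Nat.lt_pow_self hp.one_lt).le
    obtain ⟨k, hk⟩ := Nat.exists_eq_add_of_le hle
    rw [mul_pow, hk, pow_add, mul_assoc]
    exact hn _ ((hx.pow _).mul (hy.pow _))
  refine ⟨AddMonoidHom.mk' (fun s => ⟨ψ s, hψint _ s.2⟩) fun s t => Subtype.ext (map_add ψ _ _),
    { carrier := {s | (s : K) ∈ C}
      add_mem' := fun h h' => C.add_mem h h'
      zero_mem' := C.zero_mem
      smul_mem' := fun s c hc => by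
        change (s : K) * c ∈ C
        rw [mul_comm]
        exact hCmul _ hc _ s.2 }, fun s => rfl, fun h => ?_, fun c hc => ?_, fun c n hn => ?_,
    fun c hc => hψC _ hc⟩
  · have h1 : algebraMap R (integralClosure R K) b ∈ (⊥ : Ideal (integralClosure R K)) := h ▸ hbC
    exact hb (hinj (by
      rw [map_zero]
      exact congrArg Subtype.val ((Submodule.mem_bot _).1 h1)))
  · obtain ⟨r, hr⟩ := hCR _ hc
    exact ⟨r, Subtype.ext hr⟩
  · exact hCroot _ c.2 n hn

section HeightOne

variable {S : Type*} [CommRing S]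

theorem exists_notMem_mul_mem_of_root_closed {I q : Ideal S} [q.IsPrime]
    (hI : I ≠ ⊥) (hrad : ∀ (c : S) (n : ℕ), c ^ n ∈ I → c ∈ I)
    (hmin : ∀ q' : Ideal S, q'.IsPrime → q' < q → q' = ⊥) {y : S} (hy : y ∈ q) :
    ∃ s ∉ q, s * y ∈ I := by
  by_contra! hcon
  have hdisj : Disjoint (I : Set S) (q.primeCompl ⊔ Submonoid.powers y : Submonoid S) := by
    rw [Set.disjoint_left]
    intro z hz hz'
    obtain ⟨s, hs, _, ⟨n, rfl⟩, rfl⟩ := Submonoid.mem_sup.1 hz'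
    refine hcon s hs (hrad _ (n + 1) ?_)
    rw [show (s * y) ^ (n + 1) = s ^ n * y * (s * y ^ n) by ring]
    exact I.mul_mem_left _ hz
  obtain ⟨q', hq', hIq', hd⟩ := Ideal.exists_le_prime_disjoint _ _ hdisj
  rw [Set.disjoint_left] at hd
  have hle : q' ≤ q := fun z hz => by
    by_contra hzq
    exact hd hz (Submonoid.mem_sup_left (show z ∈ q.primeCompl from hzq))
  have hne : q' ≠ q := fun h => hd (h ▸ hy : y ∈ q')
    (Submonoid.mem_sup_right (Submonoid.mem_powers y))
  exact hI (le_bot_iff.1 (hmin q' hq' (lt_of_le_of_ne hle hne) ▸ hIq'))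

variable {R : Type*} [CommRing R] [Algebra R S]

theorem exists_notMem_mul_mem_map_comap {I q : Ideal S} [q.IsPrime]
    (hI : I ≠ ⊥) (hIR : ∀ c ∈ I, ∃ r : R, algebraMap R S r = c)
    (hrad : ∀ (c : S) (n : ℕ), c ^ n ∈ I → c ∈ I)
    (hmin : ∀ q' : Ideal S, q'.IsPrime → q' < q → q' = ⊥) {y : S} (hy : y ∈ q) :
    ∃ s ∉ q, s * y ∈ (q.comap (algebraMap R S)).map (algebraMap R S) := by
  obtain ⟨s, hs, hsy⟩ := exists_notMem_mul_mem_of_root_closed hI hrad hmin hy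
  obtain ⟨r, hr⟩ := hIR _ hsy
  refine ⟨s, hs, ?_⟩
  rw [← hr]
  exact Ideal.mem_map_of_mem _ (Ideal.mem_comap.2 (hr ▸ q.mul_mem_left s hy))

theorem map_eq_map_of_exists_notMem {q : Ideal S} [q.IsPrime] {J : Ideal S} (hJ : J ≤ q)
    (h : ∀ y ∈ q, ∃ s ∉ q, s * y ∈ J) :
    J.map (algebraMap S (Localization.AtPrime q)) =
      q.map (algebraMap S (Localization.AtPrime q)) := by
  refine le_antisymm (Ideal.map_mono hJ) (Ideal.map_le_iff_le_comap.2 fun y hy => ?_)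
  obtain ⟨s, hs, hsy⟩ := h y hy
  have h1 := Ideal.mem_map_of_mem (algebraMap S (Localization.AtPrime q)) hsy
  rw [map_mul] at h1
  exact (Ideal.unit_mul_mem_iff_mem _
    (IsLocalization.map_units (Localization.AtPrime q) (⟨s, hs⟩ : q.primeCompl))).1 h1

theorem Ideal.ResidueField.exists_eq_div (q : Ideal S) [q.IsPrime] (z : q.ResidueField) :
    ∃ s t : S, algebraMap S q.ResidueField t ≠ 0 ∧
      z = algebraMap S q.ResidueField s / algebraMap S q.ResidueField t := by
  obtain ⟨a, b, hb, rfl⟩ := IsFractionRing.div_surjective (S ⧸ q) z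
  obtain ⟨s, rfl⟩ := Ideal.Quotient.mk_surjective a
  obtain ⟨t, rfl⟩ := Ideal.Quotient.mk_surjective b
  refine ⟨s, t, fun h => ?_, by simp only [Ideal.algebraMap_quotient_residueField_mk]⟩
  rw [Ideal.algebraMap_residueField_eq_zero, ← Ideal.Quotient.eq_zero_iff_mem] at h
  exact nonZeroDivisors.ne_zero hb h

theorem isSeparable_residueField_of_conductor [Algebra.IsIntegral R S] {p : ℕ}
    (hp : p.Prime) [CharP S p] (φ : S →+ S) (hφ : ∀ s t : S, φ (s ^ p * t) = s * φ t)
    (hφ1 : φ 1 = 1)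
    (hφR : ∀ r : R, ∃ r' : R, φ (algebraMap R S r) = algebraMap R S r')
    {I q : Ideal S} [q.IsPrime]
    (hI : I ≠ ⊥) (hIR : ∀ c ∈ I, ∃ r : R, algebraMap R S r = c)
    (hrad : ∀ (c : S) (n : ℕ), c ^ n ∈ I → c ∈ I) (hφI : ∀ c ∈ I, φ c ∈ I)
    (hmin : ∀ q' : Ideal S, q'.IsPrime → q' < q → q' = ⊥)
    {E : Type*} [Field E] [Algebra R E] [Algebra E q.ResidueField]
    (hRE : ∀ e : E, ∃ r t : R, algebraMap R E t ≠ 0 ∧ e = algebraMap R E r / algebraMap R E t)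
    (hcomp : ∀ r : R, algebraMap E q.ResidueField (algebraMap R E r) =
      algebraMap S q.ResidueField (algebraMap R S r)) :
    Algebra.IsSeparable E q.ResidueField := by
  have hpL : (p : q.ResidueField) = 0 := by
    rw [← map_natCast (algebraMap S q.ResidueField), CharP.cast_eq_zero, map_zero]
  have : CharP E p := (CharP.charP_iff_prime_eq_zero hp).2
    ((algebraMap E q.ResidueField).injective (by rw [map_natCast, hpL, map_zero]))
  have hfrac := Ideal.ResidueField.exists_eq_div q
  by_cases hIq : I ≤ q
  · have halg : Algebra.IsAlgebraic E q.ResidueField := by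
      have hS : ∀ s : S, IsIntegral E (algebraMap S q.ResidueField s) := by
        intro s
        obtain ⟨P, hP, hPs⟩ := Algebra.IsIntegral.isIntegral (R := R) s
        refine ⟨P.map (algebraMap R E), hP.map _, ?_⟩
        rw [Polynomial.eval₂_map, show (algebraMap E q.ResidueField).comp (algebraMap R E) =
          (algebraMap S q.ResidueField).comp (algebraMap R S) from RingHom.ext hcomp,
          ← Polynomial.hom_eval₂, hPs, map_zero]
      refine ⟨fun z => ?_⟩
      obtain ⟨s, t, -, rfl⟩ := hfrac z
      rw [div_eq_mul_inv]
      exact (hS s).isAlgebraic.mul (hS t).isAlgebraic.inv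
    have hφq : ∀ y ∈ q, φ y ∈ q := by
      intro y hy
      obtain ⟨s, hs, hsy⟩ := exists_notMem_mul_mem_of_root_closed hI hrad hmin hy
      obtain ⟨k, hk⟩ := Nat.exists_eq_succ_of_ne_zero hp.ne_zero
      have h1 : s ^ p * y ∈ I := by
        rw [hk, pow_succ, mul_assoc]
        exact I.mul_mem_left _ hsy
      have h2 := hIq (hφI _ h1)
      rw [hφ] at h2
      exact (Ideal.IsPrime.mem_or_mem inferInstance h2).resolve_left hs
    let φq : S ⧸ q →+ S ⧸ q := QuotientAddGroup.map q.toAddSubgroup q.toAddSubgroup φ hφq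
    have hφq_mk : ∀ s, φq (Ideal.Quotient.mk q s) = Ideal.Quotient.mk q (φ s) := fun s => rfl
    obtain ⟨ψ, hψ, hψq⟩ := exists_frobeniusInverseLinear_extension (K := q.ResidueField) hp.pos φq (by
      intro a c
      obtain ⟨s, rfl⟩ := Ideal.Quotient.mk_surjective a
      obtain ⟨t, rfl⟩ := Ideal.Quotient.mk_surjective c
      rw [← map_pow, ← map_mul, hφq_mk, hφq_mk, hφ, map_mul])
    have hψS : ∀ s, ψ (algebraMap S q.ResidueField s) = algebraMap S q.ResidueField (φ s) := fun s => by
      simpa only [hφq_mk, Ideal.algebraMap_quotient_residueField_mk] using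
        hψq (Ideal.Quotient.mk q s)
    refine isSeparable_of_frobeniusInverseLinear hp ψ hψ ?_ fun e => ?_
    · rw [← map_one (algebraMap S q.ResidueField), hψS, hφ1]
    · obtain ⟨r, t, ht, rfl⟩ := hRE e
      obtain ⟨r', hr'⟩ := hφR (r * t ^ (p - 1))
      refine ⟨algebraMap R E r' / algebraMap R E t, ?_⟩
      obtain ⟨k, rfl⟩ := Nat.exists_eq_succ_of_ne_zero hp.ne_zero
      have ht' : algebraMap S q.ResidueField (algebraMap R S t) ≠ 0 := by
        rw [← hcomp]
        exact (map_ne_zero _).2 ht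
      rw [map_div₀ (algebraMap E _), map_div₀ (algebraMap E _), hcomp, hcomp, hcomp, ← hr', ← hψS,
        div_eq_inv_mul (ψ _), ← hψ]
      congr 1
      simp only [Nat.succ_eq_add_one, Nat.add_sub_cancel, map_mul, map_pow, inv_pow]
      field_simp
      ring
  · obtain ⟨c, hc, hcq⟩ := SetLike.not_le_iff_exists.1 hIq
    have hc0 : algebraMap S q.ResidueField c ≠ 0 := by
      rwa [Ne, Ideal.algebraMap_residueField_eq_zero]
    have hS : ∀ s, ∃ e : E, algebraMap E q.ResidueField e = algebraMap S q.ResidueField s := by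
      intro s
      obtain ⟨r, hr⟩ := hIR c hc
      obtain ⟨r', hr'⟩ := hIR _ (I.mul_mem_right s hc)
      refine ⟨algebraMap R E r' / algebraMap R E r, ?_⟩
      rw [map_div₀, hcomp, hcomp, hr, hr', map_mul]
      field_simp
    refine ⟨fun z => ?_⟩
    obtain ⟨s, t, -, rfl⟩ := hfrac z
    obtain ⟨e, he⟩ := hS s
    obtain ⟨e', he'⟩ := hS t
    rw [← he, ← he', ← map_div₀]
    exact isSeparable_algebraMap _

end HeightOne

/-- An `F`-finite Noetherian `F`-pure domain `R` of prime characteristic `p` satisfies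
(WN1): it is weakly normal, and the normalization `R → S` (where `S` is the integral
closure of `R` in `Frac R`) is unramified in codimension one, i.e. for every height-one
prime `𝔮` of `S` lying over `𝔭 = 𝔮 ∩ R` one has `𝔭 S_𝔮 = 𝔮 S_𝔮` and the residue field
extension `κ(𝔭) → κ(𝔮)` is separable. -/
theorem wn1_of_fPure (R : Type*) [CommRing R] [IsDomain R] [IsNoetherianRing R]
    (p : ℕ) (hp : p.Prime) [CharP R p] (hFF : IsFFinite p R) (hFP : IsFPure p R) :
    (∀ z : FractionRing R, (∃ r : R, algebraMap R (FractionRing R) r = z ^ p) →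
      ∃ r : R, algebraMap R (FractionRing R) r = z) ∧
    (∀ (𝔮 : Ideal (integralClosure R (FractionRing R))) [𝔮.IsPrime],
      -- `𝔮` has height one:
      𝔮 ≠ ⊥ →
      (∀ (𝔮' : Ideal (integralClosure R (FractionRing R))), 𝔮'.IsPrime → 𝔮' < 𝔮 → 𝔮' = ⊥) →
      -- `𝔭 S_𝔮 = 𝔮 S_𝔮` where `𝔭 = 𝔮 ∩ R`:
      (Ideal.map (algebraMap (integralClosure R (FractionRing R))
          (Localization.AtPrime 𝔮))
        (Ideal.map (algebraMap R (integralClosure R (FractionRing R)))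
          (𝔮.comap (algebraMap R (integralClosure R (FractionRing R))))) =
        Ideal.map (algebraMap (integralClosure R (FractionRing R))
          (Localization.AtPrime 𝔮)) 𝔮) ∧
      -- the residue field extension `κ(𝔭) → κ(𝔮)` is separable:
      (letI f := Localization.localRingHom
          (𝔮.comap (algebraMap R (integralClosure R (FractionRing R)))) 𝔮
          (algebraMap R (integralClosure R (FractionRing R))) rfl
       letI : IsLocalHom f := Localization.isLocalHom_localRingHom _ _ _ rfl
       letI g := IsLocalRing.ResidueField.map f
       @Algebra.IsSeparable
          (IsLocalRing.ResidueField (Localization.AtPrime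
            (𝔮.comap (algebraMap R (integralClosure R (FractionRing R))))))
          (IsLocalRing.ResidueField (Localization.AtPrime 𝔮))
          _ _ g.toAlgebra)) := by
  obtain ⟨φ, hφ, hφ1⟩ := hFP
  obtain ⟨s, hs⟩ := hFF
  obtain ⟨ψ, hψ, hψR⟩ :=
    exists_frobeniusInverseLinear_extension (K := FractionRing R) hp.pos φ hφ
  have hψ1 : ψ 1 = 1 := by rw [← map_one (algebraMap R (FractionRing R)), hψR, hφ1]
  have hWN : ∀ z : FractionRing R, z ^ p ∈ (algebraMap R (FractionRing R)).range →
      z ∈ (algebraMap R (FractionRing R)).range := by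
    rintro z ⟨r, hr⟩
    refine ⟨φ r, ?_⟩
    rw [← hψR, hr, ← mul_one (z ^ p), hψ, hψ1, mul_one]
  refine ⟨hWN, ?_⟩
  obtain ⟨b, hb, hbK⟩ := exists_ne_zero_forall_isIntegral_mul_mem_range hp s hs hWN
  obtain ⟨φS, I, hφS, hI, hIR, hrad, hφI⟩ := exists_conductor hp ψ hψ (by
    rintro _ ⟨r, rfl⟩
    exact ⟨φ r, (hψR r).symm⟩) hWN hb hbK
  intro 𝔮 _ _ hmin
  refine ⟨map_eq_map_of_exists_notMem Ideal.map_comap_le fun y hy =>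
    exists_notMem_mul_mem_map_comap hI hIR hrad hmin hy, ?_⟩
  have : CharP (integralClosure R (FractionRing R)) p :=
    charP_of_injective_algebraMap
      (FaithfulSMul.algebraMap_injective R (integralClosure R (FractionRing R))) p
  let := (Ideal.ResidueField.map _ 𝔮 (algebraMap R _) rfl).toAlgebra
  refine isSeparable_residueField_of_conductor (R := R) (q := 𝔮)
    (E := (𝔮.comap (algebraMap R (integralClosure R (FractionRing R)))).ResidueField) hp φS
    (fun s t => Subtype.ext ?_) (Subtype.ext ?_) (fun r => ⟨φ r, Subtype.ext ?_⟩) hI hIR hrad hφI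
    hmin (Ideal.ResidueField.exists_eq_div _) (fun r => ?_)
  · simp [hφS, hψ]
  · simp [hφS, hψ1]
  · rw [hφS]
    exact hψR r
  · exact Ideal.ResidueField.map_algebraMap _ 𝔮 (algebraMap R _) rfl r
end

section
/- Let k be an algebraically closed field of prime characteristic p, let I be a radical ideal of the polynomial ring k[x_1, …, x_n], and set A = k[x_1, …, x_n]/I. Suppose A is F-pure. Then a general hyperplane section of Spec A is F-pure: there exists a nonzero polynomial g ∈ k[T_0, T_1, …, T_n] such that for every (c_0, c_1, …, c_n) ∈ k^{n+1} with g(c_0, …, c_n) ≠ 0, the ring A/(c_0 + c_1 x_1 + ⋯ + c_n x_n) is F-pure. -/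
open scoped TensorProduct

theorem Derivation.eq_zero_of_adjoin_eq_top {k K M ι : Type*} [Field k] [Field K] [Algebra k K]
    [AddCommGroup M] [Module k M] [Module K M] {x : ι → K}
    (hx : IntermediateField.adjoin k (Set.range x) = ⊤) (D : Derivation k K M)
    (hD : ∀ i, D (x i) = 0) : D = 0 := by
  ext z
  have hz : z ∈ IntermediateField.adjoin k (Set.range x) := hx ▸ IntermediateField.mem_top
  induction hz using IntermediateField.adjoin_induction with
  | mem z hz => obtain ⟨i, rfl⟩ := hz; exact hD i
  | algebraMap c => simp
  | add a b _ _ ha hb => simpa using by rw [ha, hb]; simp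
  | inv a _ ha => rw [D.leibniz_inv, ha]; simp
  | mul a b _ _ ha hb => rw [D.leibniz, ha, hb]; simp

theorem exists_dual_derivations {k K ι : Type*} [Field k] [Field K] [Algebra k K] [Finite ι]
    {x : ι → K} (hx : IntermediateField.adjoin k (Set.range x) = ⊤) :
    ∃ (S : Set ι) (D : S → Derivation k K K),
      (∀ i : S, D i (x i) = 1) ∧ (∀ i j : S, i ≠ j → D i (x j) = 0) ∧
      Algebra.IsAlgebraic (IntermediateField.adjoin k (x '' S)) K := by
  classical
  let d := KaehlerDifferential.D k K
  obtain ⟨S, -, -, hspan, hS⟩ := exists_linearIndepOn_extension (K := K) (v := fun i ↦ d (x i))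
    (linearIndepOn_empty K _) (Set.subset_univ ∅)
  rw [LinearIndepOn] at hS
  have hdual (i : S) : ∃ f : Ω[K⁄k] →ₗ[K] K, ∀ j : S, f (d (x j)) = if i = j then 1 else 0 := by
    obtain ⟨f, hf⟩ := ((Module.Basis.span hS).coord i).exists_extend
    refine ⟨f, fun j ↦ ?_⟩
    have h := LinearMap.congr_fun hf (Module.Basis.span hS j)
    simpa [Module.Basis.span_apply, Finsupp.single_apply, eq_comm] using h
  choose f hf using hdual
  refine ⟨S, fun i ↦ (f i).compDer d, fun i ↦ by simp [hf], fun i j h ↦ by simp [hf, h], ?_⟩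
  have : Algebra.EssFiniteType k K := by
    have := IntermediateField.essFiniteType_iff.mpr
      (show (IntermediateField.adjoin k (Set.range x)).FG from
        IntermediateField.fg_adjoin_of_finite (Set.finite_range x))
    rw [hx] at this
    exact (Algebra.EssFiniteType.iff_of_algEquiv IntermediateField.topEquiv).mp this
  let E := IntermediateField.adjoin k (x '' S)
  have : Algebra.EssFiniteType E K := .of_comp k E K
  have : Algebra.FormallyUnramified E K := by
    refine ⟨?_⟩
    let δ : Derivation k K Ω[K⁄E] := (KaehlerDifferential.D E K).restrictScalars k
    have hδS (i : ι) (hi : i ∈ S) : δ (x i) = 0 :=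
      (KaehlerDifferential.D E K).map_algebraMap
        (⟨x i, IntermediateField.subset_adjoin _ _ ⟨i, hi, rfl⟩⟩ : E)
    have hδ : δ = 0 := by
      refine δ.eq_zero_of_adjoin_eq_top hx fun i ↦ ?_
      have hle : Submodule.span K ((fun i ↦ d (x i)) '' S) ≤
          LinearMap.ker δ.liftKaehlerDifferential := by
        rw [Submodule.span_le]
        rintro _ ⟨i, hi, rfl⟩
        simpa [d] using hδS i hi
      simpa [d] using hle (hspan ⟨i, Set.mem_univ i, rfl⟩)
    rw [← Submodule.subsingleton_iff K, ← subsingleton_iff_bot_eq_top,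
      ← KaehlerDifferential.span_range_derivation, eq_comm, Submodule.span_eq_bot]
    rintro _ ⟨z, rfl⟩
    exact Derivation.congr_fun hδ z
  have := Algebra.FormallyUnramified.isSeparable E K
  infer_instance

section
variable {K M L : Type*} [Field K] [Field M] [Field L] [Algebra K M] [Algebra K L] [Algebra M L]
  [IsScalarTower K M L] {p : ℕ} [Fact p.Prime] [CharP L p]

variable (K M L) in
/-- The multiplication map `L ⊗[K] M → L` of a tower `L / M / K`. -/
noncomputable def mulTower : L ⊗[K] M →ₐ[L] L :=
  Algebra.TensorProduct.lift (AlgHom.id L L) (IsScalarTower.toAlgHom K M L) fun _ _ ↦ .all _ _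

@[simp]
theorem mulTower_tmul (a : L) (m : M) : mulTower K M L (a ⊗ₜ m) = a * algebraMap M L m := by
  simp [mulTower]

theorem pow_char_eq_algebraMap_mulTower {e : M ≃+* K} (he : ∀ m, algebraMap K M (e m) = m ^ p)
    (z : L ⊗[K] M) : z ^ p = algebraMap L (L ⊗[K] M)
      (mulTower K M L z ^ p) := by
  have : CharP (L ⊗[K] M) p := charP_of_injective_algebraMap (algebraMap L _).injective p
  induction z with
  | zero => simp [(Fact.out : p.Prime).ne_zero]
  | tmul a m =>
    simp only [Algebra.TensorProduct.tmul_pow, mulTower_tmul, ← he, mul_pow,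
      ← map_pow, Algebra.TensorProduct.algebraMap_apply]
    simp [Algebra.algebraMap_eq_smul_one, TensorProduct.smul_tmul']
  | add a b ha hb => simp only [map_add, add_pow_char, ha, hb]

theorem mulTower_lTensor_derivation_eq_zero {e : M ≃+* K} (he : ∀ m, algebraMap K M (e m) = m ^ p)
    (D : Derivation K M M) {z : L ⊗[K] M} (hz : z ^ (p - 1) = 0) :
    mulTower K M L (D.toLinearMap.lTensor L z) = 0 := by
  have : CharP (L ⊗[K] M) p := charP_of_injective_algebraMap (algebraMap L _).injective p
  let δ : Derivation K (L ⊗[K] M) (L ⊗[K] M) := Derivation.mk' (D.toLinearMap.lTensor L) <| by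
    intro a b
    induction a with
    | zero => simp
    | add a a' ha ha' => simp only [map_add, add_mul, ha, ha', smul_eq_mul, mul_add]; ring
    | tmul a m =>
      induction b with
      | zero => simp
      | add a a' ha ha' => simp only [map_add, add_mul, ha, ha', smul_eq_mul, mul_add]; ring
      | tmul b n => simp [TensorProduct.tmul_add, mul_comm]
  change mulTower K M L (δ z) = 0
  by_contra h
  have hunit : IsUnit (δ z) := by
    refine (isUnit_pow_iff (Fact.out : p.Prime).ne_zero).mp ?_
    rw [pow_char_eq_algebraMap_mulTower he]
    exact (IsUnit.mk0 _ (pow_ne_zero _ h)).map _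
  have key (m : ℕ) (hm : m < p) (h0 : z ^ m = 0) : False := by
    induction m with
    | zero => simp at h0
    | succ m ih =>
      refine ih (by omega) ?_
      have h1 : δ (z ^ (m + 1)) = 0 := by rw [h0, map_zero]
      rw [δ.leibniz_pow, Nat.add_sub_cancel, smul_eq_mul, nsmul_eq_mul] at h1
      have h2 : IsUnit (((m + 1 : ℕ) : L ⊗[K] M)) := by
        rw [← map_natCast (algebraMap L (L ⊗[K] M))]
        refine (IsUnit.mk0 _ fun h ↦ ?_).map _
        exact Nat.not_dvd_of_pos_of_lt m.succ_pos hm ((CharP.cast_eq_zero_iff L p _).mp h)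
      rwa [h2.mul_right_eq_zero, hunit.mul_left_eq_zero] at h1
  exact key (p - 1) (Nat.sub_lt (Fact.out : p.Prime).pos one_pos) hz

end

/-- Transport of a derivation of `K` along an isomorphism `M ≃+* K` through which the inclusion
`K → M` becomes the Frobenius. -/
def Derivation.frobeniusRoot {k K M : Type*} [Field k] [Field K] [Field M] [Algebra k K]
    [Algebra K M] {p : ℕ} [CharP K p] {e : M ≃+* K} (he : ∀ m, algebraMap K M (e m) = m ^ p)
    (D : Derivation k K K) : Derivation K M M :=
  have hec (c : K) : e (algebraMap K M c) = c ^ p :=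
    (algebraMap K M).injective (by rw [he, map_pow])
  Derivation.mk'
    { toFun := fun m ↦ e.symm (D (e m))
      map_add' := by simp
      map_smul' := fun c m ↦ by
        apply e.injective
        simp [Algebra.smul_def, hec] }
    (fun a b ↦ by
      apply e.injective
      simp)

@[simp]
theorem Derivation.frobeniusRoot_apply {k K M : Type*} [Field k] [Field K] [Field M] [Algebra k K]
    [Algebra K M] {p : ℕ} [CharP K p] {e : M ≃+* K} (he : ∀ m, algebraMap K M (e m) = m ^ p)
    (D : Derivation k K K) (m : M) : D.frobeniusRoot he m = e.symm (D (e m)) := rfl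

theorem not_algebraicIndependent_of_mem_algebraicClosure {k L ι κ : Type*} [Field k] [Field L]
    [Algebra k L] [Fintype ι] [Fintype κ] {v : ι → L} {t : κ → L}
    (hcard : Fintype.card κ < Fintype.card ι)
    (hv : ∀ i, IsAlgebraic (Algebra.adjoin k (Set.range t)) (v i)) :
    ¬ AlgebraicIndependent k v := by
  intro h
  have h1 : (AlgebraicIndependent.matroid k L).Indep (Set.range v) :=
    AlgebraicIndependent.matroid_indep_iff.mpr h.coe_range
  have h2 := h1.encard_le_eRk_of_subset
    (X := (AlgebraicIndependent.matroid k L).closure (Set.range t)) <| by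
      rw [AlgebraicIndependent.matroid_closure_eq]
      rintro _ ⟨i, rfl⟩
      exact hv i
  rw [Matroid.eRk_closure_eq] at h2
  have h3 := h2.trans (Matroid.eRk_le_encard _ _)
  rw [← Set.image_univ, ← Set.image_univ, h.injective.encard_image] at h3
  have h4 := h3.trans (Set.encard_image_le _ _)
  simp only [Set.encard_univ, ENat.card_eq_coe_fintype_card, Nat.cast_le] at h4
  omega

theorem genericLinearForm_pow_ne_zero {k K M L : Type*} [Field k] [Field K] [Field M] [Field L]
    [Algebra k K] [Algebra k L] [Algebra K M] [Algebra K L] [Algebra M L] [IsScalarTower k K L]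
    [IsScalarTower K M L] {p : ℕ} [Fact p.Prime] [CharP L p] {e : M ≃+* K}
    (he : ∀ m, algebraMap K M (e m) = m ^ p) {n : ℕ} {x : Fin n → K}
    (hx : IntermediateField.adjoin k (Set.range x) = ⊤) {v : Fin (n + 1) → L}
    (hv : AlgebraicIndependent k v) :
    (v 0 ⊗ₜ[K] 1 + ∑ i : Fin n, v i.succ ⊗ₜ[K] e.symm (x i) : L ⊗[K] M) ^ (p - 1) ≠ 0 := by
  classical
  intro hz
  have : CharP K p := (algebraMap K L).charP (algebraMap K L).injective p
  obtain ⟨S, D, hD1, hD0, halg⟩ := exists_dual_derivations hx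
  have h0 : v 0 + ∑ i : Fin n, v i.succ * algebraMap M L (e.symm (x i)) = 0 := by
    have := congrArg (mulTower K M L) hz
    rw [map_pow, map_zero] at this
    simpa using eq_zero_of_pow_eq_zero this
  have hj (j : S) : ∑ i : Fin n, v i.succ * algebraMap M L (e.symm (D j (x i))) = 0 := by
    simpa using mulTower_lTensor_derivation_eq_zero he ((D j).frobeniusRoot he) hz
  let t : S ⊕ ↥Sᶜ → L := Sum.elim (fun i ↦ algebraMap K L (x i)) fun i ↦ v i.1.succ
  let N := Subalgebra.algebraicClosure (Algebra.adjoin k (Set.range t)) L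
  have ht (i) : t i ∈ N := by
    rw [Subalgebra.mem_algebraicClosure]
    exact isAlgebraic_algebraMap
      (⟨t i, Algebra.subset_adjoin ⟨i, rfl⟩⟩ : Algebra.adjoin k (Set.range t))
  have hKN (z : K) : algebraMap K L z ∈ N := by
    have hz := (IntermediateField.isAlgebraic_adjoin_iff_top.mp halg).isAlgebraic z
    let g := IsScalarTower.toAlgHom k K L
    have hle : (Algebra.adjoin k (x '' S)).map g ≤ Algebra.adjoin k (Set.range t) := by
      rw [AlgHom.map_adjoin]
      refine Algebra.adjoin_mono ?_
      rintro _ ⟨_, ⟨i, hi, rfl⟩, rfl⟩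
      exact ⟨.inl ⟨i, hi⟩, rfl⟩
    let f : Algebra.adjoin k (x '' S) →ₐ[k] Algebra.adjoin k (Set.range t) :=
      (g.comp (Subalgebra.val _)).codRestrict _ fun a ↦ hle ⟨a, a.2, rfl⟩
    rw [Subalgebra.mem_algebraicClosure]
    refine hz.ringHom_of_comp_eq f g (fun a b hab ↦ ?_) rfl
    exact Subtype.ext ((algebraMap K L).injective congr(($hab : L)))
  have hMN (m : M) : algebraMap M L m ∈ N := by
    rw [Subalgebra.mem_algebraicClosure]
    refine IsAlgebraic.of_pow (Fact.out : p.Prime).pos ?_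
    rw [← map_pow, ← he, ← IsScalarTower.algebraMap_apply, ← Subalgebra.mem_algebraicClosure]
    exact hKN _
  have hS' (i : Fin n) (hi : i ∉ S) : v i.succ ∈ N := ht (.inr ⟨i, hi⟩)
  have hS (j : Fin n) (hi : j ∈ S) : v j.succ ∈ N := by
    have h := hj ⟨j, hi⟩
    rw [← Finset.add_sum_erase _ _ (Finset.mem_univ j), hD1 ⟨j, hi⟩, map_one, map_one, mul_one,
      add_eq_zero_iff_eq_neg] at h
    rw [h]
    refine N.neg_mem (N.sum_mem fun i hij ↦ ?_)
    by_cases his : i ∈ S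
    · rw [hD0 ⟨j, hi⟩ ⟨i, his⟩ (by simpa [eq_comm] using hij)]
      simp
    · exact N.mul_mem (hS' i his) (hMN _)
  have hsucc (i : Fin n) : v i.succ ∈ N := by
    by_cases hi : i ∈ S
    exacts [hS i hi, hS' i hi]
  refine not_algebraicIndependent_of_mem_algebraicClosure (k := k) (v := v) (t := t) ?_ ?_ hv
  · rw [Fintype.card_congr (Equiv.Set.sumCompl S)]
    simp
  · intro i
    rw [← Subalgebra.mem_algebraicClosure]
    change v i ∈ N
    refine Fin.cases ?_ hsucc i
    rw [add_eq_zero_iff_eq_neg.mp h0]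
    exact N.neg_mem (N.sum_mem fun i _ ↦ N.mul_mem (hsucc i) (hMN _))

theorem exists_common_denominator {A K ι : Type*} [CommRing A] [Field K] {σ : A →+* K}
    (hσ : ∀ z, ∃ a s, σ s ≠ 0 ∧ z = σ a / σ s) (T : Finset ι) (c : ι → K) :
    ∃ (s : A) (a : ι → A), σ s ≠ 0 ∧ ∀ i ∈ T, c i * σ s = σ (a i) := by
  classical
  choose a s hs hc using fun i ↦ hσ (c i)
  refine ⟨∏ i ∈ T, s i, fun i ↦ a i * ∏ j ∈ T.erase i, s j, ?_, fun i hi ↦ ?_⟩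
  · simpa [Finset.prod_eq_zero_iff] using fun i _ ↦ hs i
  · rw [← Finset.mul_prod_erase _ _ hi, map_mul, map_mul, ← mul_assoc, hc i,
      div_mul_cancel₀ _ (hs i)]

/-- If `φ` is a Frobenius splitting of `A`, then relations over `L` among the functionals
`b ↦ φ (b * q i)` lift to relations among the `p`-th roots of the elements `q i`. -/
theorem sum_tmul_root_eq_zero {A K M L ι : Type*} [CommRing A] [Field K] [Field M] [Field L]
    [Algebra K M] [Algebra K L] {p : ℕ} [Fact p.Prime] [CharP K p] {e : M ≃+* K}
    (he : ∀ m, algebraMap K M (e m) = m ^ p) {φ : A →+ A}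
    (hφ : ∀ r a : A, φ (r ^ p * a) = r * φ a) (hφ1 : φ 1 = 1) {σ : A →+* K}
    (hσ : ∀ z, ∃ a s, σ s ≠ 0 ∧ z = σ a / σ s) {T : Finset ι} {w : ι → L} {q : ι → A}
    (h : ∀ b, ∑ i ∈ T, w i * algebraMap K L (σ (φ (b * q i))) = 0) :
    ∑ i ∈ T, w i ⊗ₜ[K] e.symm (σ (q i)) = 0 := by
  classical
  have hp : p ≠ 0 := (Fact.out : p.Prime).ne_zero
  let B := Module.Basis.ofVectorSpace K L
  apply (TensorProduct.equivFinsuppOfBasisLeft B).injective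
  ext j
  simp only [map_sum, map_zero, Finsupp.finsetSum_apply, Finsupp.coe_zero, Pi.zero_apply,
    TensorProduct.equivFinsuppOfBasisLeft_apply_tmul_apply]
  obtain ⟨s, a, hs, ha⟩ := exists_common_denominator hσ T fun i ↦ B.repr (w i) j
  have hB (b : A) : ∑ i ∈ T, B.repr (w i) j * σ (φ (b * q i)) = 0 := by
    have := congr(B.repr $(h b) j)
    simp only [mul_comm (w _), ← Algebra.smul_def, map_sum, Finsupp.finsetSum_apply, map_smul,
      Finsupp.smul_apply, smul_eq_mul, map_zero, Finsupp.coe_zero, Pi.zero_apply] at this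
    simpa only [mul_comm] using this
  let z := ∑ i ∈ T, a i ^ p * q i
  have hφz (b : A) : σ (φ (b * z)) = 0 := by
    rw [← mul_zero (σ s), ← hB b]
    simp only [z, Finset.mul_sum, map_sum]
    refine Finset.sum_congr rfl fun i hi ↦ ?_
    rw [mul_left_comm, hφ, map_mul, ← ha i hi]
    ring
  have hz : σ z = 0 := by
    have h := hφz (z ^ (p - 1))
    rwa [← pow_succ, Nat.sub_add_cancel (Nat.one_le_iff_ne_zero.mpr hp), ← mul_one (z ^ p), hφ,
      hφ1, mul_one] at h
  apply e.injective
  rw [map_zero, map_sum]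
  have : σ s ^ p * ∑ i ∈ T, e (B.repr (w i) j • e.symm (σ (q i))) = σ z := by
    have hec (c : K) : e (algebraMap K M c) = c ^ p :=
      (algebraMap K M).injective (by rw [he, map_pow])
    simp only [z, map_sum, Finset.mul_sum, map_mul, map_pow, Algebra.smul_def, hec]
    refine Finset.sum_congr rfl fun i hi ↦ ?_
    rw [← ha i hi, RingEquiv.apply_symm_apply]
    ring
  exact (mul_eq_zero.mp (this.trans hz)).resolve_left (pow_ne_zero _ hs)

open MvPolynomial in
/-- The power `(T₀ + x₁ T₁ + ⋯ + xₙ Tₙ) ^ N` of the generic linear form in the elements `xᵢ`. -/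
noncomputable def genericLinearFormPow {A : Type*} [CommRing A] {n : ℕ} (x : Fin n → A) (N : ℕ) :
    MvPolynomial (Fin (n + 1)) A :=
  (X 0 + ∑ i, C (x i) * X i.succ) ^ N

open MvPolynomial in
/-- Apply an additive map to the coefficients of a polynomial. -/
noncomputable def MvPolynomial.mapCoeff {A ι : Type*} [CommRing A] (φ : A →+ A)
    (q : MvPolynomial ι A) : MvPolynomial ι A :=
  ∑ m ∈ q.support, monomial m (φ (q.coeff m))

open MvPolynomial in
theorem exists_eval₂_mapCoeff_ne_zero {k A L : Type*} [Field k] [CommRing A] [Algebra k A]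
    [Field L] [Algebra k L] [IsAlgClosed L] {p : ℕ} [Fact p.Prime] [CharP L p] {φ : A →+ A}
    (hφ : ∀ r a : A, φ (r ^ p * a) = r * φ a) (hφ1 : φ 1 = 1) {n : ℕ} {x : Fin n → A}
    (hx : Algebra.adjoin k (Set.range x) = ⊤) (σ : A →ₐ[k] L) {v : Fin (n + 1) → L}
    (hv : AlgebraicIndependent k v) :
    ∃ b, (mapCoeff (φ.comp (AddMonoidHom.mulLeft b)) (genericLinearFormPow x (p - 1))).eval₂
      (σ : A →+* L) v ≠ 0 := by
  by_contra! h
  have hp : 0 < p := (Fact.out : p.Prime).pos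
  let K := IntermediateField.adjoin k (Set.range (σ ∘ x))
  have hadj : Algebra.adjoin k (Set.range (σ ∘ x)) = σ.range := by
    rw [Set.range_comp, ← AlgHom.map_adjoin, hx, Algebra.map_top]
  have hσK (a : A) : σ a ∈ K :=
    IntermediateField.algebra_adjoin_le_adjoin k _ (hadj ▸ ⟨a, rfl⟩ : σ a ∈ Algebra.adjoin k _)
  let σK : A →ₐ[k] K := σ.codRestrict K.toSubalgebra hσK
  have hσdiv (z : K) : ∃ a s, (σK : A →+* K) s ≠ 0 ∧ z = (σK : A →+* K) a / (σK : A →+* K) s := by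
    obtain ⟨r, hr, s, hs, hz⟩ := IntermediateField.mem_adjoin_iff_div.mp z.2
    rw [hadj] at hr hs
    obtain ⟨a, rfl⟩ := hr
    obtain ⟨s, rfl⟩ := hs
    by_cases h0 : σ s = 0
    · refine ⟨0, 1, by simp, Subtype.ext ?_⟩
      simpa [h0] using hz
    · exact ⟨a, s, fun h ↦ h0 congr(($h : L)), Subtype.ext hz⟩
  have hxK : IntermediateField.adjoin k (Set.range (σK ∘ x)) = ⊤ := by
    apply IntermediateField.lift_injective K
    rw [IntermediateField.lift_adjoin, IntermediateField.lift_top, ← Set.range_comp]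
    rfl
  let M : IntermediateField K L := (K.toSubfield.comap (frobenius L p)).toIntermediateField
    fun c ↦ (c ^ p).2
  let f : M →+* K := ((frobenius L p).comp M.val.toRingHom).codRestrict K.toSubfield fun m ↦ m.2
  have hf : Function.Bijective f := by
    refine ⟨f.injective, fun z ↦ ?_⟩
    refine ⟨⟨(frobeniusEquiv L p).symm z, ?_⟩, Subtype.ext ?_⟩
    · change frobenius L p _ ∈ K
      rw [← frobeniusEquiv_apply, RingEquiv.apply_symm_apply]
      exact z.2
    · exact (frobeniusEquiv L p).apply_symm_apply z
  let e : M ≃+* K := RingEquiv.ofBijective f hf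
  have he (m : M) : algebraMap K M (e m) = m ^ p := Subtype.ext rfl
  have : CharP K p := (algebraMap K L).charP (algebraMap K L).injective p
  refine genericLinearForm_pow_ne_zero he hxK hv ?_
  let g : A →+* L ⊗[K] M :=
    (Algebra.TensorProduct.includeRight (R := K) (A := L) (B := M)).toRingHom.comp
      ((e.symm : K →+* M).comp (σK : A →+* K))
  have heval : (genericLinearFormPow x (p - 1)).eval₂ g (fun i ↦ v i ⊗ₜ[K] (1 : M)) =
      (v 0 ⊗ₜ[K] 1 + ∑ i : Fin n, v i.succ ⊗ₜ[K] e.symm (σK (x i)) : L ⊗[K] M) ^ (p - 1) := by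
    rw [genericLinearFormPow, ← coe_eval₂Hom]
    simp [g]
  rw [Function.comp_def, ← heval, eval₂_eq']
  refine Eq.trans ?_ <| sum_tmul_root_eq_zero he hφ hφ1 hσdiv
    (T := (genericLinearFormPow x (p - 1)).support) (w := fun m ↦ ∏ i, v i ^ m i)
    (q := fun m ↦ (genericLinearFormPow x (p - 1)).coeff m) fun b ↦ ?_
  · refine Finset.sum_congr rfl fun m _ ↦ ?_
    have : ∏ i, (v i ⊗ₜ[K] (1 : M)) ^ m i = (∏ i, v i ^ m i) ⊗ₜ[K] (1 : M) := by
      simp only [← Algebra.TensorProduct.includeLeft_apply (S := K), map_prod, map_pow]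
    rw [this]
    simp [g]
  · rw [← h b, mapCoeff, ← coe_eval₂Hom, map_sum]
    refine Finset.sum_congr rfl fun m _ ↦ ?_
    rw [coe_eval₂Hom, eval₂_monomial, mul_comm, Finsupp.prod_fintype _ _ (by simp)]
    rfl

open MvPolynomial in
theorem exists_ne_zero_map_mem_span_mapCoeff {k A : Type*} [Field k] [CommRing A] [Algebra k A]
    {p : ℕ} [Fact p.Prime] [CharP k p] {φ : A →+ A} (hφ : ∀ r a : A, φ (r ^ p * a) = r * φ a)
    (hφ1 : φ 1 = 1) {n : ℕ} {x : Fin n → A} (hx : Algebra.adjoin k (Set.range x) = ⊤) :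
    ∃ g : MvPolynomial (Fin (n + 1)) k, g ≠ 0 ∧ map (algebraMap k A) g ∈ Ideal.span
      (Set.range fun b ↦
        mapCoeff (φ.comp (AddMonoidHom.mulLeft b)) (genericLinearFormPow x (p - 1))) := by
  set J := Ideal.span (Set.range fun b ↦
    mapCoeff (φ.comp (AddMonoidHom.mulLeft b)) (genericLinearFormPow x (p - 1)))
  by_contra! h
  let S := (nonZeroDivisors (MvPolynomial (Fin (n + 1)) k)).map (map (algebraMap k A))
  obtain ⟨Q, hQ, hJQ, hQS⟩ := J.exists_le_prime_disjoint S <| by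
    rw [Set.disjoint_left]
    rintro _ hg ⟨g, hg0, rfl⟩
    exact h g (nonZeroDivisors.ne_zero hg0) hg
  let R := MvPolynomial (Fin (n + 1)) A ⧸ Q
  let L := AlgebraicClosure (FractionRing R)
  have : CharP L p := charP_of_injective_algebraMap (algebraMap k L).injective p
  let π : MvPolynomial (Fin (n + 1)) A →ₐ[k] L :=
    (IsScalarTower.toAlgHom k R L).comp (Ideal.Quotient.mkₐ k Q)
  have hπ (q) : π q = 0 ↔ q ∈ Q := by
    have hinj : Function.Injective (algebraMap R L) := by
      rw [IsScalarTower.algebraMap_eq R (FractionRing R) L]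
      exact (FaithfulSMul.algebraMap_injective (FractionRing R) L).comp (IsFractionRing.injective R _)
    change algebraMap R L (Ideal.Quotient.mk Q q) = 0 ↔ _
    rw [map_eq_zero_iff _ hinj, Ideal.Quotient.eq_zero_iff_mem]
  let σ : A →ₐ[k] L := π.comp (IsScalarTower.toAlgHom k A _)
  have hv : AlgebraicIndependent k fun i ↦ π (X i) := by
    rw [algebraicIndependent_iff]
    intro g hg
    by_contra hg0
    have hg' : π (map (algebraMap k A) g) = 0 := by
      rw [← hg]
      exact DFunLike.congr_fun (show (π.comp (mapAlgHom (Algebra.ofId k A))) = aeval _ by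
        ext; simp) g
    exact Set.disjoint_left.mp hQS ((hπ _).mp hg')
      ⟨g, mem_nonZeroDivisors_of_ne_zero hg0, rfl⟩
  obtain ⟨b, hb⟩ := exists_eval₂_mapCoeff_ne_zero hφ hφ1 hx σ hv
  refine hb (Eq.trans ?_ ((hπ _).mpr (hJQ (Ideal.subset_span ⟨b, rfl⟩))))
  rw [← coe_eval₂Hom]
  refine DFunLike.congr_fun (show eval₂Hom (σ : A →+* L) _ = (π : MvPolynomial (Fin (n + 1)) A →+* L) by
    ext <;> simp [σ]) _

open MvPolynomial in
theorem MvPolynomial.eval_mapCoeff {A ι : Type*} [CommRing A] [Finite ι] {p : ℕ} {φ : A →+ A}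
    (hφ : ∀ r a : A, φ (r ^ p * a) = r * φ a) (b : A) (q : MvPolynomial ι A) (v : ι → A) :
    eval v (mapCoeff (φ.comp (AddMonoidHom.mulLeft b)) q) =
      φ (b * eval (fun i ↦ v i ^ p) q) := by
  have := Fintype.ofFinite ι
  rw [mapCoeff, map_sum, eval_eq', Finset.mul_sum, map_sum]
  refine Finset.sum_congr rfl fun m _ ↦ ?_
  have h : b * (q.coeff m * ∏ i, (v i ^ p) ^ m i) = (∏ i, v i ^ m i) ^ p * (b * q.coeff m) := by
    simp only [← pow_mul, mul_comm p, ← Finset.prod_pow]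
    ring
  rw [h, hφ, eval_monomial, Finsupp.prod_fintype _ _ (by simp), mul_comm]
  rfl

theorem isFPure_quotient_span_singleton {A : Type*} [CommRing A] {p : ℕ} (hp : 0 < p)
    {φ : A →+ A} (hφ : ∀ r a : A, φ (r ^ p * a) = r * φ a) {l b : A}
    (hb : φ (b * l ^ (p - 1)) = 1) : IsFPure p (A ⧸ Ideal.span {l}) := by
  let ψ : A →+ A ⧸ Ideal.span {l} :=
    (Ideal.Quotient.mk (Ideal.span {l}) : A →+ A ⧸ Ideal.span {l}).comp
      (φ.comp (AddMonoidHom.mulLeft (b * l ^ (p - 1))))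
  let Ψ : A ⧸ Ideal.span {l} →+ A ⧸ Ideal.span {l} :=
    QuotientAddGroup.lift (Ideal.span {l}).toAddSubgroup ψ <| by
      intro z hz
      obtain ⟨a, rfl⟩ := Ideal.mem_span_singleton.mp hz
      have h : b * l ^ (p - 1) * (l * a) = l ^ p * (b * a) := by
        rw [← Nat.sub_add_cancel hp, pow_succ, Nat.add_sub_cancel]
        ring
      change Ideal.Quotient.mk (Ideal.span {l}) (φ (b * l ^ (p - 1) * (l * a))) = 0
      rw [h, hφ, Ideal.Quotient.eq_zero_iff_mem, Ideal.mem_span_singleton]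
      exact dvd_mul_right _ _
  have hΨ (a : A) : Ψ (Ideal.Quotient.mk _ a) =
      Ideal.Quotient.mk (Ideal.span {l}) (φ (b * l ^ (p - 1) * a)) := rfl
  refine ⟨Ψ, fun r z ↦ ?_, ?_⟩
  · obtain ⟨r, rfl⟩ := Ideal.Quotient.mk_surjective r
    obtain ⟨z, rfl⟩ := Ideal.Quotient.mk_surjective z
    rw [← map_pow, ← map_mul, hΨ, hΨ, mul_left_comm, hφ, map_mul]
  · rw [← map_one (Ideal.Quotient.mk _), hΨ, mul_one, hb]

open MvPolynomial in
theorem IsFPure.exists_hyperplane_section {k A : Type*} [Field k] [IsAlgClosed k] [CommRing A]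
    [Algebra k A] {p : ℕ} [Fact p.Prime] [CharP k p] (hA : IsFPure p A) {n : ℕ} {x : Fin n → A}
    (hx : Algebra.adjoin k (Set.range x) = ⊤) :
    ∃ g : MvPolynomial (Fin (n + 1)) k, g ≠ 0 ∧ ∀ c : Fin (n + 1) → k, eval c g ≠ 0 →
      IsFPure p (A ⧸ Ideal.span
        {algebraMap k A (c 0) + ∑ i : Fin n, algebraMap k A (c i.succ) * x i}) := by
  obtain ⟨φ, hφ, hφ1⟩ := hA
  obtain ⟨g, hg0, hg⟩ := exists_ne_zero_map_mem_span_mapCoeff (k := k) hφ hφ1 hx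
  refine ⟨map (frobenius k p) g, ?_, fun c hc ↦ ?_⟩
  · exact (map_ne_zero_iff _ (map_injective _ (frobenius_inj k p))).mpr hg0
  obtain ⟨v, rfl⟩ : ∃ v : Fin (n + 1) → k, c = fun i ↦ v i ^ p :=
    ⟨fun i ↦ (frobeniusEquiv k p).symm (c i),
      funext fun i ↦ ((frobeniusEquiv k p).apply_symm_apply (c i)).symm⟩
  set l := algebraMap k A (v 0 ^ p) + ∑ i : Fin n, algebraMap k A (v i.succ ^ p) * x i with hl
  have hv : eval v g ≠ 0 := by
    intro h
    apply hc
    have := congrArg (frobenius k p) h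
    rwa [map_zero, map_eval] at this
  let I : Ideal A :=
    { carrier := Set.range fun b ↦ φ (b * l ^ (p - 1))
      zero_mem' := ⟨0, by simp⟩
      add_mem' := by
        rintro _ _ ⟨b, rfl⟩ ⟨b', rfl⟩
        exact ⟨b + b', by simp [add_mul]⟩
      smul_mem' := by
        rintro a _ ⟨b, rfl⟩
        exact ⟨a ^ p * b, by simp [mul_assoc, hφ]⟩ }
  let ev : MvPolynomial (Fin (n + 1)) A →+* A := eval fun i ↦ algebraMap k A (v i)
  have hI : Ideal.span (Set.range fun b ↦
      mapCoeff (φ.comp (AddMonoidHom.mulLeft b)) (genericLinearFormPow x (p - 1))) ≤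
        I.comap ev := by
    rw [Ideal.span_le]
    rintro _ ⟨b, rfl⟩
    refine ⟨b, ?_⟩
    change _ = eval _ _
    rw [eval_mapCoeff hφ, genericLinearFormPow]
    simp [hl, mul_comm]
  have h1 : algebraMap k A (eval v g) ∈ I := by
    have := hI hg
    rw [Ideal.mem_comap] at this
    simpa [ev, map_eval, Function.comp_def] using this
  have h2 := I.eq_top_of_isUnit_mem h1 ((IsUnit.mk0 _ hv).map _)
  obtain ⟨b, hb⟩ : (1 : A) ∈ I := h2 ▸ Submodule.mem_top
  exact isFPure_quotient_span_singleton (Fact.out : p.Prime).pos hφ hb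

/-- Bertini's second theorem for `F`-purity (affine form): if `k` is an algebraically
closed field of characteristic `p > 0`, `I` is a radical ideal of `k[x₁,…,xₙ]` and
`A = k[x₁,…,xₙ]/I` is `F`-pure, then a general hyperplane section of `Spec A` is
`F`-pure: there is a nonzero polynomial `g ∈ k[T₀,…,Tₙ]` such that for every
`(c₀,…,cₙ) ∈ k^{n+1}` with `g c ≠ 0`, the ring `A/(c₀ + c₁x₁ + ⋯ + cₙxₙ)` is `F`-pure. -/
theorem bertini_fPure (k : Type*) [Field k] [IsAlgClosed k] (p : ℕ) (hp : p.Prime)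
    [CharP k p] (n : ℕ) (I : Ideal (MvPolynomial (Fin n) k)) (hrad : I.IsRadical)
    (hFP : IsFPure p (MvPolynomial (Fin n) k ⧸ I)) :
    ∃ g : MvPolynomial (Fin (n + 1)) k, g ≠ 0 ∧
      ∀ c : Fin (n + 1) → k, MvPolynomial.eval c g ≠ 0 →
        IsFPure p ((MvPolynomial (Fin n) k ⧸ I) ⧸
          Ideal.span {Ideal.Quotient.mk I
            (MvPolynomial.C (c 0) + ∑ i : Fin n, MvPolynomial.C (c i.succ) * MvPolynomial.X i)}) := by
  have : Fact p.Prime := ⟨hp⟩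
  have hx : Algebra.adjoin k (Set.range fun i : Fin n ↦ Ideal.Quotient.mk I (MvPolynomial.X i)) =
      ⊤ := by
    have := congrArg (Subalgebra.map (Ideal.Quotient.mkₐ k I))
      (MvPolynomial.adjoin_range_X (R := k) (σ := Fin n))
    rwa [AlgHom.map_adjoin, ← Set.range_comp, Algebra.map_top,
      (AlgHom.range_eq_top _).mpr (Ideal.Quotient.mkₐ_surjective k I)] at this
  obtain ⟨g, hg0, hg⟩ := hFP.exists_hyperplane_section hx
  refine ⟨g, hg0, fun c hc ↦ ?_⟩
  have hl : Ideal.Quotient.mk I (MvPolynomial.C (c 0) +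
        ∑ i : Fin n, MvPolynomial.C (c i.succ) * MvPolynomial.X i) =
      algebraMap k (MvPolynomial (Fin n) k ⧸ I) (c 0) +
        ∑ i : Fin n, algebraMap k (MvPolynomial (Fin n) k ⧸ I) (c i.succ) *
          Ideal.Quotient.mk I (MvPolynomial.X i) := by
    simp only [map_add, map_sum, map_mul]
    rfl
  rw [hl]
  exact hg c hc
end
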